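/- Let 0 < a < b and α₁, α₂ > 0 be such that the free Generalized Inverse Gaussian measure fGIG with density (√((x−a)(b−x))/(2πx))·(α₁ + α₂/(√(ab)·x)) on (a,b) is a probability measure, and let X be a random variable with this law. Then for every real r with |r| ≥ 1, the law of X^r (the pushforward under x ↦ x^r) belongs to the class UI. -/

import Mathlib

open MeasureTheory Set

/-- The Cauchy transform of a measure on `ℝ`, `G_μ(z) = ∫ (z-x)⁻¹ dμ(x)`. -/
noncomputable def cauchyTransform (μ : Measure ℝ) (z : ℂ) : ℂ :=
  ∫ x : ℝ, (z - (x : ℂ))⁻¹ ∂μ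

/-- The class UI: the right inverse of the Cauchy transform, defined on some triangular
domain `Λ_{γ,δ} = {w ∈ ℂ⁻ : γ|Re w| < -Im w, Im w > -δ}`, has a univalent (injective)
analytic continuation `F` to the whole lower half-plane. -/
def IsUI (μ : Measure ℝ) : Prop :=
  ∃ F : ℂ → ℂ,
    AnalyticOnNhd ℂ F {z : ℂ | z.im < 0} ∧
    Set.InjOn F {z : ℂ | z.im < 0} ∧
    ∃ γ : ℝ, 0 < γ ∧ ∃ δ : ℝ, 0 < δ ∧
      ∀ w : ℂ, γ * |w.re| < -w.im → -δ < w.im →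
        0 < (F w).im ∧ cauchyTransform μ (F w) = w

/-- The free Generalized Inverse Gaussian (fGIG) measure: the measure on `(a,b)`
with density `(√((x-a)(b-x))/(2πx))·(α₁ + α₂/(√(ab)·x))`. -/
noncomputable def fGIG (a b α₁ α₂ : ℝ) : Measure ℝ :=
  MeasureTheory.volume.withDensity
    (fun x => ENNReal.ofReal
      ((Set.Ioo a b).indicator
        (fun x => Real.sqrt ((x - a) * (b - x)) / (2 * Real.pi * x) *
          (α₁ + α₂ / (Real.sqrt (a * b) * x))) x))

section UnivalentInverse

open Filter Topology

theorem eventually_of_forall_ultrafilter {α β : Type*} {g : α → β} {S P : Set α} {l : Filter β}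
    (h : ∀ 𝒰 : Ultrafilter α, S ∈ 𝒰 → Tendsto g 𝒰 l → P ∈ 𝒰) :
    ∀ᶠ w in l, ∀ z ∈ S, g z = w → z ∈ P := by
  have : P ∈ comap g l ⊓ 𝓟 S := by
    rw [Filter.mem_iff_ultrafilter]
    intro 𝒰 h𝒰
    exact h 𝒰 (le_principal_iff.1 (h𝒰.trans inf_le_right))
      (tendsto_iff_comap.2 (h𝒰.trans inf_le_left))
  rw [mem_inf_principal, mem_comap] at this
  obtain ⟨t, ht, hsub⟩ := this
  filter_upwards [ht] with w hw z hz hzw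
  exact hsub (show z ∈ g ⁻¹' t by simpa [hzw] using hw) hz

/-- Near a critical point, a nonconstant holomorphic function is not injective: every nearby value
other than the critical value is taken at least twice. -/
theorem AnalyticAt.eventually_exists_two_preimages {g : ℂ → ℂ} {z₀ : ℂ} (hg : AnalyticAt ℂ g z₀)
    (hd : deriv g z₀ = 0) (hne : ¬ ∀ᶠ z in 𝓝 z₀, g z = g z₀) {U : Set ℂ} (hU : U ∈ 𝓝 z₀) :
    ∀ᶠ w in 𝓝 (g z₀), w ≠ g z₀ →
      ∃ z₁ ∈ U, ∃ z₂ ∈ U, z₁ ≠ z₂ ∧ g z₁ = w ∧ g z₂ = w := by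
  have hf : AnalyticAt ℂ (fun z => g z - g z₀) z₀ := hg.sub analyticAt_const
  have hne' : ¬ ∀ᶠ z in 𝓝 z₀, g z - g z₀ = 0 := by simpa [sub_eq_zero] using hne
  obtain ⟨n, h, hh, hh0, heq⟩ := hf.exists_eventuallyEq_pow_smul_nonzero_iff.2 hne'
  have hn0 : n ≠ 0 := by
    rintro rfl
    have := heq.self_of_nhds
    simp at this
    exact hh0 this.symm
  have hn1 : n ≠ 1 := by
    rintro rfl
    have h1 : HasDerivAt (fun z => (z - z₀) ^ 1 • h z) (h z₀) z₀ := by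
      have := ((hasDerivAt_id z₀).sub_const z₀).mul hh.differentiableAt.hasDerivAt
      simpa using! this
    have h2 := (h1.congr_of_eventuallyEq heq).add_const (g z₀)
    have h3 : deriv g z₀ = h z₀ := by simpa using h2.deriv
    exact hh0 (h3 ▸ hd)
  obtain ⟨c, hc⟩ := IsAlgClosed.exists_pow_nat_eq (h z₀) (Nat.pos_of_ne_zero hn0)
  have hc0 : c ≠ 0 := by
    rintro rfl
    exact hh0 (by rw [← hc, zero_pow hn0])
  set k : ℂ → ℂ := fun z => (h z / h z₀) ^ ((n : ℂ)⁻¹) with hk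
  have hkan : AnalyticAt ℂ k z₀ := by
    refine (hh.div analyticAt_const hh0).cpow analyticAt_const ?_
    simp [hh0]
  have hk0 : k z₀ = 1 := by simp [hk, hh0]
  set ψ : ℂ → ℂ := fun z => (z - z₀) * (c * k z) with hψ
  have hψan : AnalyticAt ℂ ψ z₀ :=
    (analyticAt_id.sub analyticAt_const).mul (analyticAt_const.mul hkan)
  have hψd : HasDerivAt ψ c z₀ := by
    have := ((hasDerivAt_id z₀).sub_const z₀).mul
      ((hkan.differentiableAt.hasDerivAt).const_mul c)
    simpa [hk0] using! this
  have hψs : HasStrictDerivAt ψ c z₀ := by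
    have := hψan.hasStrictDerivAt
    rwa [hψd.deriv] at this
  have hmap := hψs.map_nhds_eq hc0
  have hψ0 : ψ z₀ = 0 := by simp [hψ]
  have hpow : ∀ᶠ z in 𝓝 z₀, g z - g z₀ = ψ z ^ n := by
    filter_upwards [heq] with z hz
    rw [hz, hψ]
    simp only [smul_eq_mul, mul_pow, hc, hk]
    rw [Complex.cpow_nat_inv_pow _ hn0]
    field_simp
  have himg : ψ '' (U ∩ {z | g z - g z₀ = ψ z ^ n}) ∈ 𝓝 (0 : ℂ) := by
    rw [← hψ0, ← hmap]
    exact image_mem_map (inter_mem hU hpow)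
  obtain ⟨ε, hε, hball⟩ := Metric.mem_nhds_iff.1 himg
  have hnhds : Metric.ball (g z₀) (ε ^ n) ∈ 𝓝 (g z₀) := Metric.ball_mem_nhds _ (by positivity)
  filter_upwards [hnhds] with w hw hwne
  obtain ⟨ω, hω⟩ := IsAlgClosed.exists_pow_nat_eq (w - g z₀) (Nat.pos_of_ne_zero hn0)
  have hω0 : ω ≠ 0 := by
    rintro rfl
    rw [zero_pow hn0] at hω
    exact hwne (sub_eq_zero.1 hω.symm)
  have hωn : ‖ω‖ < ε := by
    rw [Metric.mem_ball, dist_eq_norm, ← hω, norm_pow] at hw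
    exact lt_of_pow_lt_pow_left₀ n hε.le hw
  have hprim := Complex.isPrimitiveRoot_exp n hn0
  set ρ := Complex.exp (2 * Real.pi * Complex.I / n) with hρ
  have hρn : ‖ρ‖ = 1 := hprim.norm'_eq_one hn0
  have hρ1 : ρ ≠ 1 := hprim.ne_one (by omega)
  obtain ⟨z₁, ⟨hz₁U, hz₁⟩, hz₁ω⟩ := hball (show ω ∈ Metric.ball (0 : ℂ) ε by simpa using hωn)
  obtain ⟨z₂, ⟨hz₂U, hz₂⟩, hz₂ω⟩ := hball (show ω * ρ ∈ Metric.ball (0 : ℂ) ε by simpa [hρn] using hωn)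
  refine ⟨z₁, hz₁U, z₂, hz₂U, ?_, ?_, ?_⟩
  · rintro rfl
    rw [hz₁ω] at hz₂ω
    exact hρ1 (mul_left_cancel₀ hω0 (by rw [← hz₂ω, mul_one]))
  · have : g z₁ - g z₀ = w - g z₀ := by rw [hz₁, hz₁ω, hω]
    exact sub_left_injective this
  · have : g z₂ - g z₀ = w - g z₀ := by rw [hz₂, hz₂ω, mul_pow, hprim.pow_eq_one, hω, mul_one]
    exact sub_left_injective this

/-- A proper holomorphic map that takes one value exactly once, at a regular point, takes every
value exactly once, at a regular point. -/
theorem existsUnique_preimage_of_proper {g : ℂ → ℂ} {D V : Set ℂ} (hD : IsOpen D)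
    (hDc : IsPreconnected D) (hVc : IsPreconnected V) (hg : DifferentiableOn ℂ g D)
    (hproper : ∀ 𝒰 : Ultrafilter ℂ, D ∈ 𝒰 → ∀ w ∈ V, Tendsto g 𝒰 (𝓝 w) → ∃ z ∈ D, ↑𝒰 ≤ 𝓝 z)
    (hbase : ∃ w ∈ V, ∃ z ∈ D, g z = w ∧ deriv g z ≠ 0 ∧ ∀ z' ∈ D, g z' = w → z' = z) :
    ∀ w ∈ V, ∃ z ∈ D, g z = w ∧ deriv g z ≠ 0 ∧ ∀ z' ∈ D, g z' = w → z' = z := by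
  set A : Set ℂ := {w | ∃ z ∈ D, g z = w ∧ deriv g z ≠ 0 ∧ ∀ z' ∈ D, g z' = w → z' = z} with hA
  have han : AnalyticOnNhd ℂ g D := hg.analyticOnNhd hD
  have hcont : ∀ z ∈ D, ContinuousAt g z := fun z hz => (han z hz).continuousAt
  have hlim : ∀ 𝒰 : Ultrafilter ℂ, ∀ w, Tendsto g 𝒰 (𝓝 w) → ∀ z ∈ D, ↑𝒰 ≤ 𝓝 z → g z = w :=
    fun 𝒰 w hw z hz hle => tendsto_nhds_unique ((hcont z hz).mono_left hle) hw
  have hopen : ∀ w ∈ V, w ∈ A → A ∈ 𝓝 w := by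
    rintro w hwV ⟨z, hz, hgz, hdz, huniq⟩
    have hs : HasStrictDerivAt g (deriv g z) z := (han z hz).hasStrictDerivAt
    have hleft := hs.eventually_left_inverse hdz
    have hdne : ∀ᶠ y in 𝓝 z, deriv g y ≠ 0 :=
      ((han z hz).deriv.continuousAt).eventually_ne hdz
    have hN : {y | hs.localInverse g (deriv g z) z hdz (g y) = y} ∩ {y | deriv g y ≠ 0} ∩ D ∈ 𝓝 z :=
      inter_mem (inter_mem hleft hdne) (hD.mem_nhds hz)
    set N := {y | hs.localInverse g (deriv g z) z hdz (g y) = y} ∩ {y | deriv g y ≠ 0} ∩ D with hNdef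
    have h1 : g '' N ∈ 𝓝 w := by
      rw [← hgz, ← hs.map_nhds_eq hdz]
      exact image_mem_map hN
    have h2 : ∀ᶠ w' in 𝓝 w, ∀ y ∈ D, g y = w' → y ∈ N := by
      refine eventually_of_forall_ultrafilter fun 𝒰 hD𝒰 hlim𝒰 => ?_
      obtain ⟨y, hy, hle⟩ := hproper 𝒰 hD𝒰 w hwV hlim𝒰
      have := huniq y hy (hlim 𝒰 w hlim𝒰 y hy hle)
      exact hle (this ▸ hN)
    filter_upwards [h1, h2] with w' hw1 hw2
    obtain ⟨y, hy, hyw⟩ := hw1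
    refine ⟨y, hy.2, hyw, hy.1.2, fun y' hy' hy'w => ?_⟩
    have hy'N := hw2 y' hy' hy'w
    rw [← hy'N.1.1, ← hy.1.1, hyw, hy'w]
  have hclosed : ∀ w ∈ V, w ∈ closure A → w ∈ A := by
    intro w hwV hcl
    by_contra hwA
    rw [mem_closure_iff_frequently] at hcl
    have hex : ∃ z ∈ D, g z = w := by
      by_contra! hno
      have : ∀ᶠ w' in 𝓝 w, ∀ y ∈ D, g y = w' → y ∈ (∅ : Set ℂ) := by
        refine eventually_of_forall_ultrafilter fun 𝒰 hD𝒰 hlim𝒰 => ?_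
        obtain ⟨y, hy, hle⟩ := hproper 𝒰 hD𝒰 w hwV hlim𝒰
        exact absurd (hlim 𝒰 w hlim𝒰 y hy hle) (hno y hy)
      obtain ⟨w', ⟨y, hy, hyw, -⟩, hw'⟩ := (hcl.and_eventually this).exists
      exact hw' y hy hyw
    obtain ⟨z, hz, hgz⟩ := hex
    have hnc : ∀ y ∈ D, g y = w → ¬ ∀ᶠ x in 𝓝 y, g x = g y := by
      intro y hy hyw hev
      have heq : EqOn g (fun _ => g y) D :=
        han.eqOn_of_preconnected_of_eventuallyEq analyticOnNhd_const hDc hy hev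
      obtain ⟨w₁, hw₁A⟩ := hcl.exists
      obtain ⟨z₁, hz₁, hgz₁, -⟩ := id hw₁A
      have : w₁ = w := by rw [← hgz₁, heq hz₁, hyw]
      exact hwA (this ▸ hw₁A)
    have hsurj : ∀ y ∈ D, g y = w → ∀ N ∈ 𝓝 y, ∀ᶠ w' in 𝓝 w, ∃ x ∈ N, g x = w' := by
      intro y hy hyw N hN
      have := ((han y hy).eventually_constant_or_nhds_le_map_nhds).resolve_left (hnc y hy hyw)
      rw [hyw] at this
      exact this (image_mem_map hN)
    have huniq : ∀ y ∈ D, g y = w → y = z := by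
      intro y hy hyw
      by_contra hyz
      obtain ⟨N₁, N₂, hN₁, hN₂, hzN, hyN, hdisj⟩ := t2_separation (Ne.symm hyz)
      have e1 := hsurj z hz hgz (N₁ ∩ D) (inter_mem (hN₁.mem_nhds hzN) (hD.mem_nhds hz))
      have e2 := hsurj y hy hyw (N₂ ∩ D) (inter_mem (hN₂.mem_nhds hyN) (hD.mem_nhds hy))
      obtain ⟨w', ⟨x, hx, hxw, -, hxu⟩, ⟨x₁, hx₁, hxw₁⟩, ⟨x₂, hx₂, hxw₂⟩⟩ :=
        (hcl.and_eventually (e1.and e2)).exists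
      have a1 := hxu x₁ hx₁.2 hxw₁
      have a2 := hxu x₂ hx₂.2 hxw₂
      exact Set.disjoint_left.1 hdisj hx₁.1 (by rw [a1, ← a2]; exact hx₂.1)
    have hd0 : deriv g z = 0 := by
      by_contra hd0
      exact hwA ⟨z, hz, hgz, hd0, huniq⟩
    have e := (han z hz).eventually_exists_two_preimages hd0 (hnc z hz hgz) (hD.mem_nhds hz)
    rw [hgz] at e
    obtain ⟨w', hw'A, hw'⟩ := (hcl.and_eventually e).exists
    have hne : w' ≠ w := fun h => hwA (h ▸ hw'A)
    obtain ⟨x, hx, hxw, -, hxu⟩ := hw'A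
    obtain ⟨z₁, hz₁, z₂, hz₂, hne12, h1, h2⟩ := hw' hne
    exact hne12 ((hxu z₁ hz₁ h1).trans (hxu z₂ hz₂ h2).symm)
  obtain ⟨w₀, hw₀V, hw₀⟩ := hbase
  have hsub : V ⊆ interior A := by
    refine hVc.subset_of_closure_inter_subset isOpen_interior
      ⟨w₀, hw₀V, mem_interior_iff_mem_nhds.2 (hopen w₀ hw₀V hw₀)⟩ ?_
    rintro w ⟨hw, hwV⟩
    exact mem_interior_iff_mem_nhds.2
      (hopen w hwV (hclosed w hwV (closure_mono interior_subset hw)))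
  exact fun w hw => (interior_subset (hsub hw) : w ∈ A)

/-- The inverse of a holomorphic function that takes every value of `V` exactly once, at a regular
point, is analytic, provided that the function is proper. -/
theorem exists_analytic_inverse_of_proper {g : ℂ → ℂ} {D V : Set ℂ} (hD : IsOpen D)
    (hV : IsOpen V)
    (hDc : IsPreconnected D) (hVc : IsPreconnected V) (hg : DifferentiableOn ℂ g D)
    (hproper : ∀ 𝒰 : Ultrafilter ℂ, D ∈ 𝒰 → ∀ w ∈ V, Tendsto g 𝒰 (𝓝 w) → ∃ z ∈ D, ↑𝒰 ≤ 𝓝 z)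
    (hbase : ∃ w ∈ V, ∃ z ∈ D, g z = w ∧ deriv g z ≠ 0 ∧ ∀ z' ∈ D, g z' = w → z' = z) :
    ∃ F : ℂ → ℂ, AnalyticOnNhd ℂ F V ∧ (∀ w ∈ V, F w ∈ D ∧ g (F w) = w) ∧
      ∀ w ∈ V, ∀ z ∈ D, g z = w → z = F w := by
  have key := existsUnique_preimage_of_proper hD hDc hVc hg hproper hbase
  choose! F hFD hgF hdF huniq using key
  have han : AnalyticOnNhd ℂ g D := hg.analyticOnNhd hD
  refine ⟨F, ?_, fun w hw => ⟨hFD w hw, hgF w hw⟩, huniq⟩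
  refine DifferentiableOn.analyticOnNhd (fun w hw => ?_) hV
  have hs : HasStrictDerivAt g (deriv g (F w)) (F w) := (han _ (hFD w hw)).hasStrictDerivAt
  have hinv := hs.to_localInverse (hdF w hw)
  rw [hgF w hw] at hinv
  have hright := hs.eventually_right_inverse (hdF w hw)
  rw [hgF w hw] at hright
  set G := hs.localInverse g (deriv g (F w)) (F w) (hdF w hw)
  have hG0 : G w = F w := by
    have h := (hs.eventually_left_inverse (hdF w hw)).self_of_nhds
    rwa [hgF w hw] at h
  have hGD : ∀ᶠ y in 𝓝 w, G y ∈ D :=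
    hinv.hasDerivAt.continuousAt.eventually (by rw [hG0]; exact hD.mem_nhds (hFD w hw))
  have heq : F =ᶠ[𝓝 w] G := by
    filter_upwards [hright, hGD, hV.mem_nhds hw] with y h1 h2 h3
    exact (huniq y h3 (G y) h2 h1).symm
  exact (hinv.hasDerivAt.congr_of_eventuallyEq heq).differentiableAt.differentiableWithinAt

/-- The plane cut along the two half-lines `(-∞, A]` and `[B, ∞)`. -/
def cutPlane (A B : ℝ) : Set ℂ := {z | z.im ≠ 0 ∨ (A < z.re ∧ z.re < B)}

/-- `N` takes values asymptotically in the half-plane `{w | 0 ≤ Re (u * w)}` along `l`. -/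
def AsympHalfPlane (u : ℂ) (N : ℂ → ℂ) (l : Filter ℂ) : Prop :=
  ∀ ε > 0, ∀ᶠ z in l, -ε * ‖N z‖ ≤ (u * N z).re

/-- A function `G` with the mapping properties of the Cauchy transform of a probability measure on
`[A, B]`, which extends through `(A, B)` from the upper to the lower half-plane with jump `N`. -/
structure ContinuationData (A B : ℝ) (G E N h : ℂ → ℂ) (c₀ : ℝ) : Prop where
  A_pos : 0 < A
  A_lt_B : A < B
  c₀_pos : 0 < c₀
  G_diff : ∀ z : ℂ, z.im ≠ 0 ∨ z.re < A ∨ B < z.re → DifferentiableAt ℂ G z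
  G_im_neg : ∀ z : ℂ, 0 < z.im → (G z).im < 0
  G_im_pos : ∀ z : ℂ, z.im < 0 → 0 < (G z).im
  G_left : ∀ x : ℝ, x < A → (G x).im = 0 ∧ (G x).re < 0
  G_right : ∀ x : ℝ, B < x → (G x).im = 0 ∧ 0 < (G x).re
  G_infty : Tendsto (fun z => z * G z) (cocompact ℂ) (𝓝 1)
  E_diff : DifferentiableOn ℂ E Complex.slitPlane
  E_upper : ∀ z : ℂ, 0 < z.im → G z = E z + N z / 2
  E_lower : ∀ z : ℂ, z.im < 0 → G z = E z - N z / 2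
  E_real : ∀ x : ℝ, A ≤ x → x ≤ B → (E x).im = 0
  E_left : (E A).re < 0
  E_right : 0 < (E B).re
  N_diff : DifferentiableOn ℂ N (cutPlane A B)
  N_left : Tendsto N (𝓝[cutPlane A B] A) (𝓝 0)
  N_right : Tendsto N (𝓝[cutPlane A B] B) (𝓝 0)
  N_mid : ∀ x : ℝ, A < x → x < B → (N x).re = 0 ∧ (N x).im < 0
  N_ne : ∀ z : ℂ, z.im < 0 → N z ≠ 0
  N_neg : ∀ x : ℝ, x < 0 → AsympHalfPlane (-Complex.I) N (𝓝[{z | z.im < 0}] x)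
  N_half_left : AsympHalfPlane (-1) N (𝓝[{z | z.im < 0}] A)
  N_half_right : ∀ x : ℝ, B ≤ x → AsympHalfPlane 1 N (𝓝[{z | z.im < 0}] x)
  N_sq : ∀ x : ℝ, 0 < x → x < A ∨ B < x →
    ∃ ν : ℝ, 0 < ν ∧ Tendsto (fun z => N z ^ 2) (𝓝[{z | z.im < 0}] x) (𝓝 ν)
  N_zero : Tendsto (fun z => ‖N z‖) (𝓝[{z | z.im < 0}] 0) atTop
  h_im : ∀ z : ℂ, z.im < 0 → 0 ≤ (h z).im
  h_ne : ∀ z : ℂ, z.im < 0 → h z ≠ 0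
  h_infty : Tendsto (fun z => ‖z * h z‖) (cocompact ℂ ⊓ 𝓟 {z | z.im < 0}) atTop
  N_infty : Tendsto (fun z => N z / h z) (cocompact ℂ ⊓ 𝓟 {z | z.im < 0}) (𝓝 c₀)

theorem Ultrafilter.le_cocompact_or_exists_le_nhds {X : Type*} [TopologicalSpace X]
    (𝒰 : Ultrafilter X) : (𝒰 : Filter X) ≤ cocompact X ∨ ∃ x, (𝒰 : Filter X) ≤ 𝓝 x := by
  by_cases h : ∃ K : Set X, IsCompact K ∧ K ∈ 𝒰
  · obtain ⟨K, hK, hKU⟩ := h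
    obtain ⟨x, -, hx⟩ := isCompact_iff_ultrafilter_le_nhds.1 hK 𝒰 (le_principal_iff.2 hKU)
    exact Or.inr ⟨x, hx⟩
  · push Not at h
    left
    intro s hs
    obtain ⟨K, hK, hKs⟩ := mem_cocompact.1 hs
    exact mem_of_superset (Ultrafilter.compl_mem_iff_notMem.2 (h K hK)) hKs

theorem AsympHalfPlane.re_nonneg {u : ℂ} {N f : ℂ → ℂ} {l l' : Filter ℂ} [l'.NeBot]
    (hN : AsympHalfPlane u N l) (hl : l' ≤ l) {L : ℂ} (hf : Tendsto f l' (𝓝 L))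
    (hNf : ∀ᶠ z in l', ∃ t : ℝ, 0 < t ∧ N z = t * f z) : 0 ≤ (u * L).re := by
  have key : ∀ ε > 0, -ε * ‖L‖ ≤ (u * L).re := by
    intro ε hε
    have h1 : Tendsto (fun z => -ε * ‖f z‖) l' (𝓝 (-ε * ‖L‖)) := hf.norm.const_mul _
    have h2 : Tendsto (fun z => (u * f z).re) l' (𝓝 (u * L).re) :=
      (Complex.continuous_re.tendsto _).comp (hf.const_mul u)
    refine le_of_tendsto_of_tendsto h1 h2 ?_
    filter_upwards [hl (hN ε hε), hNf] with z hz ⟨t, ht, hzt⟩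
    rw [hzt, norm_mul, Complex.norm_real, Real.norm_of_nonneg ht.le,
      show u * (t * f z) = t * (u * f z) by ring, Complex.re_ofReal_mul] at hz
    exact le_of_mul_le_mul_left (by linarith) ht
  have : Tendsto (fun ε : ℝ => -ε * ‖L‖) (𝓝[>] 0) (𝓝 0) := by
    have : Tendsto (fun ε : ℝ => -ε * ‖L‖) (𝓝 0) (𝓝 (-0 * ‖L‖)) :=
      (continuous_id.neg.mul continuous_const).tendsto _
    simpa using this.mono_left nhdsWithin_le_nhds
  exact le_of_tendsto this (eventually_mem_nhdsWithin.mono key)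

namespace ContinuationData

variable {A B : ℝ} {G E N h : ℂ → ℂ} {c₀ : ℝ}

theorem mem_slitPlane_of_mem_cutPlane (hA : 0 < A) {z : ℂ} (hz : z ∈ cutPlane A B) :
    z ∈ Complex.slitPlane := by
  rcases hz with hz | hz
  · exact Or.inr hz
  · exact Or.inl (hA.trans hz.1)

theorem isOpen_cutPlane : IsOpen (cutPlane A B) := by
  have h1 : IsOpen {z : ℂ | z.im ≠ 0} := isOpen_ne_fun Complex.continuous_im continuous_const
  have h2 : IsOpen {z : ℂ | A < z.re} := isOpen_lt continuous_const Complex.continuous_re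
  have h3 : IsOpen {z : ℂ | z.re < B} := isOpen_lt Complex.continuous_re continuous_const
  exact h1.union (h2.inter h3)

theorem isPreconnected_cutPlane (hAB : A < B) : IsPreconnected (cutPlane A B) := by
  have hmem : (((A + B) / 2 : ℝ) : ℂ) ∈ cutPlane A B := by
    right
    constructor <;> simp only [Complex.ofReal_re] <;> linarith
  refine (StarConvex.isPathConnected (a := (((A + B) / 2 : ℝ) : ℂ)) ?_ hmem).isConnected.isPreconnected
  intro y hy s t hs ht hst
  rcases ht.eq_or_lt with rfl | ht
  · obtain rfl : s = 1 := by linarith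
    simpa using hmem
  rcases hy with hy | hy
  · left
    simp [hy, ht.ne']
  · right
    simp only [Complex.add_re, Complex.smul_re, Complex.ofReal_re, smul_eq_mul]
    obtain rfl : s = 1 - t := by linarith
    constructor <;> nlinarith [hy.1, hy.2]

theorem tendsto_norm_mul (H : ContinuationData A B G E N h c₀) :
    Tendsto (fun z => ‖z * N z‖) (cocompact ℂ ⊓ 𝓟 {z | z.im < 0}) atTop := by
  have h1 := H.h_infty.atTop_mul_pos (norm_pos_iff.2 (by exact_mod_cast H.c₀_pos.ne'))
    H.N_infty.norm
  refine h1.congr' ?_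
  filter_upwards [mem_inf_of_right (mem_principal_self _)] with z hz
  have := H.h_ne z hz
  rw [← norm_mul]
  congr 1
  field_simp

theorem G_tendsto (H : ContinuationData A B G E N h c₀) {x : ℝ} (hx : x < A ∨ B < x)
    {l : Filter ℂ} (hl : l ≤ 𝓝 (x : ℂ)) : Tendsto G l (𝓝 (G x)) :=
  (H.G_diff x (Or.inr (by simpa using hx))).continuousAt.mono_left hl

theorem G_tendsto_zero (H : ContinuationData A B G E N h c₀) {l : Filter ℂ}
    (hl : l ≤ cocompact ℂ) : Tendsto G l (𝓝 0) := by
  have h1 : Tendsto (fun z : ℂ => z⁻¹) l (𝓝 0) := by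
    have := tendsto_inv₀_cobounded (α := ℂ)
    rw [Metric.cobounded_eq_cocompact] at this
    exact this.mono_left hl
  have h2 := h1.mul (H.G_infty.mono_left hl)
  have h3 : ∀ᶠ z in l, z ≠ 0 :=
    hl (isCompact_singleton (x := (0 : ℂ))).compl_mem_cocompact
  simp only [zero_mul] at h2
  refine h2.congr' ?_
  filter_upwards [h3] with z hz
  field_simp

theorem E_tendsto (H : ContinuationData A B G E N h c₀) {x : ℝ} (hx : A ≤ x) {l : Filter ℂ}
    (hl : l ≤ 𝓝 (x : ℂ)) : Tendsto E l (𝓝 (E x)) :=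
  ((H.E_diff.differentiableAt (Complex.isOpen_slitPlane.mem_nhds
    (Or.inl (by simpa using H.A_pos.trans_le hx)))).continuousAt).mono_left hl

theorem N_tendsto (H : ContinuationData A B G E N h c₀) {z : ℂ} (hz : z ∈ cutPlane A B)
    {l : Filter ℂ} (hl : l ≤ 𝓝 z) : Tendsto N l (𝓝 (N z)) :=
  (H.N_diff.differentiableAt (isOpen_cutPlane.mem_nhds hz)).continuousAt.mono_left hl

theorem diff (H : ContinuationData A B G E N h c₀) :
    DifferentiableOn ℂ (fun z => E z + N z / 2) (cutPlane A B) :=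
  (H.E_diff.mono fun _ hz => mem_slitPlane_of_mem_cutPlane H.A_pos hz).add (H.N_diff.div_const 2)

theorem lower_subset : {z : ℂ | z.im < 0} ⊆ cutPlane A B := fun _ hz => Or.inl (ne_of_lt hz)

theorem upper_subset : {z : ℂ | 0 < z.im} ⊆ cutPlane A B := fun _ hz => Or.inl (ne_of_gt hz)

theorem im_nonpos_of_le_nhds {l : Filter ℂ} [l.NeBot] {z : ℂ} (hl : l ≤ 𝓝 z)
    (hL : {z : ℂ | z.im < 0} ∈ l) : z.im ≤ 0 :=
  le_of_tendsto ((Complex.continuous_im.tendsto z).mono_left hl)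
    (mem_of_superset hL fun w (hw : w.im < 0) => hw.le)

theorem im_nonneg_of_le_nhds {l : Filter ℂ} [l.NeBot] {z : ℂ} (hl : l ≤ 𝓝 z)
    (hL : {z : ℂ | 0 < z.im} ∈ l) : 0 ≤ z.im :=
  ge_of_tendsto ((Complex.continuous_im.tendsto z).mono_left hl)
    (mem_of_superset hL fun w (hw : 0 < w.im) => hw.le)

/-- Along an ultrafilter in the lower half-plane on which `N` is a multiple of `G` with ratio in
the forbidden region, the limit point lies in the open lower half-plane. -/
theorem exists_le_nhds_of_ratio (H : ContinuationData A B G E N h c₀) {ℓ : ℂ} (hℓ : ℓ.re < -1 / 2)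
    (hℓ' : ℓ.im < 0) {𝒰 : Ultrafilter ℂ} (hL : {z : ℂ | z.im < 0} ∈ 𝒰) {τ : ℂ → ℝ} {τ₀ : ℝ}
    (hτ : ∀ᶠ z in (𝒰 : Filter ℂ), 0 < τ z ∧ τ z ≤ 1) (hτ₀ : Tendsto τ 𝒰 (𝓝 τ₀))
    (hN : ∀ᶠ z in (𝒰 : Filter ℂ), N z = τ z * (G z / ℓ)) :
    ∃ z : ℂ, z.im < 0 ∧ ↑𝒰 ≤ 𝓝 z := by
  have hℓ0 : ℓ ≠ 0 := by rintro rfl; simp at hℓ'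
  have hτc : Tendsto (fun z => (τ z : ℂ)) 𝒰 (𝓝 τ₀) :=
    (Complex.continuous_ofReal.tendsto _).comp hτ₀
  have hτ₀1 : τ₀ ≤ 1 := le_of_tendsto hτ₀ (hτ.mono fun z hz => hz.2)
  have hns : 0 < Complex.normSq ℓ := Complex.normSq_pos.2 hℓ0
  have hNpos : ∀ᶠ z in (𝒰 : Filter ℂ), ∃ t : ℝ, 0 < t ∧ N z = t * (G z / ℓ) := by
    filter_upwards [hτ, hN] with z h1 h2 using ⟨τ z, h1.1, h2⟩
  rcases 𝒰.le_cocompact_or_exists_le_nhds with hc | ⟨z, hz⟩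
  · exfalso
    have h1 : Tendsto (fun z => ‖z * N z‖) 𝒰 (𝓝 ‖τ₀ * (1 / ℓ)‖) := by
      refine Tendsto.norm ?_
      refine (hτc.mul ((H.G_infty.mono_left hc).div_const ℓ)).congr' ?_
      filter_upwards [hN] with z hz
      rw [hz]; ring
    exact not_tendsto_nhds_of_tendsto_atTop
      (H.tendsto_norm_mul.mono_left (le_inf hc (le_principal_iff.2 hL))) _ h1
  · refine ⟨z, ?_, hz⟩
    by_contra hzim
    have hzim0 : z.im = 0 := le_antisymm (im_nonpos_of_le_nhds hz hL) (not_lt.1 hzim)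
    obtain ⟨x, rfl⟩ : ∃ x : ℝ, z = x := ⟨z.re, Complex.ext (by simp) (by simp [hzim0])⟩
    have hz' : ↑𝒰 ≤ 𝓝[{z | z.im < 0}] (x : ℂ) := le_inf hz (le_principal_iff.2 hL)
    have hzc : ↑𝒰 ≤ 𝓝[cutPlane A B] (x : ℂ) := hz'.trans (nhdsWithin_mono _ lower_subset)
    have hNlim : ∀ {g : ℂ}, Tendsto G 𝒰 (𝓝 g) → Tendsto N 𝒰 (𝓝 (τ₀ * (g / ℓ))) := by
      intro g hg
      refine (hτc.mul (hg.div_const ℓ)).congr' ?_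
      filter_upwards [hN] with z hz using hz.symm
    have hGE : ∀ {n : ℂ}, A ≤ x → Tendsto N 𝒰 (𝓝 n) → Tendsto G 𝒰 (𝓝 (E x - n / 2)) := by
      intro n hx hn
      refine ((H.E_tendsto hx hz).sub (hn.div_const 2)).congr' ?_
      filter_upwards [hL] with z hz using (H.E_lower z hz).symm
    have hsq : 0 < x → x < A ∨ B < x → (G x).im = 0 ∧ (G x).re ≠ 0 → False := by
      intro hx0 hx hG
      obtain ⟨ν, hν, hνlim⟩ := H.N_sq x hx0 hx
      have h1 := (hNlim (H.G_tendsto hx hz)).pow 2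
      have h2 := tendsto_nhds_unique h1 (hνlim.mono_left hz')
      have hGr : G x = ((G x).re : ℂ) := Complex.ext (by simp) (by simp [hG.1])
      have h3 : ((τ₀ * (G x).re) ^ 2 : ℝ) = (ν : ℂ) * ℓ ^ 2 := by
        rw [← h2, hGr]; push_cast; field_simp; simp
      have h4 := congrArg Complex.im h3
      rw [Complex.ofReal_im, Complex.im_ofReal_mul, pow_two, Complex.mul_im] at h4
      have : 0 < ν * (ℓ.re * ℓ.im) := mul_pos hν (mul_pos_of_neg_of_neg (by linarith) hℓ')
      linarith
    rcases lt_trichotomy x 0 with hx | rfl | hx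
    · have h1 := (H.G_tendsto (Or.inl (hx.trans H.A_pos)) hz).div_const ℓ
      have h2 := (H.N_neg x hx).re_nonneg hz' h1 hNpos
      obtain ⟨h3, h4⟩ := H.G_left x (hx.trans H.A_pos)
      simp only [Complex.mul_re, Complex.neg_re, Complex.I_re, Complex.I_im, Complex.div_im, h3,
        zero_mul, zero_div, zero_sub, neg_mul, one_mul, sub_neg_eq_add, zero_add] at h2
      have : 0 < (G x).re * ℓ.im / Complex.normSq ℓ :=
        div_pos (mul_pos_of_neg_of_neg h4 hℓ') hns
      linarith
    · exact not_tendsto_nhds_of_tendsto_atTop (H.N_zero.mono_left (by simpa using hz')) _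
        (hNlim (H.G_tendsto (Or.inl H.A_pos) hz)).norm
    · rcases lt_trichotomy x A with hxA | rfl | hxA
      · exact hsq hx (Or.inl hxA) ⟨(H.G_left x hxA).1, (H.G_left x hxA).2.ne⟩
      · have h1 := (hGE le_rfl (H.N_left.mono_left hzc)).div_const ℓ
        have h2 := H.N_half_left.re_nonneg hz' h1 hNpos
        have h3 := H.E_real x le_rfl H.A_lt_B.le
        simp only [Complex.neg_re, Complex.div_re, zero_div, sub_zero, h3, zero_mul, add_zero, neg_mul,
          one_mul] at h2
        have : 0 < (E x).re * ℓ.re / Complex.normSq ℓ :=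
          div_pos (mul_pos_of_neg_of_neg H.E_left (by linarith)) hns
        linarith
      · rcases lt_trichotomy x B with hxB | rfl | hxB
        · have hxc : (x : ℂ) ∈ cutPlane A B := Or.inr ⟨by simpa using hxA, by simpa using hxB⟩
          have h1 := H.N_tendsto hxc hz
          have h2 := tendsto_nhds_unique h1 (hNlim (hGE hxA.le h1))
          have h3 := H.E_real x hxA.le hxB.le
          obtain ⟨h4, h5⟩ := H.N_mid x hxA hxB
          have h6 : N x * ℓ = τ₀ * (E x - N x / 2) := by
            nth_rw 1 [h2]; field_simp
          have h7 := congrArg Complex.im h6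
          rw [Complex.im_ofReal_mul, Complex.mul_im, Complex.sub_im, h3, h4,
            show (N x / 2).im = (N x).im / 2 by simp] at h7
          nlinarith
        · have h1 := (hGE hxA.le (H.N_right.mono_left hzc)).div_const ℓ
          have h2 := (H.N_half_right x le_rfl).re_nonneg hz' h1 hNpos
          have h3 := H.E_real x hxA.le le_rfl
          simp only [one_mul, Complex.div_re, zero_div, sub_zero, h3, zero_mul, add_zero] at h2
          have : (E x).re * ℓ.re / Complex.normSq ℓ < 0 :=
            div_neg_of_neg_of_pos (mul_neg_of_pos_of_neg H.E_right (by linarith)) hns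
          linarith
        · exact hsq hx (Or.inr hxB) ⟨(H.G_right x hxB).1, (H.G_right x hxB).2.ne'⟩

theorem isOpen_lower : IsOpen {z : ℂ | z.im < 0} :=
  isOpen_lt Complex.continuous_im continuous_const

theorem isPreconnected_lower : IsPreconnected {z : ℂ | z.im < 0} :=
  (convex_halfSpace_im_lt 0).isPreconnected

theorem neBot_lower (x : ℝ) : (𝓝[{z : ℂ | z.im < 0}] (x : ℂ)).NeBot := by
  rw [← mem_closure_iff_nhdsWithin_neBot, Complex.closure_setOfPred_im_lt]
  simp

theorem G_ne_of_lower (H : ContinuationData A B G E N h c₀) {z : ℂ} (hz : z.im < 0) : G z ≠ 0 := by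
  intro h0
  have := H.G_im_pos z hz
  simp [h0] at this

theorem ratio_ne (H : ContinuationData A B G E N h c₀) {ℓ : ℂ} (hℓ : ℓ.re < -1 / 2)
    (hℓ' : ℓ.im < 0) {z : ℂ} (hz : z.im < 0) {t : ℝ} (ht : 0 < t) (ht1 : t ≤ 1) :
    N z ≠ t * (G z / ℓ) := by
  intro hNz
  have hℓ0 : ℓ ≠ 0 := by rintro rfl; simp at hℓ'
  set f : ℂ → ℂ := fun z => N z * ℓ / G z with hf
  set T : Set ℂ := {z | z.im < 0 ∧ ∃ t : ℝ, 0 < t ∧ t ≤ 1 ∧ f z = t} with hT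
  have hfN : ∀ {z : ℂ} {t : ℝ}, z.im < 0 → (f z = t ↔ N z = t * (G z / ℓ)) := by
    intro z t hz
    have := H.G_ne_of_lower hz
    rw [hf]
    dsimp only
    rw [div_eq_iff this, ← mul_div_assoc, eq_div_iff hℓ0]
  set τ : ℂ → ℝ := fun z => (f z).re with hτ
  have hTτ : ∀ z ∈ T, 0 < τ z ∧ τ z ≤ 1 ∧ f z = τ z := by
    rintro z ⟨-, t, h0, h1, h2⟩
    have : τ z = t := by simp [hτ, h2]
    rw [this]; exact ⟨h0, h1, h2⟩
  have hne : (τ '' T).Nonempty := ⟨_, z, ⟨hz, t, ht, ht1, (hfN hz).2 hNz⟩, rfl⟩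
  have hbdd : BddBelow (τ '' T) := ⟨0, by rintro _ ⟨z, hz, rfl⟩; exact (hTτ z hz).1.le⟩
  obtain ⟨u, -, hu, huT⟩ := exists_seq_tendsto_sInf hne hbdd
  set τ₀ := sInf (τ '' T) with hτ₀
  choose v hvT hvu using huT
  set 𝒰 : Ultrafilter ℂ := (hyperfilter ℕ).map v with h𝒰
  have h𝒰T : T ∈ 𝒰 := Filter.univ_mem' (f := (hyperfilter ℕ : Filter ℕ)) hvT
  have h𝒰L : {z : ℂ | z.im < 0} ∈ 𝒰 := mem_of_superset h𝒰T fun z hz => hz.1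
  have hlim : Tendsto τ 𝒰 (𝓝 τ₀) := by
    rw [h𝒰, Ultrafilter.coe_map, tendsto_map'_iff]
    have : τ ∘ v = u := funext hvu
    rw [this]
    exact hu.mono_left Nat.hyperfilter_le_atTop
  obtain ⟨y, hy, hle⟩ := H.exists_le_nhds_of_ratio hℓ hℓ' h𝒰L
    (mem_of_superset h𝒰T fun z hz => ⟨(hTτ z hz).1, (hTτ z hz).2.1⟩) hlim
    (mem_of_superset h𝒰T fun z hz => (hfN hz.1).1 (hTτ z hz).2.2)
  have hfd : DifferentiableOn ℂ f {z | z.im < 0} := by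
    refine DifferentiableOn.div ((H.N_diff.mono lower_subset).mul_const ℓ)
      (fun z hz => (H.G_diff z (Or.inl (ne_of_lt hz))).differentiableWithinAt) ?_
    exact fun z hz => H.G_ne_of_lower hz
  have hfan := hfd.analyticOnNhd isOpen_lower
  have hfy : f y = τ₀ := by
    have h1 : Tendsto f 𝒰 (𝓝 (f y)) := (hfan y hy).continuousAt.mono_left hle
    have h2 : Tendsto (fun z => (τ z : ℂ)) 𝒰 (𝓝 τ₀) :=
      (Complex.continuous_ofReal.tendsto _).comp hlim
    exact tendsto_nhds_unique (h1.congr' (mem_of_superset h𝒰T fun z hz => (hTτ z hz).2.2)) h2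
  have hτ₀1 : τ₀ ≤ 1 :=
    le_of_tendsto hlim (mem_of_superset h𝒰T fun z hz => (hTτ z hz).2.1)
  have hτ₀0 : 0 ≤ τ₀ :=
    ge_of_tendsto hlim (mem_of_superset h𝒰T fun z hz => (hTτ z hz).1.le)
  have hτ₀pos : 0 < τ₀ := by
    refine hτ₀0.lt_of_ne fun h0 => H.N_ne y hy ?_
    rw [(hfN hy).1 hfy, ← h0]
    simp
  rcases (hfan y hy).eventually_constant_or_nhds_le_map_nhds with hconst | hopen
  · have heq : EqOn f (fun _ => f y) {z | z.im < 0} :=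
      hfan.eqOn_of_preconnected_of_eventuallyEq analyticOnNhd_const isPreconnected_lower hy hconst
    have := neBot_lower 0
    set 𝒱 := Ultrafilter.of (𝓝[{z : ℂ | z.im < 0}] ((0 : ℝ) : ℂ))
    have h𝒱 : ↑𝒱 ≤ 𝓝[{z : ℂ | z.im < 0}] ((0 : ℝ) : ℂ) := Ultrafilter.of_le _
    have h𝒱L : {z : ℂ | z.im < 0} ∈ 𝒱 := h𝒱 self_mem_nhdsWithin
    obtain ⟨x, hx, hx'⟩ := H.exists_le_nhds_of_ratio (τ := fun _ => τ₀) hℓ hℓ' h𝒱L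
      (Filter.Eventually.of_forall fun _ => ⟨hτ₀pos, hτ₀1⟩) tendsto_const_nhds
      (mem_of_superset h𝒱L fun z hz => (hfN hz).1 ((heq hz).trans hfy))
    have : x = ((0 : ℝ) : ℂ) :=
      tendsto_nhds_unique (f := id) (l := (𝒱 : Filter ℂ)) hx' (h𝒱.trans nhdsWithin_le_nhds)
    simp [this] at hx
  · rw [hfy] at hopen
    have himg : f '' {z | z.im < 0} ∈ 𝓝 (τ₀ : ℂ) :=
      hopen (image_mem_map (isOpen_lower.mem_nhds hy))
    have hev : ∀ᶠ s : ℝ in 𝓝 τ₀, (s : ℂ) ∈ f '' {z | z.im < 0} :=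
      (Complex.continuous_ofReal.tendsto τ₀).eventually himg
    have hev' : ∀ᶠ s : ℝ in 𝓝[<] τ₀, (s : ℂ) ∈ f '' {z | z.im < 0} ∧ 0 < s ∧ s < τ₀ := by
      filter_upwards [nhdsWithin_le_nhds hev, nhdsWithin_le_nhds (lt_mem_nhds hτ₀pos),
        self_mem_nhdsWithin] with s h1 h2 h3 using ⟨h1, h2, h3⟩
    obtain ⟨s, ⟨x, hx, hxs⟩, hs0, hs1⟩ := hev'.exists
    have hmem : s ∈ τ '' T := ⟨x, ⟨hx, s, hs0, hs1.le.trans hτ₀1, hxs⟩, by simp [hτ, hxs]⟩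
    exact absurd (csInf_le hbdd hmem) (not_le.2 hs1)

theorem add_ne_zero (H : ContinuationData A B G E N h c₀) {z : ℂ} (hz : z.im < 0) :
    G z + N z ≠ 0 := by
  intro h0
  set f : ℂ → ℂ := fun z => G z / N z with hf
  have hfd : DifferentiableOn ℂ f {z | z.im < 0} :=
    DifferentiableOn.div (fun z hz => (H.G_diff z (Or.inl (ne_of_lt hz))).differentiableWithinAt)
      (H.N_diff.mono lower_subset) fun z hz => H.N_ne z hz
  have hfan := hfd.analyticOnNhd isOpen_lower
  have hfz : f z = -1 := by
    rw [hf]; dsimp only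
    rw [div_eq_iff (H.N_ne z hz)]
    linear_combination h0
  have hQ : ∀ {y : ℂ}, y.im < 0 → ¬ ((f y).re < -1 / 2 ∧ (f y).im < 0) := by
    rintro y hy ⟨h1, h2⟩
    refine H.ratio_ne h1 h2 hy one_pos le_rfl ?_
    have hG := H.G_ne_of_lower hy
    have hN := H.N_ne y hy
    simp only [hf]
    field_simp
    simp
  rcases (hfan z hz).eventually_constant_or_nhds_le_map_nhds with hconst | hopen
  · have heq : EqOn f (fun _ => f z) {z | z.im < 0} :=
      hfan.eqOn_of_preconnected_of_eventuallyEq analyticOnNhd_const isPreconnected_lower hz hconst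
    have hA := H.A_pos
    have := neBot_lower A
    have h1 : Tendsto G (𝓝[{z : ℂ | z.im < 0}] (A : ℂ)) (𝓝 (E A - 0 / 2)) := by
      refine ((H.E_tendsto le_rfl nhdsWithin_le_nhds).sub
        ((H.N_left.mono_left (nhdsWithin_mono _ lower_subset)).div_const 2)).congr' ?_
      filter_upwards [self_mem_nhdsWithin] with z hz using (H.E_lower z hz).symm
    have h2 : Tendsto G (𝓝[{z : ℂ | z.im < 0}] (A : ℂ)) (𝓝 (-0)) := by
      refine (H.N_left.mono_left (nhdsWithin_mono _ lower_subset)).neg.congr' ?_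
      filter_upwards [self_mem_nhdsWithin] with y hy
      have h3 := (heq hy).trans hfz
      simp only [hf] at h3
      rw [div_eq_iff (H.N_ne y hy)] at h3
      rw [h3]; ring
    have h3 := congrArg Complex.re (tendsto_nhds_unique h1 h2)
    have := H.E_left
    simp at h3
    linarith
  · rw [hfz] at hopen
    have himg : f '' {z | z.im < 0} ∈ 𝓝 (-1 : ℂ) :=
      hopen (image_mem_map (isOpen_lower.mem_nhds hz))
    obtain ⟨ε, hε, hball⟩ := Metric.mem_nhds_iff.1 himg
    obtain ⟨y, hy, hy'⟩ := hball (show (-1 - (ε / 2 : ℝ) * Complex.I : ℂ) ∈ Metric.ball (-1 : ℂ) ε by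
      rw [Metric.mem_ball, dist_eq_norm]
      rw [show (-1 - (ε / 2 : ℝ) * Complex.I - -1 : ℂ) = -((ε / 2 : ℝ) * Complex.I) by ring,
        norm_neg, norm_mul, Complex.norm_I, Complex.norm_real, mul_one, Real.norm_eq_abs,
        abs_of_pos (half_pos hε)]
      linarith)
    refine hQ hy ?_
    rw [hy']
    norm_num
    positivity

/-- The continuation of `G` through `(A, B)` has a nonzero limit at `A`, at `B`, and is nonzero on
`(A, B)`. -/
theorem tendsto_Icc (H : ContinuationData A B G E N h c₀) {x : ℝ} (hxA : A ≤ x) (hxB : x ≤ B)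
    {l : Filter ℂ} (hl : l ≤ 𝓝[cutPlane A B] (x : ℂ)) :
    ∃ g : ℂ, Tendsto (fun z => E z + N z / 2) l (𝓝 g) ∧ g ≠ 0 ∧
      (x = A ∨ x = B → g.im = 0) := by
  have hE := H.E_tendsto hxA (hl.trans nhdsWithin_le_nhds)
  have hEr := H.E_real x hxA hxB
  rcases hxA.eq_or_lt with rfl | hxA
  · refine ⟨_, hE.add ((H.N_left.mono_left hl).div_const 2), fun h0 => ?_, fun _ => by simpa using hEr⟩
    have := H.E_left
    simp at h0
    simp [h0] at this
  rcases hxB.eq_or_lt with rfl | hxB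
  · refine ⟨_, hE.add ((H.N_right.mono_left hl).div_const 2), fun h0 => ?_, fun _ => by simpa using hEr⟩
    have := H.E_right
    simp at h0
    simp [h0] at this
  · have hxc : (x : ℂ) ∈ cutPlane A B := Or.inr ⟨by simpa using hxA, by simpa using hxB⟩
    refine ⟨_, hE.add ((H.N_tendsto hxc (hl.trans nhdsWithin_le_nhds)).div_const 2), fun h0 => ?_,
      fun h => ?_⟩
    · have h1 := congrArg Complex.im h0
      have h2 := (H.N_mid x hxA hxB).2
      simp [hEr] at h1
      linarith
    · rcases h with h | h <;> linarith

theorem cases_of_mem_cutPlane {𝒰 : Ultrafilter ℂ} (hD : cutPlane A B ∈ 𝒰) :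
    {z : ℂ | 0 < z.im} ∈ 𝒰 ∨ {z : ℂ | z.im < 0} ∈ 𝒰 ∨
      ∃ x : ℝ, A ≤ x ∧ x ≤ B ∧ ↑𝒰 ≤ 𝓝 (x : ℂ) := by
  have : cutPlane A B ⊆ {z : ℂ | 0 < z.im} ∪ ({z : ℂ | z.im < 0} ∪
      ((fun x : ℝ => (x : ℂ)) '' Icc A B)) := by
    rintro z hz
    rcases lt_trichotomy z.im 0 with h | h | h
    · exact Or.inr (Or.inl h)
    · rcases hz with hz | hz
      · exact absurd h hz
      · exact Or.inr (Or.inr ⟨z.re, ⟨hz.1.le, hz.2.le⟩, Complex.ext (by simp) (by simp [h])⟩)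
    · exact Or.inl h
  rcases Ultrafilter.union_mem_iff.1 (mem_of_superset hD this) with h | h
  · exact Or.inl h
  rcases Ultrafilter.union_mem_iff.1 h with h | h
  · exact Or.inr (Or.inl h)
  · obtain ⟨_, ⟨x, hx, rfl⟩, hle⟩ := isCompact_iff_ultrafilter_le_nhds.1
      (isCompact_Icc.image Complex.continuous_ofReal) 𝒰 (le_principal_iff.2 h)
    exact Or.inr (Or.inr ⟨x, hx.1, hx.2, hle⟩)

theorem exists_ofReal {z : ℂ} (hz : z.im = 0) : ∃ x : ℝ, z = x :=
  ⟨z.re, Complex.ext (by simp) (by simp [hz])⟩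

/-- The continuation of `G` is small and negative imaginary only near infinity in the upper
half-plane. -/
theorem le_cocompact_of_tendsto_zero (H : ContinuationData A B G E N h c₀) {𝒰 : Ultrafilter ℂ}
    (hD : cutPlane A B ∈ 𝒰) (hlim : Tendsto (fun z => E z + N z / 2) 𝒰 (𝓝 0))
    (himag : ∀ᶠ z in (𝒰 : Filter ℂ), (E z + N z / 2).re = 0 ∧ (E z + N z / 2).im < 0) :
    ↑𝒰 ≤ cocompact ℂ ∧ {z : ℂ | 0 < z.im} ∈ 𝒰 := by
  have hIcc : ∀ x : ℝ, A ≤ x → x ≤ B → ↑𝒰 ≤ 𝓝 (x : ℂ) → False := by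
    intro x hA hB hx
    obtain ⟨g, hg, hg0, -⟩ := H.tendsto_Icc hA hB (le_inf hx (le_principal_iff.2 hD))
    exact hg0 (tendsto_nhds_unique hg hlim)
  rcases cases_of_mem_cutPlane hD with hU | hL | ⟨x, hxA, hxB, hx⟩
  · have hG : Tendsto G 𝒰 (𝓝 0) := hlim.congr' (mem_of_superset hU fun z hz => (H.E_upper z hz).symm)
    rcases 𝒰.le_cocompact_or_exists_le_nhds with hc | ⟨z, hz⟩
    · exact ⟨hc, hU⟩
    exfalso
    rcases (im_nonneg_of_le_nhds hz hU).eq_or_lt with h0 | h0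
    · obtain ⟨x, rfl⟩ := exists_ofReal h0.symm
      rcases lt_or_ge x A with hxA | hxA
      · have := tendsto_nhds_unique hG (H.G_tendsto (Or.inl hxA) hz)
        have h1 := (H.G_left x hxA).2
        simp [← this] at h1
      rcases lt_or_ge B x with hxB | hxB
      · have := tendsto_nhds_unique hG (H.G_tendsto (Or.inr hxB) hz)
        have h1 := (H.G_right x hxB).2
        simp [← this] at h1
      exact hIcc x hxA hxB hz
    · have := tendsto_nhds_unique hG ((H.G_diff z (Or.inl h0.ne')).continuousAt.mono_left hz)
      have h1 := H.G_im_neg z h0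
      simp [← this] at h1
  · exfalso
    have hGN : ∀ᶠ z in (𝒰 : Filter ℂ), E z + N z / 2 = G z + N z :=
      mem_of_superset hL fun z hz => by
        rw [mem_ofPred_eq, H.E_lower z hz]; ring
    have hNlim : ∀ {g : ℂ}, Tendsto G 𝒰 (𝓝 g) → Tendsto N 𝒰 (𝓝 (-g)) := by
      intro g hg
      have := hlim.sub hg
      rw [zero_sub] at this
      refine this.congr' (hGN.mono fun z hz => ?_)
      rw [hz]; ring
    rcases 𝒰.le_cocompact_or_exists_le_nhds with hc | ⟨z, hz⟩
    · have hcL : ↑𝒰 ≤ cocompact ℂ ⊓ 𝓟 {z : ℂ | z.im < 0} := le_inf hc (le_principal_iff.2 hL)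
      have h1 : Tendsto (fun z => (z * N z)⁻¹) 𝒰 (𝓝 0) := by
        have := (H.tendsto_norm_mul.mono_left hcL)
        rw [tendsto_norm_atTop_iff_cobounded] at this
        exact tendsto_inv₀_cobounded.comp this
      have h2 : Tendsto (fun z => 1 + (z * G z) * (z * N z)⁻¹) 𝒰 (𝓝 (1 + 1 * 0)) :=
        ((H.G_infty.mono_left hc).mul h1).const_add 1
      have h3 := h2.mul (H.N_infty.mono_left hcL)
      have hz0 : ∀ᶠ z : ℂ in (𝒰 : Filter ℂ), z ≠ 0 :=
        hc (isCompact_singleton (x := (0 : ℂ))).compl_mem_cocompact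
      have h4 : Tendsto (fun z => (E z + N z / 2) / h z) 𝒰 (𝓝 c₀) := by
        simp only [mul_zero, add_zero, one_mul] at h3
        refine h3.congr' ?_
        filter_upwards [hGN, hz0, hL] with z h5 h6 h7
        have := H.N_ne z h7
        have := H.h_ne z h7
        rw [h5]; field_simp; ring
      have h5 := h4.inv₀ (by exact_mod_cast H.c₀_pos.ne')
      have h6 : 0 < ((c₀ : ℂ)⁻¹).re := by
        rw [← Complex.ofReal_inv]; exact inv_pos.2 H.c₀_pos
      have h7 := ((Complex.continuous_re.tendsto _).comp h5).eventually (lt_mem_nhds h6)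
      obtain ⟨z, h8, ⟨h9, h10⟩, h11⟩ := (h7.and (himag.and hL)).exists
      have h13 := H.h_im z h11
      simp only [Function.comp, inv_div, Complex.div_re, h9, mul_zero, zero_div, zero_add] at h8
      have : (h z).im * (E z + N z / 2).im / Complex.normSq (E z + N z / 2) ≤ 0 :=
        div_nonpos_of_nonpos_of_nonneg (mul_nonpos_of_nonneg_of_nonpos h13 h10.le)
          (Complex.normSq_nonneg _)
      linarith
    rcases (im_nonpos_of_le_nhds hz hL).eq_or_lt with h0 | h0
    · obtain ⟨x, rfl⟩ := exists_ofReal h0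
      have hxL : ↑𝒰 ≤ 𝓝[{z : ℂ | z.im < 0}] (x : ℂ) := le_inf hz (le_principal_iff.2 hL)
      rcases lt_or_ge x A with hxA | hxA
      · have hN := hNlim (H.G_tendsto (Or.inl hxA) hz)
        obtain ⟨g0, g1⟩ := H.G_left x hxA
        obtain ⟨g, hg⟩ := exists_ofReal g0
        rw [hg, Complex.ofReal_re] at g1
        rw [hg, ← Complex.ofReal_neg] at hN
        have hNi : Tendsto (fun z => (N z)⁻¹) 𝒰 (𝓝 ((-g)⁻¹ : ℝ)) := by
          rw [Complex.ofReal_inv]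
          exact hN.inv₀ (by exact_mod_cast (neg_pos.2 g1).ne')
        have hQ : Tendsto (fun z => -1 + (E z + N z / 2) * (N z)⁻¹) 𝒰
            (𝓝 (-1 + 0 * ((-g)⁻¹ : ℝ))) := (hlim.mul hNi).const_add _
        have e1 := ((Complex.continuous_re.tendsto _).comp hNi).eventually
          (lt_mem_nhds (show 0 < (((-g)⁻¹ : ℝ) : ℂ).re by simpa using g1))
        have e2 := ((Complex.continuous_re.tendsto _).comp hQ).eventually
          (gt_mem_nhds (show (-1 + 0 * ((-g)⁻¹ : ℝ) : ℂ).re < -1 / 2 by norm_num))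
        obtain ⟨z, h1, h2, ⟨h3, h4⟩, h5, h6⟩ := (e1.and (e2.and (himag.and (hGN.and hL)))).exists
        refine H.ratio_ne (ℓ := -1 + (E z + N z / 2) * (N z)⁻¹) h2 ?_ h6 one_pos le_rfl ?_
        · simp only [Function.comp] at h1
          rw [Complex.add_im, Complex.mul_im, h3]
          simp only [Complex.neg_im, Complex.one_im, neg_zero, zero_mul, zero_add]
          exact mul_neg_of_neg_of_pos h4 h1
        · have := H.N_ne z h6
          have h7 : -1 + (E z + N z / 2) * (N z)⁻¹ = G z / N z := by
            rw [h5]; field_simp; ring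
          have := H.G_ne_of_lower h6
          rw [h7]
          field_simp
          simp
      rcases lt_or_ge B x with hxB | hxB
      · have h1 := (H.N_half_right x hxB.le).re_nonneg hxL (hNlim (H.G_tendsto (Or.inr hxB) hz))
          (Filter.Eventually.of_forall fun z => ⟨1, one_pos, by simp⟩)
        have h2 := (H.G_right x hxB).2
        simp at h1
        linarith
      exact hIcc x hxA hxB hz
    · have h1 : Tendsto (fun z => G z + N z) 𝒰 (𝓝 (G z + N z)) :=
        ((H.G_diff z (Or.inl h0.ne)).continuousAt.mono_left hz).add
          (H.N_tendsto (lower_subset h0) hz)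
      exact H.add_ne_zero h0 (tendsto_nhds_unique h1 (hlim.congr' hGN))
  · exact (hIcc x hxA hxB hx).elim

/-- The continuation of `G` is proper over the lower half-plane. -/
theorem exists_le_nhds_of_tendsto (H : ContinuationData A B G E N h c₀) {𝒰 : Ultrafilter ℂ}
    (hD : cutPlane A B ∈ 𝒰) {w : ℂ} (hw : w.im < 0)
    (hlim : Tendsto (fun z => E z + N z / 2) 𝒰 (𝓝 w)) : ∃ z ∈ cutPlane A B, ↑𝒰 ≤ 𝓝 z := by
  have hIcc : ∀ x : ℝ, A ≤ x → x ≤ B → ↑𝒰 ≤ 𝓝 (x : ℂ) → ∃ z ∈ cutPlane A B, ↑𝒰 ≤ 𝓝 z := by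
    intro x hA hB hx
    obtain ⟨g, hg, -, hg0⟩ := H.tendsto_Icc hA hB (le_inf hx (le_principal_iff.2 hD))
    rw [tendsto_nhds_unique hg hlim] at hg0
    refine ⟨x, Or.inr ⟨?_, ?_⟩, hx⟩
    · exact hA.lt_of_ne fun h => hw.ne (hg0 (Or.inl h.symm))
    · exact hB.lt_of_ne fun h => hw.ne (hg0 (Or.inr h))
  rcases cases_of_mem_cutPlane hD with hU | hL | ⟨x, hxA, hxB, hx⟩
  · have hG : Tendsto G 𝒰 (𝓝 w) := hlim.congr' (mem_of_superset hU fun z hz => (H.E_upper z hz).symm)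
    rcases 𝒰.le_cocompact_or_exists_le_nhds with hc | ⟨z, hz⟩
    · rw [tendsto_nhds_unique hG (H.G_tendsto_zero hc)] at hw
      simp at hw
    rcases (im_nonneg_of_le_nhds hz hU).eq_or_lt with h0 | h0
    · obtain ⟨x, rfl⟩ := exists_ofReal h0.symm
      rcases lt_or_ge x A with hxA | hxA
      · rw [tendsto_nhds_unique hG (H.G_tendsto (Or.inl hxA) hz)] at hw
        exact absurd (H.G_left x hxA).1 hw.ne
      rcases lt_or_ge B x with hxB | hxB
      · rw [tendsto_nhds_unique hG (H.G_tendsto (Or.inr hxB) hz)] at hw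
        exact absurd (H.G_right x hxB).1 hw.ne
      exact hIcc x hxA hxB hz
    · exact ⟨z, upper_subset h0, hz⟩
  · have hGN : ∀ᶠ z in (𝒰 : Filter ℂ), E z + N z / 2 = G z + N z :=
      mem_of_superset hL fun z hz => by
        rw [mem_ofPred_eq, H.E_lower z hz]; ring
    have hNlim : ∀ {g : ℂ}, Tendsto G 𝒰 (𝓝 g) → Tendsto N 𝒰 (𝓝 (w - g)) := by
      intro g hg
      refine (hlim.sub hg).congr' (hGN.mono fun z hz => ?_)
      rw [hz]; ring
    rcases 𝒰.le_cocompact_or_exists_le_nhds with hc | ⟨z, hz⟩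
    · exfalso
      have hcL : ↑𝒰 ≤ cocompact ℂ ⊓ 𝓟 {z : ℂ | z.im < 0} := le_inf hc (le_principal_iff.2 hL)
      have h1 := hNlim (H.G_tendsto_zero hc)
      have hc₀ : (c₀ : ℂ) ≠ 0 := by exact_mod_cast H.c₀_pos.ne'
      have h2 := h1.mul ((H.N_infty.mono_left hcL).inv₀ hc₀)
      have h3 : Tendsto h 𝒰 (𝓝 ((w - 0) * (c₀ : ℂ)⁻¹)) := by
        refine h2.congr' ?_
        filter_upwards [hL] with z hz
        have := H.N_ne z hz
        have := H.h_ne z hz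
        field_simp
      have h4 := ge_of_tendsto ((Complex.continuous_im.tendsto _).comp h3)
        (mem_of_superset hL fun z hz => H.h_im z hz)
      rw [sub_zero, ← Complex.ofReal_inv, Complex.im_mul_ofReal] at h4
      have := mul_neg_of_neg_of_pos hw (inv_pos.2 H.c₀_pos)
      linarith
    rcases (im_nonpos_of_le_nhds hz hL).eq_or_lt with h0 | h0
    · obtain ⟨x, rfl⟩ := exists_ofReal h0
      have hxL : ↑𝒰 ≤ 𝓝[{z : ℂ | z.im < 0}] (x : ℂ) := le_inf hz (le_principal_iff.2 hL)
      have hsq : 0 < x → x < A ∨ B < x → (G x).im = 0 → False := by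
        intro hx0 hx hG
        obtain ⟨ν, hν, hνlim⟩ := H.N_sq x hx0 hx
        have h2 := tendsto_nhds_unique ((hNlim (H.G_tendsto hx hz)).pow 2) (hνlim.mono_left hxL)
        have h3 := congrArg Complex.im h2
        have h4 := congrArg Complex.re h2
        simp only [pow_two, Complex.mul_im, Complex.mul_re, Complex.sub_im, Complex.sub_re, hG,
          Complex.ofReal_im, Complex.ofReal_re, sub_zero] at h3 h4
        have h5 : w.re - (G x).re = 0 := by
          have : (w.re - (G x).re) * w.im = 0 := by linarith
          exact (mul_eq_zero.1 this).resolve_right hw.ne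
        rw [h5] at h4
        nlinarith
      rcases lt_trichotomy x 0 with hx | rfl | hx
      · exfalso
        have h1 := (H.N_neg x hx).re_nonneg hxL (hNlim (H.G_tendsto (Or.inl (hx.trans H.A_pos)) hz))
          (Filter.Eventually.of_forall fun z => ⟨1, one_pos, by simp⟩)
        have h2 := (H.G_left x (hx.trans H.A_pos)).1
        simp [h2] at h1
        linarith
      · exact (not_tendsto_nhds_of_tendsto_atTop (H.N_zero.mono_left (by simpa using hxL)) _
          (hNlim (H.G_tendsto (Or.inl H.A_pos) hz)).norm).elim
      · rcases lt_or_ge x A with hxA | hxA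
        · exact (hsq hx (Or.inl hxA) (H.G_left x hxA).1).elim
        rcases lt_or_ge B x with hxB | hxB
        · exact (hsq hx (Or.inr hxB) (H.G_right x hxB).1).elim
        exact hIcc x hxA hxB hz
    · exact ⟨z, lower_subset h0, hz⟩
  · exact hIcc x hxA hxB hx

end ContinuationData

/-- A holomorphic function with `z * G z → 1` at infinity is univalent near infinity, and its
inverse near `0` maps a triangular domain into the upper half-plane. -/
theorem exists_inverse_near_infty {G : ℂ → ℂ} {R₀ : ℝ}
    (hG : ∀ z : ℂ, R₀ < ‖z‖ → DifferentiableAt ℂ G z)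
    (hinf : Tendsto (fun z => z * G z) (cocompact ℂ) (𝓝 1)) :
    ∃ R : ℝ, InjOn G {z | R < ‖z‖} ∧ (∀ z : ℂ, R < ‖z‖ → deriv G z ≠ 0) ∧
      ∃ δ : ℝ, 0 < δ ∧ ∀ w : ℂ, |w.re| < -w.im → -δ < w.im →
        ∃ z : ℂ, 0 < z.im ∧ R < ‖z‖ ∧ G z = w := by
  set g : ℂ → ℂ := fun u => if u = 0 then 0 else G u⁻¹ with hg
  have hg0 : g 0 = 0 := by simp [hg]
  have hgu : ∀ {u : ℂ}, u ≠ 0 → g u = G u⁻¹ := fun hu => by simp [hg, hu]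
  have hgd0 : HasDerivAt g 1 0 := by
    rw [hasDerivAt_iff_tendsto_slope]
    have h1 : Tendsto (fun u : ℂ => u⁻¹) (𝓝[≠] 0) (cocompact ℂ) := by
      rw [← Metric.cobounded_eq_cocompact]
      exact tendsto_inv₀_nhdsNE_zero
    refine (hinf.comp h1).congr' ?_
    filter_upwards [self_mem_nhdsWithin] with u hu
    simp [slope, hg0, hgu hu]
  have hgd : ∀ u : ℂ, u ≠ 0 → ‖u‖ < (|R₀| + 1)⁻¹ → DifferentiableAt ℂ g u := by
    intro u hu hur
    have h1 : R₀ < ‖u⁻¹‖ := by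
      rw [norm_inv]
      have := (lt_inv_comm₀ (norm_pos_iff.2 hu) (by positivity)).1 hur
      linarith [le_abs_self R₀]
    have h2 : DifferentiableAt ℂ (fun u : ℂ => G u⁻¹) u :=
      (hG _ h1).comp u (differentiableAt_inv hu)
    refine h2.congr_of_eventuallyEq ?_
    filter_upwards [isOpen_ne.mem_nhds hu] with v hv using hgu hv
  have hball : Metric.ball (0 : ℂ) (|R₀| + 1)⁻¹ ∈ 𝓝 (0 : ℂ) := Metric.ball_mem_nhds _ (by positivity)
  have hgan : AnalyticAt ℂ g 0 := by
    refine DifferentiableOn.analyticAt (s := Metric.ball (0 : ℂ) (|R₀| + 1)⁻¹) (fun u hu => ?_) hball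
    rcases eq_or_ne u 0 with rfl | hu0
    · exact hgd0.differentiableAt.differentiableWithinAt
    · exact (hgd u hu0 (by simpa using hu)).differentiableWithinAt
  have hs : HasStrictDerivAt g 1 0 := by
    have := hgan.hasStrictDerivAt
    rwa [hgd0.deriv] at this
  set k := hs.localInverse g 1 0 one_ne_zero with hk
  have hleft : ∀ᶠ u in 𝓝 (0 : ℂ), k (g u) = u := hs.eventually_left_inverse one_ne_zero
  have hright : ∀ᶠ w in 𝓝 (0 : ℂ), g (k w) = w := by
    have := hs.eventually_right_inverse one_ne_zero
    rwa [hg0] at this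
  have hk0 : k 0 = 0 := by
    have := hleft.self_of_nhds
    rwa [hg0] at this
  have hkd : HasDerivAt k 1 0 := by
    have := (hs.to_localInverse one_ne_zero).hasDerivAt
    rwa [hg0, inv_one] at this
  have hder : ∀ᶠ u in 𝓝 (0 : ℂ), deriv g u ≠ 0 :=
    hgan.deriv.continuousAt.eventually_ne (by rw [hgd0.deriv]; exact one_ne_zero)
  obtain ⟨ε, hε, hεball⟩ := Metric.eventually_nhds_iff_ball.1 (hleft.and (hder.and hball))
  have hinv : ∀ {z : ℂ}, ε⁻¹ < ‖z‖ → z⁻¹ ∈ Metric.ball (0 : ℂ) ε ∧ z⁻¹ ≠ 0 := by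
    intro z hz
    have hz0 : 0 < ‖z‖ := (inv_pos.2 hε).trans hz
    refine ⟨?_, inv_ne_zero (norm_pos_iff.1 hz0)⟩
    rw [mem_ball_zero_iff, norm_inv]
    exact inv_lt_of_inv_lt₀ hε hz
  refine ⟨ε⁻¹, ?_, ?_, ?_⟩
  · intro z hz y hy hzy
    have h1 := (hεball _ (hinv hz).1).1
    have h2 := (hεball _ (hinv hy).1).1
    rw [hgu (hinv hz).2, inv_inv] at h1
    rw [hgu (hinv hy).2, inv_inv] at h2
    rw [hzy, h2] at h1
    exact (inv_injective h1).symm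
  · intro z hz hd
    obtain ⟨h1, h2⟩ := hinv hz
    obtain ⟨-, h3, h4⟩ := hεball _ h1
    apply h3
    have h5 : DifferentiableAt ℂ G (z⁻¹)⁻¹ := by
      apply hG
      rw [norm_inv]
      have := (lt_inv_comm₀ (norm_pos_iff.2 h2) (by positivity)).1 (mem_ball_zero_iff.1 h4)
      linarith [le_abs_self R₀]
    have h6 := h5.hasDerivAt.comp z⁻¹ (hasDerivAt_inv h2)
    have h7 : g =ᶠ[𝓝 z⁻¹] G ∘ fun u => u⁻¹ := by
      filter_upwards [isOpen_ne.mem_nhds h2] with v hv using hgu hv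
    rw [(h6.congr_of_eventuallyEq h7).deriv, inv_inv, hd, zero_mul]
  · have h1 : ∀ᶠ w in 𝓝 (0 : ℂ), ‖k w - w‖ ≤ 1 / 4 * ‖w‖ := by
      have := (hasDerivAt_iff_isLittleO.1 hkd).def (c := 1 / 4) (by norm_num)
      filter_upwards [this] with w hw
      simpa [hk0] using hw
    have h2 : ∀ᶠ w in 𝓝 (0 : ℂ), k w ∈ Metric.ball (0 : ℂ) ε :=
      hkd.continuousAt.eventually (by rw [hk0]; exact Metric.ball_mem_nhds _ hε)
    obtain ⟨δ, hδ, hδball⟩ := Metric.eventually_nhds_iff_ball.1 (h1.and (h2.and hright))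
    refine ⟨δ / 2, by positivity, fun w hw1 hw2 => ?_⟩
    have hwn : ‖w‖ < 2 * -w.im := by
      have := Complex.norm_le_abs_re_add_abs_im w
      have h3 : |w.im| = -w.im := abs_of_neg (by linarith [abs_nonneg w.re])
      linarith
    obtain ⟨h3, h4, h5⟩ := hδball w (by rw [mem_ball_zero_iff]; linarith)
    have h6 : (k w).im < 0 := by
      have h7 := (Complex.abs_im_le_norm (k w - w)).trans h3
      rw [Complex.sub_im] at h7
      have := le_abs_self ((k w).im - w.im)
      linarith [abs_nonneg w.re]
    have h7 : k w ≠ 0 := by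
      intro h0
      simp [h0] at h6
    refine ⟨(k w)⁻¹, ?_, ?_, ?_⟩
    · rw [Complex.inv_im]
      exact div_pos (neg_pos.2 h6) (Complex.normSq_pos.2 h7)
    · rw [norm_inv]
      exact (inv_lt_inv₀ hε (norm_pos_iff.2 h7)).2 (mem_ball_zero_iff.1 h4)
    · rw [← hgu h7, h5]

/-- The Cauchy-type function `G` of `ContinuationData` has a univalent inverse on the lower
half-plane. -/
theorem ContinuationData.exists_univalent_inverse {A B : ℝ} {G E N h : ℂ → ℂ} {c₀ : ℝ}
    (H : ContinuationData A B G E N h c₀) :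
    ∃ F : ℂ → ℂ, AnalyticOnNhd ℂ F {z : ℂ | z.im < 0} ∧ InjOn F {z : ℂ | z.im < 0} ∧
      ∃ γ : ℝ, 0 < γ ∧ ∃ δ : ℝ, 0 < δ ∧
        ∀ w : ℂ, γ * |w.re| < -w.im → -δ < w.im → 0 < (F w).im ∧ G (F w) = w := by
  have hB := H.A_pos.trans H.A_lt_B
  obtain ⟨R, hinj, hder, δ, hδ, htri⟩ := exists_inverse_near_infty (G := G) (R₀ := B) (fun z hz => by
    refine H.G_diff z ?_
    by_contra! hcon
    obtain ⟨h1, h2, h3⟩ := hcon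
    obtain ⟨x, rfl⟩ := exists_ofReal h1
    simp only [Complex.ofReal_re] at h2 h3
    rw [Complex.norm_real, Real.norm_of_nonneg (H.A_pos.le.trans h2)] at hz
    linarith) H.G_infty
  set S : Set ℂ := {w | w.re = 0 ∧ w.im < 0} with hS
  have hsmall : ∀ᶠ w in 𝓝[S] (0 : ℂ), ∀ z ∈ cutPlane A B, E z + N z / 2 = w →
      z ∈ {z : ℂ | 0 < z.im ∧ R < ‖z‖} := by
    refine eventually_of_forall_ultrafilter fun 𝒰 hD hlim => ?_
    obtain ⟨h1, h2⟩ := H.le_cocompact_of_tendsto_zero hD (hlim.mono_right nhdsWithin_le_nhds)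
      (hlim.eventually self_mem_nhdsWithin)
    have h3 : {z : ℂ | R < ‖z‖} ∈ 𝒰 := h1 (by
      rw [← Metric.cobounded_eq_cocompact]
      exact tendsto_norm_cobounded_atTop.eventually (eventually_gt_atTop R))
    exact inter_mem h2 h3
  have hlimt : Tendsto (fun t : ℝ => -(t : ℂ) * Complex.I) (𝓝[>] 0) (𝓝[S] 0) := by
    refine tendsto_nhdsWithin_iff.2 ⟨?_, ?_⟩
    · have : Tendsto (fun t : ℝ => -(t : ℂ) * Complex.I) (𝓝 0) (𝓝 (-((0 : ℝ) : ℂ) * Complex.I)) :=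
        (Complex.continuous_ofReal.neg.mul continuous_const).tendsto _
      simpa using this.mono_left nhdsWithin_le_nhds
    · filter_upwards [self_mem_nhdsWithin] with t (ht : 0 < t)
      simp [hS, ht]
  have hδev : ∀ᶠ t : ℝ in 𝓝[>] 0, t < δ := nhdsWithin_le_nhds (gt_mem_nhds hδ)
  obtain ⟨t, h1, h2, ht⟩ := ((hlimt.eventually hsmall).and (hδev.and self_mem_nhdsWithin)).exists
  set w₀ : ℂ := -(t : ℂ) * Complex.I with hw₀
  have hw₀re : w₀.re = 0 := by simp [hw₀]
  have hw₀im : w₀.im = -t := by simp [hw₀]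
  obtain ⟨z₀, hz₀, hz₀R, hGz₀⟩ := htri w₀ (by rw [hw₀re, hw₀im]; simpa using ht) (by rw [hw₀im]; linarith)
  have hupper : ∀ {z : ℂ}, 0 < z.im → E z + N z / 2 = G z := fun hz => (H.E_upper _ hz).symm
  obtain ⟨F, hFan, hF, hFuniq⟩ := exists_analytic_inverse_of_proper isOpen_cutPlane isOpen_lower
    (isPreconnected_cutPlane H.A_lt_B) isPreconnected_lower H.diff
    (fun 𝒰 hD w hw hlim => H.exists_le_nhds_of_tendsto hD hw hlim)
    ⟨w₀, show w₀.im < 0 by rw [hw₀im]; linarith, z₀, upper_subset hz₀, by rw [hupper hz₀, hGz₀], by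
      have : (fun z => E z + N z / 2) =ᶠ[𝓝 z₀] G := by
        filter_upwards [(isOpen_lt continuous_const Complex.continuous_im).mem_nhds hz₀] with z hz
          using hupper hz
      rw [this.deriv_eq]
      exact hder z₀ hz₀R, by
      intro z hz hzw
      obtain ⟨h3, h4⟩ := h1 z hz hzw
      refine hinj h4 hz₀R ?_
      rw [hGz₀, ← hzw, hupper h3]⟩
  refine ⟨F, hFan, ?_, 1, one_pos, δ, hδ, ?_⟩
  · intro w hw v hv hwv
    rw [← (hF w hw).2, ← (hF v hv).2, hwv]
  · intro w hw1 hw2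
    rw [one_mul] at hw1
    obtain ⟨z, hz, -, hGz⟩ := htri w hw1 hw2
    have : z = F w := hFuniq w (show w.im < 0 by linarith [abs_nonneg w.re]) z (upper_subset hz)
      (by rw [hupper hz, hGz])
    rw [← this]
    exact ⟨hz, hGz⟩

/-- An integral of a uniformly bounded family of holomorphic functions is holomorphic. -/
theorem differentiableAt_integral_of_norm_le {X : Type*} [MeasurableSpace X] {μ : Measure X}
    [IsFiniteMeasure μ] {F : ℂ → X → ℂ} {z₀ : ℂ} {ρ C : ℝ} (hρ : 0 < ρ)
    (hm : ∀ z ∈ Metric.ball z₀ ρ, AEStronglyMeasurable (F z) μ)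
    (hd : ∀ᵐ x ∂μ, DifferentiableOn ℂ (fun z => F z x) (Metric.ball z₀ ρ))
    (hC : ∀ᵐ x ∂μ, ∀ z ∈ Metric.ball z₀ ρ, ‖F z x‖ ≤ C) :
    DifferentiableAt ℂ (fun z => ∫ x, F z x ∂μ) z₀ := by
  have hz₀ : z₀ ∈ Metric.ball z₀ ρ := Metric.mem_ball_self hρ
  have hat : ∀ {f : ℂ → ℂ}, DifferentiableOn ℂ f (Metric.ball z₀ ρ) → ∀ z ∈ Metric.ball z₀ ρ,
      HasDerivAt f (deriv f z) z := fun hf z hz =>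
    (hf.differentiableAt (Metric.isOpen_ball.mem_nhds hz)).hasDerivAt
  have hderiv : AEStronglyMeasurable (fun x => deriv (fun z => F z x) z₀) μ := by
    set δ : ℕ → ℂ := fun n => ((ρ / (n + 2) : ℝ) : ℂ) with hδ
    have hδ0 : ∀ n, δ n ≠ 0 := by
      intro n
      simp only [hδ]
      exact_mod_cast (div_pos hρ (by positivity)).ne'
    have hδlim : Tendsto (fun n => z₀ + δ n) atTop (𝓝[≠] z₀) := by
      refine tendsto_nhdsWithin_iff.2 ⟨?_, Filter.Eventually.of_forall fun n => by simpa using hδ0 n⟩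
      have h1 : Tendsto (fun n : ℕ => ρ / ((n : ℝ) + 2)) atTop (𝓝 0) :=
        tendsto_const_nhds.div_atTop (tendsto_atTop_add_const_right _ _ tendsto_natCast_atTop_atTop)
      have h2 := ((Complex.continuous_ofReal.tendsto 0).comp h1).const_add z₀
      simpa [hδ, Function.comp_def] using h2
    have hmem : ∀ n, z₀ + δ n ∈ Metric.ball z₀ ρ := by
      intro n
      rw [Metric.mem_ball, dist_eq_norm, add_sub_cancel_left, hδ]
      dsimp only
      rw [Complex.norm_real, Real.norm_of_nonneg (by positivity)]
      exact div_lt_self hρ (by linarith [(Nat.cast_nonneg n : (0 : ℝ) ≤ n)])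
    refine aestronglyMeasurable_of_tendsto_ae (u := atTop)
      (f := fun n x => (δ n)⁻¹ • (F (z₀ + δ n) x - F z₀ x))
      (fun n => by exact ((hm _ (hmem n)).sub (hm _ hz₀)).const_smul (δ n)⁻¹) ?_
    filter_upwards [hd] with x hx
    have h3 := ((hat hx z₀ hz₀).tendsto_slope).comp hδlim
    refine h3.congr fun n => ?_
    simp [slope]
  refine (hasDerivAt_integral_of_dominated_loc_of_deriv_le (μ := μ) (F := F)
    (F' := fun z x => deriv (fun z => F z x) z) (s := Metric.ball z₀ (ρ / 2))
    (bound := fun _ => C / (ρ / 4)) (Metric.ball_mem_nhds _ (by positivity))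
    (by filter_upwards [Metric.ball_mem_nhds z₀ hρ] with z hz using hm z hz)
    (Integrable.of_bound (hm z₀ hz₀) C (hC.mono fun x hx => hx z₀ hz₀)) hderiv ?_
    (integrable_const _) ?_).2.differentiableAt
  · filter_upwards [hd, hC] with x hx hxC z hz
    have hsub : Metric.closedBall z (ρ / 4) ⊆ Metric.ball z₀ ρ := by
      intro y hy
      rw [Metric.mem_ball] at hz ⊢
      have := dist_triangle y z z₀
      have := Metric.mem_closedBall.1 hy
      linarith
    refine Complex.norm_deriv_le_of_forall_mem_sphere_norm_le (by positivity)
      ((hx.mono ?_).diffContOnCl) fun y hy => hxC y (hsub (Metric.sphere_subset_closedBall hy))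
    exact Metric.closure_ball_subset_closedBall.trans hsub
  · filter_upwards [hd] with x hx z hz
    exact hat hx z (Metric.ball_subset_ball (by linarith) hz)

/-- Integrals of holomorphic functions with a removable singularity moving along a compact curve
are holomorphic. -/
theorem differentiableAt_integral_removable {a b : ℝ} {S : Set ℂ} (hS : IsOpen S)
    {p w : ℝ → ℝ} (hp : ContinuousOn p (Icc a b)) (hpi : InjOn p (Icc a b))
    (hw : ContinuousOn w (Icc a b))
    {Φ : ℂ × ℝ → ℂ} (hΦ : ContinuousOn Φ {q | q.1 ∈ S ∧ q.2 ∈ Icc a b ∧ q.1 ≠ p q.2})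
    {J : ℂ → ℝ → ℂ} (hJ : ∀ x ∈ Icc a b, DifferentiableOn ℂ (fun z => J z x) S)
    (hJΦ : ∀ x ∈ Icc a b, ∀ z ∈ S, z ≠ p x → J z x = Φ (z, x)) {z₀ : ℂ} (hz₀ : z₀ ∈ S) :
    DifferentiableAt ℂ (fun z => ∫ x in Icc a b, w x * J z x) z₀ := by
  obtain ⟨ε, hε, hεS⟩ := Metric.isOpen_iff.1 hS z₀ hz₀
  set η := ε / 4 with hη
  have hη0 : 0 < η := by positivity
  have hsubS : Metric.closedBall z₀ (3 * η) ⊆ S := by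
    refine (Metric.closedBall_subset_ball ?_).trans hεS
    rw [hη]; linarith
  set K : Set (ℂ × ℝ) := {q | q.1 ∈ Metric.closedBall z₀ (3 * η) ∧ q.2 ∈ Icc a b ∧
    η / 2 ≤ ‖q.1 - p q.2‖} with hK
  have hKc : IsCompact K := by
    have h1 : IsCompact (Metric.closedBall z₀ (3 * η) ×ˢ Icc a b) :=
      (isCompact_closedBall _ _).prod isCompact_Icc
    have h2 : ContinuousOn (fun q : ℂ × ℝ => ‖q.1 - p q.2‖)
        (Metric.closedBall z₀ (3 * η) ×ˢ Icc a b) := by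
      refine (continuousOn_fst.sub ?_).norm
      exact Complex.continuous_ofReal.comp_continuousOn
        (hp.comp continuousOn_snd fun q hq => hq.2)
    have h3 := h2.preimage_isClosed_of_isClosed h1.isClosed (isClosed_Ici (a := η / 2))
    have hKsub : K ⊆ Metric.closedBall z₀ (3 * η) ×ˢ Icc a b := fun q hq => ⟨hq.1, hq.2.1⟩
    refine h1.of_isClosed_subset ?_ hKsub
    convert h3 using 1
    ext q
    simp only [hK, mem_ofPred_eq, mem_inter_iff, mem_prod, mem_preimage, mem_Ici, and_assoc]
  obtain ⟨C, hC⟩ := hKc.exists_bound_of_continuousOn (hΦ.mono (by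
    rintro q ⟨h1, h2, h3⟩
    refine ⟨hsubS h1, h2, fun h => ?_⟩
    rw [h, sub_self, norm_zero] at h3
    linarith))
  obtain ⟨Cw, hCw⟩ := isCompact_Icc.exists_bound_of_continuousOn hw
  have hbound : ∀ x ∈ Icc a b, ∀ z ∈ Metric.ball z₀ (2 * η), ‖J z x‖ ≤ C := by
    intro x hx z hz
    obtain ⟨ρ, hρ2, hρ3, hρ⟩ : ∃ ρ : ℝ, 2 * η ≤ ρ ∧ ρ ≤ 3 * η ∧
        ∀ y ∈ Metric.sphere z₀ ρ, η / 2 ≤ ‖y - p x‖ := by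
      have key : ∀ ρ : ℝ, η / 2 ≤ |ρ - ‖(p x : ℂ) - z₀‖| →
          ∀ y ∈ Metric.sphere z₀ ρ, η / 2 ≤ ‖y - p x‖ := by
        intro ρ hρ y hy
        rw [← mem_sphere_iff_norm.1 hy] at hρ
        refine hρ.trans ((abs_norm_sub_norm_le _ _).trans (le_of_eq ?_))
        congr 1
        ring
      by_cases h : ‖(p x : ℂ) - z₀‖ ≤ 5 / 2 * η
      · exact ⟨3 * η, by linarith, le_rfl, key _ (by rw [le_abs]; left; linarith)⟩
      · exact ⟨2 * η, le_rfl, by linarith, key _ (by rw [le_abs]; right; linarith)⟩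
    have hcl : closure (Metric.ball z₀ ρ) ⊆ Metric.closedBall z₀ (3 * η) :=
      Metric.closure_ball_subset_closedBall.trans (Metric.closedBall_subset_closedBall hρ3)
    refine Complex.norm_le_of_forall_mem_frontier_norm_le (U := Metric.ball z₀ ρ)
      (f := fun z => J z x) Metric.isBounded_ball
      (((hJ x hx).mono (hcl.trans hsubS)).diffContOnCl) ?_ (subset_closure
        (Metric.ball_subset_ball hρ2 hz))
    intro y hy
    have hys : y ∈ Metric.sphere z₀ ρ := by
      rwa [frontier_ball z₀ (by linarith : ρ ≠ 0 )] at hy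
    have hyc : y ∈ Metric.closedBall z₀ (3 * η) :=
      Metric.closedBall_subset_closedBall hρ3 (Metric.sphere_subset_closedBall hys)
    have hyp := hρ y hys
    rw [hJΦ x hx y (hsubS hyc) (by rintro rfl; simp at hyp; linarith)]
    exact hC (y, x) ⟨hyc, hx, hyp⟩
  have hballS : Metric.ball z₀ (2 * η) ⊆ S :=
    (Metric.ball_subset_closedBall.trans (Metric.closedBall_subset_closedBall (by linarith))).trans
      hsubS
  refine differentiableAt_integral_of_norm_le (ρ := 2 * η) (C := Cw * C) (by positivity) ?_ ?_ ?_
  · intro z hz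
    have h1 : AEStronglyMeasurable (fun x => (w x : ℂ)) (volume.restrict (Icc a b)) :=
      (Complex.continuous_ofReal.comp_continuousOn hw).aestronglyMeasurable measurableSet_Icc
    refine h1.mul ?_
    set T : Set ℝ := Icc a b ∩ {x | z = p x} with hT
    have hTs : T.Subsingleton := by
      rintro x ⟨hx, hx'⟩ y ⟨hy, hy'⟩
      refine hpi hx hy ?_
      rw [mem_ofPred_eq] at hx' hy'
      exact_mod_cast hx'.symm.trans hy'
    have hT0 : volume T = 0 := hTs.measure_zero volume
    have hTm : MeasurableSet T := hTs.measurableSet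
    have h2 : AEStronglyMeasurable (fun x => J z x) (volume.restrict (Icc a b \ T)) := by
      have h3 : ContinuousOn (fun x => Φ (z, x)) (Icc a b \ T) :=
        hΦ.comp (by fun_prop) fun x hx => ⟨hballS hz, hx.1, fun h => hx.2 ⟨hx.1, h⟩⟩
      refine (h3.aestronglyMeasurable (measurableSet_Icc.diff hTm)).congr ?_
      filter_upwards [ae_restrict_mem (measurableSet_Icc.diff hTm)] with x hx
      exact (hJΦ x hx.1 z (hballS hz) fun h => hx.2 ⟨hx.1, h⟩).symm
    have h4 : (volume.restrict (Icc a b \ T)) = volume.restrict (Icc a b) :=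
      Measure.restrict_congr_set (sdiff_null_ae_eq_self hT0)
    rwa [h4] at h2
  · filter_upwards [ae_restrict_mem measurableSet_Icc] with x hx
    exact ((hJ x hx).mono hballS).const_mul _
  · filter_upwards [ae_restrict_mem measurableSet_Icc] with x hx z hz
    rw [norm_mul, Complex.norm_real]
    exact mul_le_mul (hCw x hx) (hbound x hx z hz) (norm_nonneg _)
      ((norm_nonneg _).trans (hCw x hx))

theorem integral_pos_of_ae_pos {X : Type*} [MeasurableSpace X] {μ : Measure X} [NeZero μ]
    {f : X → ℝ} (hf : Integrable f μ) (hpos : ∀ᵐ x ∂μ, 0 < f x) : 0 < ∫ x, f x ∂μ := by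
  rw [integral_pos_iff_support_of_nonneg_ae (hpos.mono fun x hx => hx.le) hf]
  refine pos_iff_ne_zero.2 fun h => NeZero.ne μ ?_
  rw [← Measure.measure_univ_eq_zero]
  have : Function.support f =ᵐ[μ] univ := by
    filter_upwards [hpos] with x hx
    exact propext ⟨fun _ => mem_univ x, fun _ => hx.ne'⟩
  rw [← measure_congr this, h]

section CauchyTransform

variable {ν : Measure ℝ} {A B : ℝ}

theorem exists_le_norm_sub {z : ℂ} (hz : z.im ≠ 0 ∨ z.re < A ∨ B < z.re) :
    ∃ ε > 0, ∀ x ∈ Ioo A B, ε ≤ ‖z - (x : ℂ)‖ := by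
  rcases hz with hz | hz | hz
  · refine ⟨|z.im|, abs_pos.2 hz, fun x _ => ?_⟩
    simpa using Complex.abs_im_le_norm (z - x)
  · refine ⟨A - z.re, by linarith, fun x hx => ?_⟩
    have h1 := Complex.abs_re_le_norm (z - x)
    have h2 := neg_le_abs (z - x).re
    simp only [Complex.sub_re, Complex.ofReal_re] at h1 h2
    linarith [hx.1]
  · refine ⟨z.re - B, by linarith, fun x hx => ?_⟩
    have h1 := Complex.abs_re_le_norm (z - x)
    have h2 := le_abs_self (z - x).re
    simp only [Complex.sub_re, Complex.ofReal_re] at h1 h2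
    linarith [hx.2]

theorem aestronglyMeasurable_cauchy (ν : Measure ℝ) (z : ℂ) :
    AEStronglyMeasurable (fun x : ℝ => (z - (x : ℂ))⁻¹) ν :=
  (measurable_const.sub Complex.measurable_ofReal).inv.aestronglyMeasurable

theorem integrable_cauchy [IsFiniteMeasure ν] (hν : ∀ᵐ x ∂ν, x ∈ Ioo A B) {z : ℂ}
    (hz : z.im ≠ 0 ∨ z.re < A ∨ B < z.re) : Integrable (fun x : ℝ => (z - (x : ℂ))⁻¹) ν := by
  obtain ⟨ε, hε, h⟩ := exists_le_norm_sub hz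
  refine Integrable.of_bound (aestronglyMeasurable_cauchy ν z) ε⁻¹ ?_
  filter_upwards [hν] with x hx
  rw [norm_inv]
  exact inv_anti₀ hε (h x hx)

theorem differentiableAt_cauchyTransform [IsFiniteMeasure ν] (hν : ∀ᵐ x ∂ν, x ∈ Ioo A B) {z : ℂ}
    (hz : z.im ≠ 0 ∨ z.re < A ∨ B < z.re) : DifferentiableAt ℂ (cauchyTransform ν) z := by
  obtain ⟨ε, hε, h⟩ := exists_le_norm_sub hz
  have key : ∀ x ∈ Ioo A B, ∀ y ∈ Metric.ball z (ε / 2), ε / 2 ≤ ‖y - (x : ℂ)‖ := by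
    intro x hx y hy
    have h1 := norm_sub_le_norm_sub_add_norm_sub z y (x : ℂ)
    rw [mem_ball_iff_norm'] at hy
    linarith [h x hx]
  refine differentiableAt_integral_of_norm_le (ρ := ε / 2) (C := (ε / 2)⁻¹) (half_pos hε)
    (fun y _ => aestronglyMeasurable_cauchy ν y) ?_ ?_
  · filter_upwards [hν] with x hx y hy
    refine DifferentiableAt.differentiableWithinAt ?_
    refine (differentiableAt_id.sub_const _).inv ?_
    exact norm_pos_iff.1 (lt_of_lt_of_le (half_pos hε) (key x hx y hy))
  · filter_upwards [hν] with x hx y hy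
    rw [norm_inv]
    exact inv_anti₀ (half_pos hε) (key x hx y hy)

theorem cauchyTransform_re [IsFiniteMeasure ν] (hν : ∀ᵐ x ∂ν, x ∈ Ioo A B) {z : ℂ}
    (hz : z.im ≠ 0 ∨ z.re < A ∨ B < z.re) :
    (cauchyTransform ν z).re = ∫ x : ℝ, ((z - (x : ℂ))⁻¹).re ∂ν :=
  (integral_re (integrable_cauchy hν hz)).symm

theorem cauchyTransform_im [IsFiniteMeasure ν] (hν : ∀ᵐ x ∂ν, x ∈ Ioo A B) {z : ℂ}
    (hz : z.im ≠ 0 ∨ z.re < A ∨ B < z.re) :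
    (cauchyTransform ν z).im = ∫ x : ℝ, ((z - (x : ℂ))⁻¹).im ∂ν :=
  (integral_im (integrable_cauchy hν hz)).symm

theorem cauchyTransform_conj (z : ℂ) :
    cauchyTransform ν (starRingEnd ℂ z) = starRingEnd ℂ (cauchyTransform ν z) := by
  rw [cauchyTransform, cauchyTransform, ← integral_conj]
  simp

theorem cauchyTransform_im_pos [IsProbabilityMeasure ν] (hν : ∀ᵐ x ∂ν, x ∈ Ioo A B) {z : ℂ}
    (hz : z.im < 0) : 0 < (cauchyTransform ν z).im := by
  rw [cauchyTransform_im hν (Or.inl hz.ne)]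
  refine integral_pos_of_ae_pos (integrable_cauchy hν (Or.inl hz.ne)).im (ae_of_all _ fun x => ?_)
  rw [Complex.inv_im]
  refine div_pos (by simpa using hz) (Complex.normSq_pos.2 fun h => ?_)
  have := congrArg Complex.im h
  simp at this
  exact hz.ne this

theorem cauchyTransform_im_neg [IsProbabilityMeasure ν] (hν : ∀ᵐ x ∂ν, x ∈ Ioo A B) {z : ℂ}
    (hz : 0 < z.im) : (cauchyTransform ν z).im < 0 := by
  have := cauchyTransform_im_pos hν (z := starRingEnd ℂ z) (by simpa using hz)
  rw [cauchyTransform_conj] at this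
  simpa using this

theorem cauchyTransform_ofReal_im (x : ℝ) : (cauchyTransform ν x).im = 0 := by
  have := cauchyTransform_conj (ν := ν) (x : ℂ)
  rw [Complex.conj_ofReal] at this
  exact Complex.conj_eq_iff_im.1 this.symm

theorem cauchyTransform_re_neg [IsProbabilityMeasure ν] (hν : ∀ᵐ x ∂ν, x ∈ Ioo A B) {z : ℂ}
    (hz : z.im ≠ 0 ∨ z.re < A ∨ B < z.re) (hzA : z.re ≤ A) : (cauchyTransform ν z).re < 0 := by
  rw [cauchyTransform_re hν hz, ← neg_pos, ← integral_neg]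
  refine integral_pos_of_ae_pos (integrable_cauchy hν hz).re.neg ?_
  filter_upwards [hν] with x hx
  rw [Complex.inv_re, ← neg_div]
  refine div_pos (by simpa using hzA.trans_lt hx.1) (Complex.normSq_pos.2 fun h => ?_)
  have := congrArg Complex.re h
  simp at this
  linarith [hx.1]

theorem cauchyTransform_re_pos [IsProbabilityMeasure ν] (hν : ∀ᵐ x ∂ν, x ∈ Ioo A B) {z : ℂ}
    (hz : z.im ≠ 0 ∨ z.re < A ∨ B < z.re) (hzB : B ≤ z.re) : 0 < (cauchyTransform ν z).re := by
  rw [cauchyTransform_re hν hz]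
  refine integral_pos_of_ae_pos (integrable_cauchy hν hz).re ?_
  filter_upwards [hν] with x hx
  show 0 < ((z - (x : ℂ))⁻¹).re
  rw [Complex.inv_re]
  refine div_pos (by simpa using hx.2.trans_le hzB) (Complex.normSq_pos.2 fun h => ?_)
  have := congrArg Complex.re h
  simp at this
  linarith [hx.2]

theorem inv_re_add_mul_I (x t ε : ℝ) :
    (((t : ℂ) + ε * Complex.I - x)⁻¹).re = (t - x) / ((t - x) ^ 2 + ε ^ 2) := by
  rw [Complex.inv_re, Complex.normSq_apply]
  simp [pow_two]

theorem cauchyTransform_re_le_left [IsProbabilityMeasure ν] (hν : ∀ᵐ x ∂ν, x ∈ Ioo A B) {ε : ℝ}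
    (hε : 0 < ε) (hε1 : ε ≤ 1) :
    (cauchyTransform ν (A + ε * Complex.I)).re ≤ (cauchyTransform ν (A + (1 : ℝ) * Complex.I)).re := by
  have h1 : ((A : ℂ) + ε * Complex.I).im ≠ 0 := by simpa using hε.ne'
  have h2 : ((A : ℂ) + (1 : ℝ) * Complex.I).im ≠ 0 := by simp
  rw [cauchyTransform_re hν (Or.inl h1), cauchyTransform_re hν (Or.inl h2)]
  refine integral_mono_ae (integrable_cauchy hν (Or.inl h1)).re
    (integrable_cauchy hν (Or.inl h2)).re ?_
  filter_upwards [hν] with x hx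
  show ((_ : ℂ)⁻¹).re ≤ ((_ : ℂ)⁻¹).re
  rw [inv_re_add_mul_I, inv_re_add_mul_I]
  have h3 : A - x < 0 := by linarith [hx.1]
  have h4 : 0 < (A - x) ^ 2 := by nlinarith
  rw [div_le_div_iff₀ (by positivity) (by positivity)]
  have : ε ^ 2 ≤ 1 ^ 2 := by gcongr
  nlinarith

theorem cauchyTransform_re_le_right [IsProbabilityMeasure ν] (hν : ∀ᵐ x ∂ν, x ∈ Ioo A B) {ε : ℝ}
    (hε : 0 < ε) (hε1 : ε ≤ 1) :
    (cauchyTransform ν (B + (1 : ℝ) * Complex.I)).re ≤ (cauchyTransform ν (B + ε * Complex.I)).re := by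
  have h1 : ((B : ℂ) + ε * Complex.I).im ≠ 0 := by simpa using hε.ne'
  have h2 : ((B : ℂ) + (1 : ℝ) * Complex.I).im ≠ 0 := by simp
  rw [cauchyTransform_re hν (Or.inl h1), cauchyTransform_re hν (Or.inl h2)]
  refine integral_mono_ae (integrable_cauchy hν (Or.inl h2)).re
    (integrable_cauchy hν (Or.inl h1)).re ?_
  filter_upwards [hν] with x hx
  show ((_ : ℂ)⁻¹).re ≤ ((_ : ℂ)⁻¹).re
  rw [inv_re_add_mul_I, inv_re_add_mul_I]
  have h3 : 0 < B - x := by linarith [hx.2]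
  have h4 : 0 < (B - x) ^ 2 := by positivity
  rw [div_le_div_iff₀ (by positivity) (by positivity)]
  have : ε ^ 2 ≤ 1 ^ 2 := by gcongr
  nlinarith

theorem tendsto_mul_cauchyTransform [IsProbabilityMeasure ν] (hν : ∀ᵐ x ∂ν, x ∈ Ioo A B) :
    Tendsto (fun z => z * cauchyTransform ν z) (cocompact ℂ) (𝓝 1) := by
  set M := max |A| |B| with hM
  have hM0 : 0 ≤ M := (abs_nonneg A).trans (le_max_left _ _)
  have hxM : ∀ x ∈ Ioo A B, |x| ≤ M := fun x hx =>
    abs_le_max_abs_abs hx.1.le hx.2.le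
  have hlim : Tendsto (fun z : ℂ => M / (‖z‖ - M)) (cocompact ℂ) (𝓝 0) :=
    tendsto_const_nhds.div_atTop (tendsto_atTop_add_const_right _ _ tendsto_norm_cocompact_atTop)
  rw [tendsto_iff_norm_sub_tendsto_zero]
  refine squeeze_zero' (Eventually.of_forall fun z => norm_nonneg _) ?_ hlim
  filter_upwards [tendsto_norm_cocompact_atTop.eventually_gt_atTop M] with z hz
  have hdist : ∀ x ∈ Ioo A B, ‖z‖ - M ≤ ‖z - (x : ℂ)‖ := by
    intro x hx
    have := norm_sub_norm_le z (x : ℂ)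
    rw [Complex.norm_real, Real.norm_eq_abs] at this
    linarith [hxM x hx]
  have hint : Integrable (fun x : ℝ => (z - (x : ℂ))⁻¹) ν := by
    refine Integrable.of_bound (aestronglyMeasurable_cauchy ν z) (‖z‖ - M)⁻¹ ?_
    filter_upwards [hν] with x hx
    rw [norm_inv]
    exact inv_anti₀ (by linarith) (hdist x hx)
  have heq : z * cauchyTransform ν z - 1 = ∫ x : ℝ, (z * (z - (x : ℂ))⁻¹ - 1) ∂ν := by
    rw [integral_sub (hint.const_mul z) (integrable_const _), integral_const_mul]
    simp [cauchyTransform]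
  rw [heq]
  have := norm_integral_le_of_norm_le_const (μ := ν) (C := M / (‖z‖ - M))
    (f := fun x : ℝ => z * (z - (x : ℂ))⁻¹ - 1) (by
      filter_upwards [hν] with x hx
      have h1 : 0 < ‖z - (x : ℂ)‖ := by linarith [hdist x hx]
      have h2 : z * (z - (x : ℂ))⁻¹ - 1 = x / (z - x) := by
        have := norm_pos_iff.1 h1
        field_simp
        ring
      rw [h2, norm_div, Complex.norm_real, Real.norm_eq_abs]
      exact div_le_div₀ hM0 (hxM x hx) (by linarith) (hdist x hx))
  simpa using this

end CauchyTransform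

section Semicircle

variable {v : ℂ}

theorem add_cos_eq (hv0 : v ≠ 0) (θ : ℝ) :
    (v + v⁻¹) / 2 + (Real.cos θ : ℂ) = (Complex.exp (θ * Complex.I) + v) *
      (Complex.exp (θ * Complex.I) + v⁻¹) / (2 * Complex.exp (θ * Complex.I)) := by
  have hw := Complex.exp_ne_zero (θ * Complex.I)
  rw [Complex.ofReal_cos, Complex.cos, neg_mul, Complex.exp_neg]
  field_simp
  ring

theorem exp_add_ne_zero (hv1 : ‖v‖ ≠ 1) (θ : ℝ) : Complex.exp (θ * Complex.I) + v ≠ 0 := by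
  intro h
  refine hv1 ?_
  rw [eq_neg_of_add_eq_zero_right h, norm_neg, Complex.norm_exp_ofReal_mul_I]

theorem add_cos_ne_zero (hv0 : v ≠ 0) (hv1 : ‖v‖ < 1) (θ : ℝ) :
    (v + v⁻¹) / 2 + (Real.cos θ : ℂ) ≠ 0 := by
  rw [add_cos_eq hv0]
  have h1 := exp_add_ne_zero hv1.ne θ
  have h2 : Complex.exp (θ * Complex.I) + v⁻¹ ≠ 0 := by
    refine exp_add_ne_zero (fun h => hv1.ne ?_) θ
    rwa [norm_inv, inv_eq_one] at h
  exact div_ne_zero (mul_ne_zero h1 h2) (mul_ne_zero two_ne_zero (Complex.exp_ne_zero _))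

theorem integral_inv_add_cos_two_pi (hv0 : v ≠ 0) (hv1 : ‖v‖ < 1) :
    ∫ θ in (0 : ℝ)..2 * Real.pi, ((v + v⁻¹) / 2 + (Real.cos θ : ℂ))⁻¹
      = 4 * Real.pi * v / (1 - v ^ 2) := by
  have hvinv : 1 < ‖v⁻¹‖ := by
    rw [norm_inv]
    exact (one_lt_inv₀ (norm_pos_iff.2 hv0)).2 hv1
  have hne : ∀ w ∈ Metric.closedBall (0 : ℂ) 1, w + v⁻¹ ≠ 0 := by
    intro w hw h
    rw [mem_closedBall_zero_iff, eq_neg_of_add_eq_zero_left h, norm_neg] at hw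
    linarith
  have hd : ∀ w ∈ Metric.closedBall (0 : ℂ) 1,
      DifferentiableAt ℂ (fun w : ℂ => (w + v⁻¹)⁻¹) w := fun w hw =>
    (differentiableAt_id.add_const _).inv (hne w hw)
  have hC := Complex.circleIntegral_sub_inv_smul_of_differentiable_on_off_countable
    (R := 1) (c := 0) (w := -v) (f := fun w : ℂ => (w + v⁻¹)⁻¹) (s := ∅) countable_empty
    (by simpa using hv1) (fun w hw => (hd w hw).continuousAt.continuousWithinAt)
    (fun w hw => hd w (Metric.ball_subset_closedBall hw.1))
  have hv2 : 1 - v ^ 2 ≠ 0 := by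
    intro h
    have : ‖v‖ ^ 2 = 1 := by rw [← norm_pow, ← sub_eq_zero.1 h, norm_one]
    nlinarith [norm_nonneg v]
  have hint : ∀ θ : ℝ, ((v + v⁻¹) / 2 + (Real.cos θ : ℂ))⁻¹ = (2 / Complex.I) *
      (deriv (circleMap 0 1) θ • ((circleMap 0 1 θ - -v)⁻¹ • (circleMap 0 1 θ + v⁻¹)⁻¹)) := by
    intro θ
    have h1 := exp_add_ne_zero hv1.ne θ
    have h2 : Complex.exp (θ * Complex.I) + v⁻¹ ≠ 0 := exp_add_ne_zero hvinv.ne' θ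
    have h3 := Complex.exp_ne_zero (θ * Complex.I)
    rw [add_cos_eq hv0]
    simp only [deriv_circleMap, circleMap, smul_eq_mul, zero_add, Complex.ofReal_one, one_mul,
      sub_neg_eq_add]
    generalize Complex.exp (θ * Complex.I) = e at *
    generalize v⁻¹ = v' at *
    have := Complex.I_ne_zero
    field_simp
  simp_rw [hint]
  rw [intervalIntegral.integral_const_mul]
  rw [circleIntegral] at hC
  rw [hC, smul_eq_mul]
  have h4 : -v + v⁻¹ ≠ 0 := hne (-v) (by simpa using hv1.le)
  have h5 : (-v + v⁻¹) = (1 - v ^ 2) / v := by field_simp; ring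
  rw [h5]
  have := Complex.I_ne_zero
  field_simp
  ring

theorem integral_inv_add_cos (hv0 : v ≠ 0) (hv1 : ‖v‖ < 1) :
    ∫ θ in (0 : ℝ)..Real.pi, ((v + v⁻¹) / 2 + (Real.cos θ : ℂ))⁻¹
      = 2 * Real.pi * v / (1 - v ^ 2) := by
  have hcont : Continuous fun θ : ℝ => ((v + v⁻¹) / 2 + (Real.cos θ : ℂ))⁻¹ :=
    (continuous_const.add (Complex.continuous_ofReal.comp Real.continuous_cos)).inv₀
      (add_cos_ne_zero hv0 hv1)
  have h1 := intervalIntegral.integral_comp_sub_left (a := 0) (b := Real.pi)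
    (fun θ : ℝ => ((v + v⁻¹) / 2 + (Real.cos θ : ℂ))⁻¹) (2 * Real.pi)
  simp only [Real.cos_two_pi_sub, sub_zero] at h1
  rw [show 2 * Real.pi - Real.pi = Real.pi by ring] at h1
  have h2 := intervalIntegral.integral_add_adjacent_intervals
    (hcont.intervalIntegrable (μ := volume) 0 Real.pi)
    (hcont.intervalIntegrable (μ := volume) Real.pi (2 * Real.pi))
  rw [← h1, integral_inv_add_cos_two_pi hv0 hv1, ← two_mul] at h2
  rw [← mul_right_inj' (two_ne_zero (α := ℂ)), h2]
  ring

theorem integral_sin_sq_div (hv0 : v ≠ 0) (hv1 : ‖v‖ < 1) :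
    ∫ θ in (0 : ℝ)..Real.pi, (Real.sin θ : ℂ) ^ 2 * ((v + v⁻¹) / 2 + (Real.cos θ : ℂ))⁻¹
      = Real.pi * v := by
  set Z := (v + v⁻¹) / 2 with hZ
  have hcos : Continuous fun θ : ℝ => (Real.cos θ : ℂ) :=
    Complex.continuous_ofReal.comp Real.continuous_cos
  have hcont : Continuous fun θ : ℝ => (Z + (Real.cos θ : ℂ))⁻¹ :=
    (continuous_const.add hcos).inv₀ (add_cos_ne_zero hv0 hv1)
  have hv2 : 1 - v ^ 2 ≠ 0 := by
    intro h
    have : ‖v‖ ^ 2 = 1 := by rw [← norm_pow, ← sub_eq_zero.1 h, norm_one]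
    nlinarith [norm_nonneg v]
  have hint : ∀ θ : ℝ, (Real.sin θ : ℂ) ^ 2 * (Z + (Real.cos θ : ℂ))⁻¹ =
      (1 - Z ^ 2) * (Z + (Real.cos θ : ℂ))⁻¹ + (Z - (Real.cos θ : ℂ)) := by
    intro θ
    have h1 := add_cos_ne_zero hv0 hv1 θ
    have h2 : (Real.sin θ : ℂ) ^ 2 = 1 - (Real.cos θ : ℂ) ^ 2 := by
      exact_mod_cast Real.sin_sq θ
    rw [← hZ] at h1
    rw [h2]
    field_simp
    ring
  have hsub : Continuous fun θ : ℝ => Z - (Real.cos θ : ℂ) := continuous_const.sub hcos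
  simp_rw [hint]
  rw [intervalIntegral.integral_add ((hcont.const_mul _).intervalIntegrable _ _)
    (hsub.intervalIntegrable _ _), intervalIntegral.integral_const_mul,
    intervalIntegral.integral_sub (continuous_const.intervalIntegrable _ _)
    (hcos.intervalIntegrable _ _), integral_inv_add_cos hv0 hv1, intervalIntegral.integral_ofReal,
    integral_cos, intervalIntegral.integral_const, hZ]
  simp only [Real.sin_pi, Real.sin_zero, sub_zero, Complex.ofReal_zero, Complex.real_smul]
  field_simp
  ring

/-- The Stieltjes transform of the semicircle, in Joukowski coordinates. -/
theorem integral_semicircle (hv0 : v ≠ 0) (hv1 : ‖v‖ < 1) {c d : ℝ} (hd : 0 < d) {a b : ℝ}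
    (ha : a = c - d) (hb : b = c + d) {ζ : ℂ} (hζ : ζ = c + d * ((v + v⁻¹) / 2)) :
    ∫ x in a..b, (Real.sqrt ((x - a) * (b - x)) : ℂ) / (ζ - x) = Real.pi * d * v := by
  have hsub := intervalIntegral.integral_deriv_smul_comp' (a := 0) (b := Real.pi)
    (f := fun θ => c - d * Real.cos θ) (f' := fun θ => d * Real.sin θ)
    (g := fun x : ℝ => (Real.sqrt ((x - a) * (b - x)) : ℂ) / (ζ - x)) ?_ ?_ ?_
  · simp only [Real.cos_pi, Real.cos_zero] at hsub
    rw [show c - d * 1 = a by rw [ha]; ring, show c - d * -1 = b by rw [hb]; ring] at hsub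
    rw [← hsub, mul_assoc, mul_left_comm, ← integral_sin_sq_div hv0 hv1,
      ← intervalIntegral.integral_const_mul]
    refine intervalIntegral.integral_congr fun θ hθ => ?_
    rw [uIcc_of_le Real.pi_pos.le] at hθ
    have h1 : Real.sqrt ((c - d * Real.cos θ - a) * (b - (c - d * Real.cos θ))) =
        d * Real.sin θ := by
      rw [show (c - d * Real.cos θ - a) * (b - (c - d * Real.cos θ)) = (d * Real.sin θ) ^ 2 by
        rw [ha, hb, mul_pow, Real.sin_sq]; ring]
      exact Real.sqrt_sq (mul_nonneg hd.le (Real.sin_nonneg_of_mem_Icc hθ))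
    have h2 : ζ - ((c - d * Real.cos θ : ℝ) : ℂ) = d * ((v + v⁻¹) / 2 + (Real.cos θ : ℂ)) := by
      rw [hζ]; push_cast; ring
    have h3 := add_cos_ne_zero hv0 hv1 θ
    have h4 : (d : ℂ) ≠ 0 := by exact_mod_cast hd.ne'
    simp only [Function.comp_apply]
    rw [h1, h2, Complex.real_smul]
    generalize (v + v⁻¹) / 2 + (Real.cos θ : ℂ) = q at *
    push_cast
    field_simp
  · intro θ _
    simpa using ((Real.hasDerivAt_cos θ).const_mul d).const_sub c
  · fun_prop
  · rintro _ ⟨θ, hθ, rfl⟩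
    refine ContinuousAt.continuousWithinAt ?_
    refine ContinuousAt.div (by fun_prop) (by fun_prop) ?_
    have h2 : ζ - ((c - d * Real.cos θ : ℝ) : ℂ) = d * ((v + v⁻¹) / 2 + (Real.cos θ : ℂ)) := by
      rw [hζ]; push_cast; ring
    simp only
    rw [h2]
    exact mul_ne_zero (by exact_mod_cast hd.ne') (add_cos_ne_zero hv0 hv1 θ)

end Semicircle

theorem AsympHalfPlane.of_mul {u : ℂ} {N P Q : ℂ → ℂ} {l : Filter ℂ} {q : ℝ} (hq : 0 < q)
    (hN : ∀ᶠ z in l, N z = P z * Q z) (hP : ∀ᶠ z in l, 0 ≤ (u * P z).re)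
    (hQ : Tendsto Q l (𝓝 (q : ℂ))) : AsympHalfPlane u N l := by
  intro ε hε
  have h1 : Tendsto (fun z => ‖u‖ * ‖Q z - q‖) l (𝓝 0) := by
    simpa using (tendsto_iff_norm_sub_tendsto_zero.1 hQ).const_mul ‖u‖
  have h2 : Tendsto (fun z => ε * ‖Q z‖) l (𝓝 (ε * q)) := by
    have := hQ.norm.const_mul ε
    rwa [Complex.norm_real, Real.norm_of_nonneg hq.le] at this
  filter_upwards [hN, hP, h1.eventually_lt h2 (by positivity)] with z hz hPz hlt
  have h3 : u * N z = q * (u * P z) + u * P z * (Q z - q) := by rw [hz]; ring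
  have h4 := neg_le_of_abs_le (Complex.abs_re_le_norm (u * P z * (Q z - q)))
  rw [h3, Complex.add_re, Complex.re_ofReal_mul, hz]
  rw [norm_mul, norm_mul] at h4
  rw [norm_mul]
  nlinarith [norm_nonneg (P z), mul_nonneg hq.le hPz]

section SquareRoot

theorem Complex.cpow_half_sq (w : ℂ) : (w ^ (2⁻¹ : ℂ)) ^ 2 = w := Complex.cpow_ofNat_inv_pow w 2

theorem Complex.re_cpow_half_pos {w : ℂ} (hw : w ∈ Complex.slitPlane) :
    0 < (w ^ (2⁻¹ : ℂ)).re := by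
  have h1 := Complex.mem_slitPlane_iff_arg.1 hw
  have h2 := (Complex.arg_le_pi w).lt_of_ne h1.1
  have h3 := Complex.neg_pi_lt_arg w
  rw [Complex.cpow_def_of_ne_zero h1.2, Complex.exp_re]
  have h4 : (Complex.log w * 2⁻¹).im = w.arg / 2 := by
    rw [show Complex.log w * (2⁻¹ : ℂ) = Complex.log w / ((2 : ℝ) : ℂ) by push_cast; rfl,
      Complex.div_ofReal_im, Complex.log_im]
  rw [h4]
  exact mul_pos (Real.exp_pos _) (Real.cos_pos_of_mem_Ioo ⟨by linarith, by linarith⟩)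

/-- The branch of `√((ζ - a) (b - ζ))` with positive real part. -/
noncomputable def edgeSqrt (a b : ℝ) (ζ : ℂ) : ℂ := ((ζ - a) * (b - ζ)) ^ (2⁻¹ : ℂ)

variable {a b : ℝ} {ζ : ℂ}

theorem edgeSqrt_sq (a b : ℝ) (ζ : ℂ) : edgeSqrt a b ζ ^ 2 = (ζ - a) * (b - ζ) :=
  Complex.cpow_half_sq _

theorem mem_slitPlane_edge (hab : a < b) (hζ : ζ ∈ cutPlane a b) :
    (ζ - a) * (b - ζ) ∈ Complex.slitPlane := by
  rw [Complex.mem_slitPlane_iff]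
  have h1 : ((ζ - a) * (b - ζ)).im = ζ.im * (a + b - 2 * ζ.re) := by simp; ring
  have h2 : ((ζ - a) * (b - ζ)).re = (ζ.re - a) * (b - ζ.re) + ζ.im ^ 2 := by simp; ring
  rw [h1, h2]
  by_cases h : ζ.im = 0
  · left
    rcases hζ with hζ | hζ
    · exact absurd h hζ
    · rw [h]
      nlinarith [hζ.1, hζ.2]
  · by_cases h' : a + b - 2 * ζ.re = 0
    · left
      have : 0 < ζ.im ^ 2 := by positivity
      nlinarith
    · exact Or.inr (mul_ne_zero h h')

theorem edgeSqrt_re_pos (hab : a < b) (hζ : ζ ∈ cutPlane a b) : 0 < (edgeSqrt a b ζ).re :=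
  Complex.re_cpow_half_pos (mem_slitPlane_edge hab hζ)

theorem differentiableAt_edgeSqrt (hab : a < b) (hζ : ζ ∈ cutPlane a b) :
    DifferentiableAt ℂ (edgeSqrt a b) ζ :=
  ((differentiableAt_id.sub_const _).mul (differentiableAt_id.const_sub _)).cpow_const
    (mem_slitPlane_edge hab hζ)

theorem edgeSqrt_re_mul_im (a b : ℝ) (ζ : ℂ) :
    2 * (edgeSqrt a b ζ).re * (edgeSqrt a b ζ).im = ζ.im * (a + b - 2 * ζ.re) := by
  have h := congrArg Complex.im (edgeSqrt_sq a b ζ)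
  rw [pow_two] at h
  simp only [Complex.mul_im, Complex.sub_re, Complex.sub_im, Complex.ofReal_re,
    Complex.ofReal_im] at h
  linarith

theorem edgeSqrt_re_sq_sub (a b : ℝ) (ζ : ℂ) :
    (edgeSqrt a b ζ).re ^ 2 - (edgeSqrt a b ζ).im ^ 2 =
      (ζ.re - a) * (b - ζ.re) + ζ.im ^ 2 := by
  have h := congrArg Complex.re (edgeSqrt_sq a b ζ)
  rw [pow_two] at h
  simp only [Complex.mul_re, Complex.sub_re, Complex.sub_im, Complex.ofReal_re,
    Complex.ofReal_im] at h
  linarith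

theorem edgeSqrt_im_neg (hab : a < b) (hζ : ζ.im < 0) (hre : ζ.re < (a + b) / 2) :
    (edgeSqrt a b ζ).im < 0 := by
  have h1 := edgeSqrt_re_pos hab (Or.inl hζ.ne)
  have h2 := edgeSqrt_re_mul_im a b ζ
  have h3 : ζ.im * (a + b - 2 * ζ.re) < 0 := mul_neg_of_neg_of_pos hζ (by linarith)
  by_contra! h
  nlinarith [mul_nonneg h1.le h]

theorem edgeSqrt_im_pos (hab : a < b) (hζ : ζ.im < 0) (hre : (a + b) / 2 < ζ.re) :
    0 < (edgeSqrt a b ζ).im := by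
  have h1 := edgeSqrt_re_pos hab (Or.inl hζ.ne)
  have h2 := edgeSqrt_re_mul_im a b ζ
  have h3 : 0 < ζ.im * (a + b - 2 * ζ.re) := mul_pos_of_neg_of_neg hζ (by linarith)
  by_contra! h
  nlinarith [mul_nonneg h1.le (neg_nonneg.2 h)]

theorem edgeSqrt_ofReal_im {x : ℝ} (hax : a < x) (hxb : x < b) : (edgeSqrt a b x).im = 0 := by
  have h1 := edgeSqrt_re_pos (hax.trans hxb) (ζ := x) (Or.inr (by simpa using ⟨hax, hxb⟩))
  have h2 := edgeSqrt_re_mul_im a b x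
  simp only [Complex.ofReal_im, zero_mul] at h2
  exact (mul_eq_zero.1 h2).resolve_left (by positivity)

theorem re_edgeSqrt_mul_conj_pos (ha : 0 < a) (hab : a < b) (hζ : ζ.im < 0) :
    0 < (edgeSqrt a b ζ).re * ζ.re + (edgeSqrt a b ζ).im * ζ.im := by
  have hp := edgeSqrt_re_pos hab (Or.inl hζ.ne)
  have h1 := edgeSqrt_re_mul_im a b ζ
  have h2 := edgeSqrt_re_sq_sub a b ζ
  generalize (edgeSqrt a b ζ).re = p at *
  generalize (edgeSqrt a b ζ).im = q at *
  generalize ζ.re = x at *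
  generalize ζ.im = y at *
  have hy2 : 0 < y ^ 2 := by nlinarith
  have hP : 0 < p ^ 2 := by positivity
  set m := x - (a + b) / 2 with hm
  have hpq : p * q = -(y * m) := by rw [hm]; linarith
  have hq2 : p ^ 2 * q ^ 2 = y ^ 2 * m ^ 2 := by
    rw [← mul_pow, hpq]; ring
  have hd : p ^ 2 - q ^ 2 = (b - a) ^ 2 / 4 - m ^ 2 + y ^ 2 := by rw [h2, hm]; ring
  have key : (p ^ 2 - y ^ 2) * (p ^ 2 + m ^ 2) = p ^ 2 * ((b - a) ^ 2 / 4) := by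
    have : p ^ 2 * (p ^ 2 - q ^ 2) = p ^ 2 * ((b - a) ^ 2 / 4 - m ^ 2 + y ^ 2) := by rw [hd]
    linarith
  have hPm : 0 < p ^ 2 + m ^ 2 := by positivity
  have hba : 0 < (b - a) ^ 2 / 4 := by
    have : 0 < b - a := by linarith
    positivity
  have hPy : 0 < p ^ 2 - y ^ 2 := by
    by_contra! h
    nlinarith [mul_nonneg (neg_nonneg.2 h) hPm.le, mul_pos hP hba]
  have goal : 0 < x * (p ^ 2 - y ^ 2) + y ^ 2 * ((a + b) / 2) := by
    by_cases hx : 0 ≤ x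
    · have h3 := mul_nonneg hx hPy.le
      have h4 : 0 < y ^ 2 * ((a + b) / 2) := by
        have : 0 < b := ha.trans hab
        positivity
      linarith
    · push Not at hx
      have hW : y ^ 2 * (p ^ 2 + m ^ 2) = p ^ 2 * (p ^ 2 + m ^ 2 - (b - a) ^ 2 / 4) := by
        linarith
      have hmul : (x * (p ^ 2 - y ^ 2) + y ^ 2 * ((a + b) / 2)) * (p ^ 2 + m ^ 2) =
          p ^ 2 * (x * ((b - a) ^ 2 / 4) + (a + b) / 2 * (p ^ 2 + m ^ 2 - (b - a) ^ 2 / 4)) := by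
        linear_combination x * key + (a + b) / 2 * hW
      have hpos : 0 < x * ((b - a) ^ 2 / 4) +
          (a + b) / 2 * (p ^ 2 + m ^ 2 - (b - a) ^ 2 / 4) := by
        have e1 : p ^ 2 + m ^ 2 - (b - a) ^ 2 / 4 = p ^ 2 + x ^ 2 - (a + b) * x + a * b := by
          rw [hm]; ring
        have hb : 0 < b := ha.trans hab
        have e2 : -(a + b) * x ≤ p ^ 2 + m ^ 2 - (b - a) ^ 2 / 4 := by
          rw [e1]; nlinarith [sq_nonneg x, mul_pos ha hb]
        have e3 : (a + b) / 2 * (-(a + b) * x) ≤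
            (a + b) / 2 * (p ^ 2 + m ^ 2 - (b - a) ^ 2 / 4) :=
          mul_le_mul_of_nonneg_left e2 (by positivity)
        have e4 : 0 < (-x) * ((a + b) ^ 2 / 2 - (b - a) ^ 2 / 4) := by
          refine mul_pos (by linarith) ?_
          nlinarith [mul_pos ha hb]
        linarith
      have := mul_pos hP hpos
      rw [← hmul] at this
      exact pos_of_mul_pos_left this hPm.le
  have : 0 < p * (p * x + q * y) := by
    have e : p * (p * x + q * y) = x * (p ^ 2 - y ^ 2) + y ^ 2 * ((a + b) / 2) := by
      linear_combination y * hpq + y ^ 2 * hm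
    rw [e]; exact goal
  exact pos_of_mul_pos_right this hp.le

end SquareRoot

section Root

/-- The principal branch of `z ^ (1 / r)`. -/
noncomputable def principalRoot (r : ℝ) (z : ℂ) : ℂ := z ^ ((r⁻¹ : ℝ) : ℂ)

variable {r : ℝ} {z : ℂ}

theorem principalRoot_ne_zero (hz : z ≠ 0) : principalRoot r z ≠ 0 := by
  rw [principalRoot, Complex.cpow_def_of_ne_zero hz]
  exact Complex.exp_ne_zero _

theorem norm_principalRoot (r : ℝ) (z : ℂ) : ‖principalRoot r z‖ = ‖z‖ ^ r⁻¹ :=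
  Complex.norm_cpow_real z _

theorem principalRoot_ofReal {x : ℝ} (hx : 0 ≤ x) :
    principalRoot r x = ((x ^ r⁻¹ : ℝ) : ℂ) := (Complex.ofReal_cpow hx _).symm

theorem log_principalRoot (hr : 1 ≤ r) (hz : z ≠ 0) :
    Complex.log (principalRoot r z) = Complex.log z * ((r⁻¹ : ℝ) : ℂ) := by
  have hr0 : 0 < r⁻¹ := by positivity
  have hr1 : r⁻¹ ≤ 1 := inv_le_one_of_one_le₀ hr
  have him : (Complex.log z * ((r⁻¹ : ℝ) : ℂ)).im = z.arg * r⁻¹ := by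
    rw [Complex.im_mul_ofReal, Complex.log_im]
  have h1 := Complex.neg_pi_lt_arg z
  have h2 := Complex.arg_le_pi z
  have h3 := Real.pi_pos
  rw [principalRoot, Complex.cpow_def_of_ne_zero hz]
  refine Complex.log_exp ?_ ?_ <;> rw [him]
  · by_cases h : 0 ≤ z.arg
    · linarith [mul_nonneg h hr0.le]
    · nlinarith
  · by_cases h : 0 ≤ z.arg
    · nlinarith
    · nlinarith

theorem arg_principalRoot (hr : 1 ≤ r) (hz : z ≠ 0) :
    (principalRoot r z).arg = z.arg * r⁻¹ := by
  have := congrArg Complex.im (log_principalRoot hr hz)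
  rwa [Complex.im_mul_ofReal, Complex.log_im, Complex.log_im] at this

theorem principalRoot_cpow (hr : 1 ≤ r) (hz : z ≠ 0) : principalRoot r z ^ (r : ℂ) = z := by
  rw [Complex.cpow_def_of_ne_zero (principalRoot_ne_zero hz), log_principalRoot hr hz, mul_assoc,
    ← Complex.ofReal_mul, inv_mul_cancel₀ (by positivity), Complex.ofReal_one, mul_one,
    Complex.exp_log hz]

theorem principalRoot_im_neg (hr : 1 ≤ r) (hz : z.im < 0) : (principalRoot r z).im < 0 := by
  have hz0 : z ≠ 0 := by rintro rfl; simp at hz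
  rw [← Complex.arg_neg_iff] at hz ⊢
  rw [arg_principalRoot hr hz0]
  exact mul_neg_of_neg_of_pos hz (by positivity)

theorem principalRoot_conj (hz : z ∈ Complex.slitPlane) :
    principalRoot r (starRingEnd ℂ z) = starRingEnd ℂ (principalRoot r z) := by
  have h := Complex.conj_cpow z ((r⁻¹ : ℝ) : ℂ) (Complex.mem_slitPlane_iff_arg.1 hz).1
  rw [Complex.conj_ofReal] at h
  exact h

theorem principalRoot_im_pos (hr : 1 ≤ r) (hz : 0 < z.im) : 0 < (principalRoot r z).im := by
  have h := principalRoot_im_neg (z := starRingEnd ℂ z) hr (by simpa using hz)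
  rw [principalRoot_conj (Or.inr hz.ne')] at h
  simpa using h

theorem differentiableAt_principalRoot (hz : z ∈ Complex.slitPlane) :
    DifferentiableAt ℂ (principalRoot r) z := differentiableAt_id.cpow_const hz

theorem principalRoot_mem_cutPlane {a b : ℝ} (ha : 0 < a) (hab : a < b) (hr : 1 ≤ r)
    (hz : z ∈ cutPlane (a ^ r) (b ^ r)) : principalRoot r z ∈ cutPlane a b := by
  by_cases him : z.im = 0
  · right
    obtain ⟨h1, h2⟩ := hz.resolve_left (by simpa using him)
    have hr0 : 0 < r := by positivity
    have hb := ha.trans hab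
    have hz0 : 0 < z.re := (Real.rpow_pos_of_pos ha r).trans h1
    have hzre : z = (z.re : ℂ) := Complex.ext (by simp) (by simpa using him)
    rw [hzre, principalRoot_ofReal hz0.le, Complex.ofReal_re]
    constructor
    · exact (Real.lt_rpow_inv_iff_of_pos ha.le hz0.le hr0).2 h1
    · exact (Real.rpow_inv_lt_iff_of_pos hz0.le hb.le hr0).2 h2
  · left
    rcases lt_or_gt_of_ne him with h | h
    · exact (principalRoot_im_neg hr h).ne
    · exact (principalRoot_im_pos hr h).ne'

theorem tendsto_principalRoot {x : ℝ} (hx : 0 < x) :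
    Tendsto (principalRoot r) (𝓝 (x : ℂ)) (𝓝 ((x ^ r⁻¹ : ℝ) : ℂ)) := by
  rw [← principalRoot_ofReal hx.le]
  exact (differentiableAt_principalRoot (Or.inl (by simpa using hx))).continuousAt

theorem tendsto_principalRoot_zero (hr : 1 ≤ r) : Tendsto (principalRoot r) (𝓝 0) (𝓝 0) := by
  rw [tendsto_zero_iff_norm_tendsto_zero]
  simp_rw [norm_principalRoot]
  have h : Tendsto (fun z : ℂ => ‖z‖) (𝓝 0) (𝓝 0) := by
    simpa using (continuous_norm (E := ℂ)).tendsto 0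
  have hr0 : 0 < r⁻¹ := by positivity
  have h2 := (Real.continuous_rpow_const hr0.le).tendsto (0 : ℝ)
  rw [Real.zero_rpow hr0.ne'] at h2
  exact h2.comp h

theorem tendsto_principalRoot_cocompact (hr : 1 ≤ r) :
    Tendsto (fun z => ‖principalRoot r z‖) (cocompact ℂ) atTop := by
  simp_rw [norm_principalRoot]
  have hr0 : 0 < r⁻¹ := by positivity
  exact (tendsto_rpow_atTop hr0).comp tendsto_norm_cocompact_atTop

theorem principalRoot_div_im_nonneg (hr : 1 ≤ r) (hz : z.im < 0) :
    0 ≤ (principalRoot r z / z).im := by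
  have hz0 : z ≠ 0 := by rintro rfl; simp at hz
  have harg := Complex.arg_neg_iff.2 hz
  have h1 := Complex.neg_pi_lt_arg z
  have hr0 : 0 < r⁻¹ := by positivity
  have hr1 : r⁻¹ ≤ 1 := inv_le_one_of_one_le₀ hr
  have h : principalRoot r z / z = Complex.exp (Complex.log z * ((r⁻¹ - 1 : ℝ) : ℂ)) := by
    rw [principalRoot, Complex.cpow_def_of_ne_zero hz0]
    nth_rw 2 [← Complex.exp_log hz0]
    rw [← Complex.exp_sub]
    congr 1
    push_cast
    ring
  rw [h, Complex.exp_im, Complex.im_mul_ofReal, Complex.log_im]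
  refine mul_nonneg (Real.exp_pos _).le (Real.sin_nonneg_of_mem_Icc ⟨?_, ?_⟩)
  · nlinarith
  · nlinarith

end Root

section Jump

/-- The jump across `(a ^ r, b ^ r)` of the Cauchy transform of the `r`-th power of an fGIG law. -/
noncomputable def fGIGJump (a b r α β : ℝ) (z : ℂ) : ℂ :=
  -(Complex.I / r) * edgeSqrt a b (principalRoot r z) * (α + β / principalRoot r z) / z

variable {a b r α β : ℝ} {z : ℂ}

theorem differentiableOn_fGIGJump (ha : 0 < a) (hab : a < b) (hr : 1 ≤ r) :
    DifferentiableOn ℂ (fGIGJump a b r α β) (cutPlane (a ^ r) (b ^ r)) := by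
  intro z hz
  have hzs : z ∈ Complex.slitPlane :=
    ContinuationData.mem_slitPlane_of_mem_cutPlane (Real.rpow_pos_of_pos ha r) hz
  have hz0 := Complex.slitPlane_ne_zero hzs
  have h1 : DifferentiableAt ℂ (fun z => edgeSqrt a b (principalRoot r z)) z :=
    (differentiableAt_edgeSqrt hab (principalRoot_mem_cutPlane ha hab hr hz)).comp z
      (differentiableAt_principalRoot hzs)
  have h2 : DifferentiableAt ℂ (fun z => (β : ℂ) / principalRoot r z) z :=
    (differentiableAt_const _).div (differentiableAt_principalRoot hzs) (principalRoot_ne_zero hz0)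
  exact (((h1.const_mul _).mul (h2.const_add _)).div differentiableAt_id
    hz0).differentiableWithinAt

theorem fGIGJump_sq (a b r α β : ℝ) (z : ℂ) : fGIGJump a b r α β z ^ 2 =
    -((principalRoot r z - a) * (b - principalRoot r z)) * (α + β / principalRoot r z) ^ 2 /
      (r * z) ^ 2 := by
  rw [← edgeSqrt_sq, fGIGJump, div_pow, mul_pow, mul_pow, neg_sq, div_pow, Complex.I_sq]
  ring

theorem tendsto_kappa {x : ℝ} (hx : 0 < x) :
    Tendsto (fun z => (α : ℂ) + β / principalRoot r z) (𝓝 (x : ℂ))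
      (𝓝 ((α + β / x ^ r⁻¹ : ℝ) : ℂ)) := by
  have h : ((x ^ r⁻¹ : ℝ) : ℂ) ≠ 0 := by exact_mod_cast (Real.rpow_pos_of_pos hx _).ne'
  have := ((tendsto_const_nhds (x := (β : ℂ))).div (tendsto_principalRoot (r := r) hx) h).const_add
    (α : ℂ)
  push_cast at this ⊢
  exact this

theorem tendsto_fGIGJump_sq (hr : 1 ≤ r) {x : ℝ} (hx : 0 < x) :
    Tendsto (fun z => fGIGJump a b r α β z ^ 2) (𝓝 (x : ℂ))
      (𝓝 ((-((x ^ r⁻¹ - a) * (b - x ^ r⁻¹)) * (α + β / x ^ r⁻¹) ^ 2 / (r * x) ^ 2 : ℝ) : ℂ)) := by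
  have h1 := tendsto_principalRoot (r := r) hx
  have h2 : ((r : ℂ) * x) ^ 2 ≠ 0 := by
    have : r * x ≠ 0 := by positivity
    exact_mod_cast pow_ne_zero 2 this
  have h3 := (((h1.sub_const (a : ℂ)).mul (h1.const_sub (b : ℂ))).neg.mul
    ((tendsto_kappa (α := α) (β := β) (r := r) hx).pow 2)).div
    ((tendsto_id.const_mul (r : ℂ)).pow 2) h2
  simp_rw [fGIGJump_sq]
  push_cast at h3 ⊢
  exact h3

theorem tendsto_zero_of_sq {f : ℂ → ℂ} {l : Filter ℂ} (h : Tendsto (fun z => f z ^ 2) l (𝓝 0)) :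
    Tendsto f l (𝓝 0) := by
  rw [tendsto_zero_iff_norm_tendsto_zero] at h ⊢
  have h2 := (Real.continuous_sqrt.tendsto 0).comp h
  rw [Real.sqrt_zero] at h2
  refine h2.congr fun z => ?_
  simp [norm_pow, Real.sqrt_sq (norm_nonneg _)]

theorem rpow_inv_rpow_self {x : ℝ} (hx : 0 < x) (hr : 1 ≤ r) : (x ^ r) ^ r⁻¹ = x :=
  Real.rpow_rpow_inv hx.le (by positivity)

theorem tendsto_fGIGJump_left (ha : 0 < a) (hr : 1 ≤ r) :
    Tendsto (fGIGJump a b r α β) (𝓝 ((a ^ r : ℝ) : ℂ)) (𝓝 0) := by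
  have h := tendsto_fGIGJump_sq (a := a) (b := b) (α := α) (β := β) hr (Real.rpow_pos_of_pos ha r)
  rw [rpow_inv_rpow_self ha hr] at h
  refine tendsto_zero_of_sq ?_
  simpa using h

theorem tendsto_fGIGJump_right (hb : 0 < b) (hr : 1 ≤ r) :
    Tendsto (fGIGJump a b r α β) (𝓝 ((b ^ r : ℝ) : ℂ)) (𝓝 0) := by
  have h := tendsto_fGIGJump_sq (a := a) (b := b) (α := α) (β := β) hr (Real.rpow_pos_of_pos hb r)
  rw [rpow_inv_rpow_self hb hr] at h
  refine tendsto_zero_of_sq ?_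
  simpa using h

theorem fGIGJump_mid (ha : 0 < a) (hab : a < b) (hr : 1 ≤ r) (hα : 0 < α) (hβ : 0 < β) {x : ℝ}
    (hx1 : a ^ r < x) (hx2 : x < b ^ r) :
    (fGIGJump a b r α β x).re = 0 ∧ (fGIGJump a b r α β x).im < 0 := by
  have hr0 : 0 < r := by positivity
  have hx0 : 0 < x := (Real.rpow_pos_of_pos ha r).trans hx1
  have hax : a < x ^ r⁻¹ := (Real.lt_rpow_inv_iff_of_pos ha.le hx0.le hr0).2 hx1
  have hxb : x ^ r⁻¹ < b := (Real.rpow_inv_lt_iff_of_pos hx0.le (ha.trans hab).le hr0).2 hx2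
  have h1 := edgeSqrt_re_pos (ζ := ((x ^ r⁻¹ : ℝ) : ℂ)) hab (Or.inr (by simpa using ⟨hax, hxb⟩))
  have h2 := edgeSqrt_ofReal_im hax hxb
  rw [fGIGJump, principalRoot_ofReal hx0.le]
  set y := x ^ r⁻¹ with hy
  have hy0 : 0 < y := ha.trans hax
  have h3 : edgeSqrt a b y = ((edgeSqrt a b y).re : ℂ) := Complex.ext (by simp) (by simpa using h2)
  have h4 : -(Complex.I / r) * edgeSqrt a b y * (α + β / (y : ℂ)) / x =
      ((-((edgeSqrt a b y).re * (α + β / y) / (r * x)) : ℝ) : ℂ) * Complex.I := by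
    rw [h3]
    push_cast
    simp only [Complex.ofReal_re]
    ring
  rw [h4, Complex.re_ofReal_mul, Complex.im_ofReal_mul, Complex.I_re, Complex.I_im]
  refine ⟨by simp, ?_⟩
  have : 0 < (edgeSqrt a b y).re * (α + β / y) / (r * x) := by positivity
  linarith

theorem kappa_ne_zero (hβ : 0 < β) {ζ : ℂ} (hζ : ζ.im < 0) : (α : ℂ) + β / ζ ≠ 0 := by
  intro h
  have h1 := congrArg Complex.im h
  have h2 : 0 < Complex.normSq ζ := Complex.normSq_pos.2 (by rintro rfl; simp at hζ)
  rw [div_eq_mul_inv, Complex.add_im, Complex.im_ofReal_mul, Complex.inv_im, Complex.ofReal_im,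
    zero_add, Complex.zero_im] at h1
  have : 0 < β * (-ζ.im / Complex.normSq ζ) := mul_pos hβ (div_pos (by linarith) h2)
  linarith

theorem fGIGJump_ne_zero (hab : a < b) (hr : 1 ≤ r) (hβ : 0 < β)
    (hz : z.im < 0) : fGIGJump a b r α β z ≠ 0 := by
  have hz0 : z ≠ 0 := by rintro rfl; simp at hz
  have hζ := principalRoot_im_neg hr hz
  have h1 : edgeSqrt a b (principalRoot r z) ≠ 0 := by
    intro h
    have := edgeSqrt_re_pos hab (Or.inl hζ.ne)
    rw [h] at this
    simp at this
  have hr0 : (r : ℂ) ≠ 0 := by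
    have : r ≠ 0 := by positivity
    exact_mod_cast this
  exact div_ne_zero (mul_ne_zero (mul_ne_zero (neg_ne_zero.2 (div_ne_zero Complex.I_ne_zero hr0))
    h1) (kappa_ne_zero hβ hζ)) hz0

theorem re_edgeSqrt_mul_kappa_pos (ha : 0 < a) (hab : a < b) (hα : 0 < α) (hβ : 0 < β) {ζ : ℂ}
    (hζ : ζ.im < 0) : 0 < (edgeSqrt a b ζ * (α + β / ζ)).re := by
  have h1 := edgeSqrt_re_pos hab (Or.inl hζ.ne)
  have h2 := re_edgeSqrt_mul_conj_pos ha hab hζ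
  have h3 : 0 < Complex.normSq ζ := Complex.normSq_pos.2 (by rintro rfl; simp at hζ)
  have h4 : (edgeSqrt a b ζ * (α + β / ζ)).re = α * (edgeSqrt a b ζ).re +
      β * (((edgeSqrt a b ζ).re * ζ.re + (edgeSqrt a b ζ).im * ζ.im) / Complex.normSq ζ) := by
    rw [mul_add, Complex.add_re, mul_comm, Complex.re_ofReal_mul, mul_div_left_comm,
      Complex.re_ofReal_mul, Complex.div_re, add_div]
  rw [h4]
  positivity

theorem asympHalfPlane_fGIGJump_neg (ha : 0 < a) (hab : a < b) (hr : 1 ≤ r) (hα : 0 < α)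
    (hβ : 0 < β) {x : ℝ} (hx : x < 0) :
    AsympHalfPlane (-Complex.I) (fGIGJump a b r α β) (𝓝[{z | z.im < 0}] (x : ℂ)) := by
  have hr0 : 0 < r := by positivity
  have hq : 0 < -(1 / (r * x)) := by
    have : r * x < 0 := mul_neg_of_pos_of_neg hr0 hx
    exact neg_pos.2 (one_div_neg.2 this)
  have hrx : (r : ℂ) * x ≠ 0 := by exact_mod_cast (mul_neg_of_pos_of_neg hr0 hx).ne
  refine AsympHalfPlane.of_mul (q := -(1 / (r * x))) (Q := fun z => -(1 / (r * z)))
    (P := fun z => Complex.I * (edgeSqrt a b (principalRoot r z) * (α + β / principalRoot r z)))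
    hq (Eventually.of_forall fun z => ?_) ?_ ?_
  · rw [fGIGJump]; ring
  · filter_upwards [self_mem_nhdsWithin] with z hz
    have := re_edgeSqrt_mul_kappa_pos ha hab hα hβ (principalRoot_im_neg hr hz)
    rw [← mul_assoc, neg_mul, Complex.I_mul_I, neg_neg, one_mul]
    exact this.le
  · have := ((tendsto_const_nhds (x := (1 : ℂ))).div
      ((tendsto_id (x := 𝓝 (x : ℂ))).const_mul (r : ℂ)) hrx).neg
    push_cast
    exact this.mono_left nhdsWithin_le_nhds

theorem tendsto_kappa_div (hr : 1 ≤ r) {x : ℝ} (hx : 0 < x) :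
    Tendsto (fun z => (α + β / principalRoot r z) / (r * z)) (𝓝 (x : ℂ))
      (𝓝 (((α + β / x ^ r⁻¹) / (r * x) : ℝ) : ℂ)) := by
  have hrx : (r : ℂ) * x ≠ 0 := by
    have : r * x ≠ 0 := by positivity
    exact_mod_cast this
  have := (tendsto_kappa (α := α) (β := β) (r := r) hx).div
      ((tendsto_id (x := 𝓝 (x : ℂ))).const_mul (r : ℂ)) hrx
  push_cast at this ⊢
  exact this

theorem asympHalfPlane_fGIGJump_left (ha : 0 < a) (hab : a < b) (hr : 1 ≤ r) (hα : 0 < α)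
    (hβ : 0 < β) :
    AsympHalfPlane (-1) (fGIGJump a b r α β) (𝓝[{z | z.im < 0}] ((a ^ r : ℝ) : ℂ)) := by
  have hx := Real.rpow_pos_of_pos ha r
  have hr0 : 0 < r := by positivity
  refine AsympHalfPlane.of_mul (P := fun z => -(Complex.I * edgeSqrt a b (principalRoot r z)))
    (by positivity) (Eventually.of_forall fun z => ?_) ?_
    ((tendsto_kappa_div (α := α) (β := β) hr hx).mono_left nhdsWithin_le_nhds)
  · rw [fGIGJump]; ring
  · have h1 := (Complex.continuous_re.tendsto _).comp (tendsto_principalRoot (r := r) hx)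
    rw [Complex.ofReal_re, rpow_inv_rpow_self ha hr] at h1
    have h2 := (h1.mono_left (nhdsWithin_le_nhds (s := {z | z.im < 0}))).eventually_lt_const
      (show a < (a + b) / 2 by linarith)
    filter_upwards [self_mem_nhdsWithin, h2] with z hz hre
    have := edgeSqrt_im_neg hab (principalRoot_im_neg hr hz) hre
    simp only [mul_neg, neg_mul, one_mul, neg_neg, Complex.mul_re, Complex.I_re, Complex.I_im]
    linarith

theorem asympHalfPlane_fGIGJump_right (ha : 0 < a) (hab : a < b) (hr : 1 ≤ r) (hα : 0 < α)
    (hβ : 0 < β) {x : ℝ} (hbx : b ^ r ≤ x) :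
    AsympHalfPlane 1 (fGIGJump a b r α β) (𝓝[{z | z.im < 0}] (x : ℂ)) := by
  have hb := ha.trans hab
  have hx := (Real.rpow_pos_of_pos hb r).trans_le hbx
  have hr0 : 0 < r := by positivity
  refine AsympHalfPlane.of_mul (P := fun z => -(Complex.I * edgeSqrt a b (principalRoot r z)))
    (by positivity) (Eventually.of_forall fun z => ?_) ?_
    ((tendsto_kappa_div (α := α) (β := β) hr hx).mono_left nhdsWithin_le_nhds)
  · rw [fGIGJump]; ring
  · have h1 := (Complex.continuous_re.tendsto _).comp (tendsto_principalRoot (r := r) hx)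
    rw [Complex.ofReal_re] at h1
    have h3 : b ≤ x ^ r⁻¹ := (Real.le_rpow_inv_iff_of_pos hb.le hx.le hr0).2 hbx
    have h2 := (h1.mono_left (nhdsWithin_le_nhds (s := {z | z.im < 0}))).eventually_const_lt
      (show (a + b) / 2 < x ^ r⁻¹ by linarith)
    filter_upwards [self_mem_nhdsWithin, h2] with z hz hre
    have := edgeSqrt_im_pos hab (principalRoot_im_neg hr hz) hre
    simp only [one_mul, Complex.neg_re, Complex.mul_re, Complex.I_re, Complex.I_im]
    linarith

theorem fGIGJump_sq_pos (ha : 0 < a) (hab : a < b) (hr : 1 ≤ r) (hα : 0 < α) (hβ : 0 < β) {x : ℝ}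
    (hx : 0 < x) (hx' : x < a ^ r ∨ b ^ r < x) :
    ∃ ν : ℝ, 0 < ν ∧
      Tendsto (fun z => fGIGJump a b r α β z ^ 2) (𝓝[{z | z.im < 0}] (x : ℂ)) (𝓝 (ν : ℂ)) := by
  refine ⟨_, ?_, (tendsto_fGIGJump_sq hr hx).mono_left nhdsWithin_le_nhds⟩
  have hr0 : 0 < r := by positivity
  have hy := Real.rpow_pos_of_pos hx r⁻¹
  have : 0 < -((x ^ r⁻¹ - a) * (b - x ^ r⁻¹)) := by
    rcases hx' with h | h
    · have := (Real.rpow_inv_lt_iff_of_pos hx.le ha.le hr0).2 h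
      nlinarith
    · have := (Real.lt_rpow_inv_iff_of_pos (ha.trans hab).le hx.le hr0).2 h
      nlinarith
  positivity

theorem tendsto_norm_fGIGJump_zero (ha : 0 < a) (hab : a < b) (hr : 1 ≤ r) (hβ : 0 < β) :
    Tendsto (fun z => ‖fGIGJump a b r α β z‖) (𝓝[{z | z.im < 0}] 0) atTop := by
  have hr0 : 0 < r := by positivity
  have hb := ha.trans hab
  have h1 := tendsto_principalRoot_zero hr
  have h2 : Tendsto (fun z => ‖-((principalRoot r z - a) * (b - principalRoot r z)) *
      (α * principalRoot r z + β) ^ 2‖) (𝓝[{z | z.im < 0}] 0) (𝓝 (a * b * β ^ 2)) := by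
    have h3 := (((h1.sub_const (a : ℂ)).mul (h1.const_sub (b : ℂ))).neg.mul
      (((h1.const_mul (α : ℂ)).add_const (β : ℂ)).pow 2)).norm
    have h4 : ‖-((0 - (a : ℂ)) * (b - 0)) * (α * 0 + β) ^ 2‖ = a * b * β ^ 2 := by
      rw [show -((0 - (a : ℂ)) * (b - 0)) * (α * 0 + β) ^ 2 = ((a * b * β ^ 2 : ℝ) : ℂ) by
        push_cast; ring, Complex.norm_real, Real.norm_of_nonneg (by positivity)]
    rw [h4] at h3
    exact h3.mono_left nhdsWithin_le_nhds
  have h5 : Tendsto (fun z => ‖(r * z * principalRoot r z) ^ 2‖) (𝓝[{z | z.im < 0}] 0)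
      (𝓝[>] 0) := by
    refine tendsto_nhdsWithin_iff.2 ⟨?_, ?_⟩
    · have := ((((tendsto_id (x := 𝓝 (0 : ℂ))).const_mul (r : ℂ)).mul h1).pow 2).norm
      simp only [mul_zero, ne_eq, OfNat.ofNat_ne_zero, not_false_eq_true, zero_pow, norm_zero] at this
      exact this.mono_left nhdsWithin_le_nhds
    · filter_upwards [self_mem_nhdsWithin] with z hz
      have hz0 : z ≠ 0 := by rintro rfl; simp at hz
      have hrc : (r : ℂ) ≠ 0 := by exact_mod_cast hr0.ne'
      exact norm_pos_iff.2 (pow_ne_zero 2 (mul_ne_zero (mul_ne_zero hrc hz0)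
        (principalRoot_ne_zero hz0)))
  have h6 := h2.pos_mul_atTop (by positivity) h5.inv_tendsto_nhdsGT_zero
  refine (Real.tendsto_sqrt_atTop.comp h6).congr' ?_
  filter_upwards [self_mem_nhdsWithin] with z hz
  have hz0 : z ≠ 0 := by rintro rfl; simp at hz
  have hζ0 := principalRoot_ne_zero (r := r) hz0
  have hrc : (r : ℂ) ≠ 0 := by exact_mod_cast hr0.ne'
  rw [← Real.sqrt_sq (norm_nonneg (fGIGJump a b r α β z)), ← norm_pow, fGIGJump_sq]
  simp only [Function.comp_apply, Pi.inv_apply]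
  rw [← norm_inv, ← norm_mul]
  congr 2
  field_simp

theorem tendsto_edgeSqrt_div (ha : 0 < a) (hab : a < b) (hr : 1 ≤ r) :
    Tendsto (fun z => edgeSqrt a b (principalRoot r z) / principalRoot r z)
      (cocompact ℂ ⊓ 𝓟 {z | z.im < 0}) (𝓝 Complex.I) := by
  have hη : Tendsto (fun z => (principalRoot r z)⁻¹) (cocompact ℂ ⊓ 𝓟 {z | z.im < 0}) (𝓝 0) := by
    rw [tendsto_zero_iff_norm_tendsto_zero]
    simp_rw [norm_inv]
    exact (tendsto_inv_atTop_zero.comp (tendsto_principalRoot_cocompact hr)).mono_left inf_le_left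
  have hlim : Tendsto (fun z => ‖(principalRoot r z)⁻¹ * (a + b) - a * b * (principalRoot r z)⁻¹ ^ 2‖)
      (cocompact ℂ ⊓ 𝓟 {z | z.im < 0}) (𝓝 0) := by
    have := ((hη.mul_const ((a : ℂ) + b)).sub ((hη.pow 2).const_mul ((a : ℂ) * b))).norm
    simpa using this
  have hsmall := (tendsto_zero_iff_norm_tendsto_zero.1 hη).eventually_lt_const
    (show 0 < 1 / (2 * (a + b)) by have := ha.trans hab; positivity)
  rw [tendsto_iff_norm_sub_tendsto_zero]
  refine squeeze_zero' (Eventually.of_forall fun z => norm_nonneg _) ?_ hlim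
  filter_upwards [hsmall, mem_inf_of_right (mem_principal_self _)] with z hz him
  have hζ := principalRoot_im_neg hr him
  set ζ := principalRoot r z with hζdef
  have hζ0 : ζ ≠ 0 := by intro h; rw [h] at hζ; simp at hζ
  have hb := ha.trans hab
  set σ := edgeSqrt a b ζ / ζ with hσ
  have hsq : σ ^ 2 + 1 = ζ⁻¹ * (a + b) - a * b * ζ⁻¹ ^ 2 := by
    rw [hσ, div_pow, edgeSqrt_sq]
    field_simp
    ring
  have hre : 0 < σ.re := by
    rw [hσ, Complex.div_re, ← add_div]
    exact div_pos (re_edgeSqrt_mul_conj_pos ha hab hζ) (Complex.normSq_pos.2 hζ0)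
  have hηim : 0 < (ζ⁻¹).im := by
    rw [Complex.inv_im]
    exact div_pos (by linarith) (Complex.normSq_pos.2 hζ0)
  have him2 : 2 * σ.re * σ.im = (ζ⁻¹).im * ((a + b) - 2 * (a * b) * (ζ⁻¹).re) := by
    have h := congrArg Complex.im hsq
    simp only [pow_two, Complex.add_im, Complex.mul_im, Complex.one_im, Complex.sub_im,
      Complex.add_re, Complex.ofReal_re, Complex.ofReal_im, Complex.mul_re] at h
    linarith
  have hpos : 0 < (a + b) - 2 * (a * b) * (ζ⁻¹).re := by
    have h1 := (Complex.abs_re_le_norm ζ⁻¹).trans_lt hz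
    have h2 := (le_abs_self _).trans_lt h1
    rw [lt_div_iff₀ (by positivity)] at h2
    have h3 : 2 * (a * b) * (ζ⁻¹).re ≤ 2 * (a * b) * (1 / (2 * (a + b))) := by
      refine mul_le_mul_of_nonneg_left ?_ (by positivity)
      exact (le_abs_self _).trans h1.le
    have h4 : 2 * (a * b) * (1 / (2 * (a + b))) < a + b := by
      rw [mul_one_div, div_lt_iff₀ (by positivity)]
      nlinarith [mul_pos ha hb]
    linarith
  have hσim : 0 < σ.im := by
    have := mul_pos hηim hpos
    rw [← him2] at this
    exact pos_of_mul_pos_right this (by positivity)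
  have h1 : 1 ≤ ‖σ + Complex.I‖ := by
    refine le_trans ?_ (Complex.abs_im_le_norm _)
    rw [Complex.add_im, Complex.I_im]
    exact le_trans (by linarith) (le_abs_self _)
  rw [← hsq, show σ ^ 2 + 1 = (σ - Complex.I) * (σ + Complex.I) by
    linear_combination Complex.I_sq, norm_mul]
  exact le_mul_of_one_le_right (norm_nonneg _) h1

theorem tendsto_fGIGJump_div (ha : 0 < a) (hab : a < b) (hr : 1 ≤ r) :
    Tendsto (fun z => fGIGJump a b r α β z / (principalRoot r z / z))
      (cocompact ℂ ⊓ 𝓟 {z | z.im < 0}) (𝓝 ((α / r : ℝ) : ℂ)) := by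
  have hη : Tendsto (fun z => (principalRoot r z)⁻¹) (cocompact ℂ ⊓ 𝓟 {z | z.im < 0}) (𝓝 0) := by
    rw [tendsto_zero_iff_norm_tendsto_zero]
    simp_rw [norm_inv]
    exact (tendsto_inv_atTop_zero.comp (tendsto_principalRoot_cocompact hr)).mono_left inf_le_left
  have h1 := ((tendsto_edgeSqrt_div ha hab hr).const_mul (-(Complex.I / r))).mul
    ((hη.const_mul (β : ℂ)).const_add (α : ℂ))
  have h2 : -(Complex.I / r) * Complex.I * (α + β * 0) = ((α / r : ℝ) : ℂ) := by
    push_cast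
    linear_combination (-(α : ℂ) / r) * Complex.I_sq
  rw [h2] at h1
  refine h1.congr' ?_
  filter_upwards [mem_inf_of_right (mem_principal_self _)] with z hz
  have hz0 : z ≠ 0 := by rintro rfl; simp at hz
  have hζ0 := principalRoot_ne_zero (r := r) hz0
  rw [fGIGJump]
  field_simp

theorem tendsto_norm_mul_principalRoot_div (hr : 1 ≤ r) :
    Tendsto (fun z => ‖z * (principalRoot r z / z)‖) (cocompact ℂ ⊓ 𝓟 {z | z.im < 0}) atTop := by
  refine ((tendsto_principalRoot_cocompact hr).mono_left inf_le_left).congr' ?_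
  filter_upwards [mem_inf_of_right (mem_principal_self _)] with z hz
  have hz0 : z ≠ 0 := by rintro rfl; simp at hz
  rw [mul_div_cancel₀ _ hz0]

end Jump

section SemicircleTransform

variable {a b : ℝ} {ζ : ℂ}

theorem integral_Icc_semicircle (hab : a < b) {σ : ℝ} (hσ : σ ^ 2 = 1) (hζ : 0 < σ * ζ.im) :
    ∫ x in Icc a b, (Real.sqrt ((x - a) * (b - x)) : ℂ) * (ζ - x)⁻¹ =
      Real.pi * (ζ - (a + b) / 2 - σ * Complex.I * edgeSqrt a b ζ) := by
  set s := edgeSqrt a b ζ with hs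
  have hζim : ζ.im ≠ 0 := by rintro h; simp [h] at hζ
  have hp := edgeSqrt_re_pos hab (Or.inl hζim)
  have hpq := edgeSqrt_re_mul_im a b ζ
  rw [← hs] at hp hpq
  have hd : 0 < (b - a) / 2 := by linarith
  have hdc : (((b - a) / 2 : ℝ) : ℂ) ≠ 0 := by exact_mod_cast hd.ne'
  have hσc : (σ : ℂ) ^ 2 = 1 := by exact_mod_cast hσ
  set v := (ζ - (a + b) / 2 - σ * Complex.I * s) / ((b - a) / 2 : ℝ) with hv
  set v' := (ζ - (a + b) / 2 + σ * Complex.I * s) / ((b - a) / 2 : ℝ) with hv'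
  have hvv : v * v' = 1 := by
    rw [hv, hv', div_mul_div_comm, div_eq_one_iff_eq (mul_ne_zero hdc hdc)]
    have h1 := edgeSqrt_sq a b ζ
    rw [← hs] at h1
    push_cast
    linear_combination (-σ ^ 2 * s ^ 2) * Complex.I_sq + s ^ 2 * hσc + h1
  have hv0 : v ≠ 0 := left_ne_zero_of_mul_eq_one hvv
  have hvinv : v⁻¹ = v' := inv_eq_of_mul_eq_one_right hvv
  have hlt : ‖v‖ < ‖v'‖ := by
    rw [hv, hv', norm_div, norm_div]
    refine div_lt_div_of_pos_right ?_ (norm_pos_iff.2 hdc)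
    rw [← sq_lt_sq₀ (norm_nonneg _) (norm_nonneg _), ← Complex.normSq_eq_norm_sq,
      ← Complex.normSq_eq_norm_sq, Complex.normSq_apply, Complex.normSq_apply]
    have e1 : ((a : ℂ) + b) / 2 = (((a + b) / 2 : ℝ) : ℂ) := by push_cast; rfl
    rw [e1]
    simp only [Complex.sub_re, Complex.add_re, Complex.mul_re, Complex.mul_im, Complex.sub_im,
      Complex.add_im, Complex.I_re, Complex.I_im, Complex.ofReal_re, Complex.ofReal_im]
    have key : 0 < σ * (ζ.im * s.re - (ζ.re - (a + b) / 2) * s.im) := by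
      have h2 : s.re * (σ * (ζ.im * s.re - (ζ.re - (a + b) / 2) * s.im)) =
          σ * ζ.im * (s.re ^ 2 + (ζ.re - (a + b) / 2) ^ 2) := by
        linear_combination (-(σ * (ζ.re - (a + b) / 2)) / 2) * hpq
      have h3 : 0 < σ * ζ.im * (s.re ^ 2 + (ζ.re - (a + b) / 2) ^ 2) := by positivity
      rw [← h2] at h3
      exact pos_of_mul_pos_right h3 hp.le
    nlinarith
  have hv1 : ‖v‖ < 1 := by
    have h1 : ‖v‖ * ‖v'‖ = 1 := by rw [← norm_mul, hvv, norm_one]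
    nlinarith [norm_nonneg v, norm_nonneg v']
  have hmain := integral_semicircle hv0 hv1 (c := (a + b) / 2) hd (a := a) (b := b) (by ring)
    (by ring) (ζ := ζ) (by
      rw [hvinv, hv, hv']
      field_simp
      push_cast
      ring)
  rw [integral_Icc_eq_integral_Ioc, ← intervalIntegral.integral_of_le hab.le]
  simp only [← div_eq_mul_inv]
  rw [hmain, mul_assoc, hv, mul_div_cancel₀ _ hdc]

end SemicircleTransform

section Pushforward

variable {a b α₁ α₂ r : ℝ}

theorem measurable_fGIG_density (a b α₁ α₂ : ℝ) : Measurable (fun x => ENNReal.ofReal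
      ((Set.Ioo a b).indicator
        (fun x => Real.sqrt ((x - a) * (b - x)) / (2 * Real.pi * x) *
          (α₁ + α₂ / (Real.sqrt (a * b) * x))) x)) := by
  refine (Measurable.indicator ?_ measurableSet_Ioo).ennreal_ofReal
  fun_prop

theorem ae_fGIG_mem_Ioo (a b α₁ α₂ : ℝ) : ∀ᵐ x ∂(fGIG a b α₁ α₂), x ∈ Ioo a b := by
  rw [fGIG, ae_withDensity_iff (measurable_fGIG_density a b α₁ α₂)]
  refine ae_of_all _ fun x hx => ?_
  by_contra h
  simp [indicator_of_notMem h] at hx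

theorem ae_map_fGIG_mem_Ioo (ha : 0 < a) (hr : 1 ≤ r) :
    ∀ᵐ y ∂(Measure.map (fun x : ℝ => x ^ r) (fGIG a b α₁ α₂)), y ∈ Ioo (a ^ r) (b ^ r) := by
  refine (ae_map_iff (p := fun y => y ∈ Ioo (a ^ r) (b ^ r)) (by fun_prop) measurableSet_Ioo).2 ?_
  filter_upwards [ae_fGIG_mem_Ioo a b α₁ α₂] with x hx
  have hr0 : 0 < r := by positivity
  exact ⟨Real.rpow_lt_rpow ha.le hx.1 hr0, Real.rpow_lt_rpow (ha.trans hx.1).le hx.2 hr0⟩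

/-- The ratio of the fGIG density to `√((x - a) (b - x))`. -/
noncomputable def fGIGFactor (α β : ℝ) (ζ : ℂ) : ℂ := (α + β / ζ) / (2 * Real.pi * ζ)

theorem cauchyTransform_map_fGIG (ha : 0 < a) (hab : a < b) (hα₁ : 0 < α₁) (hα₂ : 0 < α₂) (z : ℂ) :
    cauchyTransform (Measure.map (fun x : ℝ => x ^ r) (fGIG a b α₁ α₂)) z =
      ∫ x in Icc a b, (Real.sqrt ((x - a) * (b - x)) : ℂ) *
        (fGIGFactor α₁ (α₂ / Real.sqrt (a * b)) x * (z - ((x ^ r : ℝ) : ℂ))⁻¹) := by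
  rw [cauchyTransform, integral_map (by fun_prop) (aestronglyMeasurable_cauchy _ z), fGIG,
    integral_withDensity_eq_integral_toReal_smul (measurable_fGIG_density a b α₁ α₂)
      (ae_of_all _ fun x => ENNReal.ofReal_lt_top), integral_Icc_eq_integral_Ioo,
    ← integral_indicator measurableSet_Ioo]
  refine integral_congr_ae (ae_of_all _ fun x => ?_)
  by_cases hx : x ∈ Ioo a b
  · have hx0 : 0 < x := ha.trans hx.1
    have hb : 0 < b := ha.trans hab
    have hab0 : 0 < Real.sqrt (a * b) := Real.sqrt_pos.2 (mul_pos ha hb)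
    simp only [indicator_of_mem hx]
    rw [ENNReal.toReal_ofReal (by have := Real.pi_pos; positivity), Complex.real_smul,
      fGIGFactor]
    have hxc : (x : ℂ) ≠ 0 := by exact_mod_cast hx0.ne'
    have hsc : (Real.sqrt (a * b) : ℂ) ≠ 0 := by exact_mod_cast hab0.ne'
    have hpi : (Real.pi : ℂ) ≠ 0 := by exact_mod_cast Real.pi_ne_zero
    push_cast
    field_simp
  · simp only [indicator_of_notMem hx]
    simp

end Pushforward

section Continuation

variable {a b r α β : ℝ} {z : ℂ}

theorem hasDerivAt_principalRoot (hz : z ∈ Complex.slitPlane) :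
    HasDerivAt (principalRoot r) (principalRoot r z / (r * z)) z := by
  have hz0 := Complex.slitPlane_ne_zero hz
  have h := (hasDerivAt_id z).cpow_const (c := ((r⁻¹ : ℝ) : ℂ)) hz
  refine h.congr_deriv ?_
  rw [id, Complex.cpow_sub _ _ hz0, Complex.cpow_one, principalRoot]
  push_cast
  field_simp

theorem deriv_principalRoot_ne_zero (hr : 1 ≤ r) (hz : z ∈ Complex.slitPlane) :
    principalRoot r z / (r * z) ≠ 0 := by
  have hz0 := Complex.slitPlane_ne_zero hz
  have hr0 : (r : ℂ) ≠ 0 := by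
    have : r ≠ 0 := by positivity
    exact_mod_cast this
  exact div_ne_zero (principalRoot_ne_zero hz0) (mul_ne_zero hr0 hz0)

theorem principalRoot_injOn (hr : 1 ≤ r) : InjOn (principalRoot r) Complex.slitPlane := by
  intro z hz w hw h
  rw [← principalRoot_cpow hr (Complex.slitPlane_ne_zero hz), h,
    principalRoot_cpow hr (Complex.slitPlane_ne_zero hw)]

theorem principalRoot_rpow (hr : 1 ≤ r) {x : ℝ} (hx : 0 < x) :
    principalRoot r ((x ^ r : ℝ) : ℂ) = x := by
  rw [principalRoot_ofReal (Real.rpow_pos_of_pos hx r).le, rpow_inv_rpow_self hx hr]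

theorem rpow_mem_slitPlane {x : ℝ} (hx : 0 < x) : ((x ^ r : ℝ) : ℂ) ∈ Complex.slitPlane :=
  Or.inl (by simpa using Real.rpow_pos_of_pos hx r)

theorem dslope_principalRoot_ne_zero (hr : 1 ≤ r) {w : ℂ} (hw : w ∈ Complex.slitPlane)
    (hz : z ∈ Complex.slitPlane) : dslope (principalRoot r) w z ≠ 0 := by
  by_cases h : z = w
  · rw [h, dslope_same, (hasDerivAt_principalRoot hw).deriv]
    exact deriv_principalRoot_ne_zero hr hw
  · rw [dslope_of_ne _ h, slope_def_field]
    exact div_ne_zero (sub_ne_zero.2 fun h' => h (principalRoot_injOn hr hz hw h'))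
      (sub_ne_zero.2 h)

theorem isOpen_slitPlane_nhds {w : ℂ} (hw : w ∈ Complex.slitPlane) :
    Complex.slitPlane ∈ 𝓝 w := Complex.isOpen_slitPlane.mem_nhds hw

/-- The residue at `x = z ^ (1 / r)` of the integrand of the Cauchy transform. -/
noncomputable def fGIGResidue (r α β : ℝ) (z : ℂ) : ℂ :=
  fGIGFactor α β (principalRoot r z) * (principalRoot r z / (r * z))

theorem differentiableAt_fGIGFactor {ζ : ℂ} (hζ : ζ ≠ 0) :
    DifferentiableAt ℂ (fGIGFactor α β) ζ := by
  have hpi : (2 * Real.pi : ℂ) ≠ 0 := by exact_mod_cast (mul_pos two_pos Real.pi_pos).ne'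
  exact (((differentiableAt_const _).div differentiableAt_id hζ).const_add _).div
    (differentiableAt_id.const_mul _) (mul_ne_zero hpi hζ)

theorem differentiableAt_fGIGResidue (hr : 1 ≤ r) (hz : z ∈ Complex.slitPlane) :
    DifferentiableAt ℂ (fGIGResidue r α β) z := by
  have hz0 := Complex.slitPlane_ne_zero hz
  have hr0 : (r : ℂ) ≠ 0 := by
    have : r ≠ 0 := by positivity
    exact_mod_cast this
  refine ((differentiableAt_fGIGFactor (principalRoot_ne_zero hz0)).comp z
    (differentiableAt_principalRoot hz)).mul ?_
  exact (differentiableAt_principalRoot hz).div (differentiableAt_id.const_mul _)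
    (mul_ne_zero hr0 hz0)

/-- The integrand of the Cauchy transform with its pole removed. -/
noncomputable def fGIGRegular (r α β : ℝ) (z : ℂ) (x : ℝ) : ℂ :=
  dslope (fun z => fGIGFactor α β x -
    fGIGResidue r α β z / dslope (principalRoot r) ((x ^ r : ℝ) : ℂ) z) ((x ^ r : ℝ) : ℂ) z

theorem differentiableOn_fGIGRegular (hr : 1 ≤ r) {x : ℝ} (hx : 0 < x) :
    DifferentiableOn ℂ (fun z => fGIGRegular r α β z x) Complex.slitPlane := by
  have hX := rpow_mem_slitPlane (r := r) hx
  refine (Complex.differentiableOn_dslope (isOpen_slitPlane_nhds hX)).2 ?_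
  refine DifferentiableOn.const_sub (DifferentiableOn.div (fun z hz =>
    (differentiableAt_fGIGResidue hr hz).differentiableWithinAt) ?_
    fun z hz => dslope_principalRoot_ne_zero hr hX hz) _
  exact (Complex.differentiableOn_dslope (isOpen_slitPlane_nhds hX)).2 fun z hz =>
    (differentiableAt_principalRoot hz).differentiableWithinAt

theorem fGIGRegular_eq (hr : 1 ≤ r) {x : ℝ} (hx : 0 < x) (hz : z ∈ Complex.slitPlane)
    (hzx : z ≠ ((x ^ r : ℝ) : ℂ)) : fGIGRegular r α β z x =
      fGIGFactor α β x * (z - ((x ^ r : ℝ) : ℂ))⁻¹ -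
        fGIGResidue r α β z * (principalRoot r z - x)⁻¹ := by
  have hX := rpow_mem_slitPlane (r := r) hx
  have hne := sub_ne_zero.2 hzx
  have hne' : principalRoot r z - x ≠ 0 := by
    rw [← principalRoot_rpow hr hx]
    exact sub_ne_zero.2 fun h => hzx (principalRoot_injOn hr hz hX h)
  have hzero : fGIGFactor α β x - fGIGResidue r α β ((x ^ r : ℝ) : ℂ) /
      dslope (principalRoot r) ((x ^ r : ℝ) : ℂ) ((x ^ r : ℝ) : ℂ) = 0 := by
    rw [dslope_same, (hasDerivAt_principalRoot hX).deriv, fGIGResidue,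
      mul_div_cancel_right₀ _ (deriv_principalRoot_ne_zero hr hX), principalRoot_rpow hr hx,
      sub_self]
  rw [fGIGRegular, dslope_of_ne _ hzx, slope_def_field, hzero, sub_zero, dslope_of_ne _ hzx,
    slope_def_field, principalRoot_rpow hr hx]
  field_simp

/-- The mean of the continuations of the Cauchy transform from both half-planes. -/
noncomputable def fGIGMean (a b r α β : ℝ) (z : ℂ) : ℂ :=
  (∫ x in Icc a b, (Real.sqrt ((x - a) * (b - x)) : ℂ) * fGIGRegular r α β z x) +
    fGIGResidue r α β z * (Real.pi * (principalRoot r z - (a + b) / 2))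

theorem differentiableOn_fGIGMean (ha : 0 < a) (hr : 1 ≤ r) :
    DifferentiableOn ℂ (fGIGMean a b r α β) Complex.slitPlane := by
  intro z hz
  have hr0 : 0 < r := by positivity
  refine DifferentiableAt.differentiableWithinAt (DifferentiableAt.add ?_ ?_)
  · refine differentiableAt_integral_removable Complex.isOpen_slitPlane
      (p := fun x => x ^ r) (w := fun x => Real.sqrt ((x - a) * (b - x)))
      (J := fGIGRegular r α β) (Φ := fun q => fGIGFactor α β q.2 * (q.1 - ((q.2 ^ r : ℝ) : ℂ))⁻¹ -
        fGIGResidue r α β q.1 * (principalRoot r q.1 - q.2)⁻¹) ?_ ?_ ?_ ?_ ?_ ?_ hz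
    · exact (Real.continuous_rpow_const hr0.le).continuousOn
    · exact (Real.strictMonoOn_rpow_Ici_of_exponent_pos hr0).injOn.mono
        fun x hx => ha.le.trans hx.1
    · fun_prop
    · rintro ⟨w, x⟩ ⟨hw, hx, hwx⟩
      have hx0 : 0 < x := ha.trans_le hx.1
      have hxc : (x : ℂ) ≠ 0 := by exact_mod_cast hx0.ne'
      have hne' : principalRoot r w - x ≠ 0 := by
        rw [← principalRoot_rpow hr hx0]
        exact sub_ne_zero.2 fun h =>
          hwx (principalRoot_injOn hr hw (rpow_mem_slitPlane hx0) h)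
      refine ContinuousAt.continuousWithinAt ?_
      have c1 : ContinuousAt (fun q : ℂ × ℝ => (q.2 : ℂ)) (w, x) := by fun_prop
      have c2 : ContinuousAt (fun q : ℂ × ℝ => ((q.2 ^ r : ℝ) : ℂ)) (w, x) :=
        (Complex.continuous_ofReal.comp
          ((Real.continuous_rpow_const hr0.le).comp continuous_snd)).continuousAt
      have c3 : ContinuousAt (fun q : ℂ × ℝ => fGIGFactor α β q.2) (w, x) :=
        ContinuousAt.comp (f := fun q : ℂ × ℝ => (q.2 : ℂ)) (g := fGIGFactor α β)
          (differentiableAt_fGIGFactor hxc).continuousAt c1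
      have c4 : ContinuousAt (fun q : ℂ × ℝ => fGIGResidue r α β q.1) (w, x) :=
        ContinuousAt.comp (f := fun q : ℂ × ℝ => q.1) (g := fGIGResidue r α β)
          (differentiableAt_fGIGResidue hr hw).continuousAt continuousAt_fst
      have c5 : ContinuousAt (fun q : ℂ × ℝ => principalRoot r q.1) (w, x) :=
        ContinuousAt.comp (f := fun q : ℂ × ℝ => q.1) (g := principalRoot r)
          (differentiableAt_principalRoot hw).continuousAt continuousAt_fst
      exact (c3.mul ((continuousAt_fst.sub c2).inv₀ (sub_ne_zero.2 hwx))).sub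
        (c4.mul ((c5.sub c1).inv₀ hne'))
    · exact fun x hx => differentiableOn_fGIGRegular hr (ha.trans_le hx.1)
    · exact fun x hx w hw hwx => fGIGRegular_eq hr (ha.trans_le hx.1) hw hwx
  · exact (differentiableAt_fGIGResidue hr hz).mul
      (((differentiableAt_principalRoot hz).sub_const _).const_mul _)

theorem fGIGMean_eq (ha : 0 < a) (hab : a < b) (hr : 1 ≤ r) {σ : ℝ} (hσ : σ ^ 2 = 1)
    (hz : 0 < σ * z.im) :
    ∫ x in Icc a b, (Real.sqrt ((x - a) * (b - x)) : ℂ) *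
        (fGIGFactor α β x * (z - ((x ^ r : ℝ) : ℂ))⁻¹) =
      fGIGMean a b r α β z + σ * (fGIGJump a b r α β z / 2) := by
  have hzim : z.im ≠ 0 := by rintro h; simp [h] at hz
  have hzs : z ∈ Complex.slitPlane := Or.inr hzim
  have hr0 : 0 < r := by positivity
  have hz0 := Complex.slitPlane_ne_zero hzs
  have hζ0 := principalRoot_ne_zero (r := r) hz0
  have hζ : 0 < σ * (principalRoot r z).im := by
    rcases mul_self_eq_one_iff.1 (by rw [← sq, hσ] : σ * σ = 1) with rfl | rfl
    · simpa using principalRoot_im_pos hr (by simpa using hz)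
    · simpa using principalRoot_im_neg hr (by simpa using hz)
  have hζim : (principalRoot r z).im ≠ 0 := by rintro h; simp [h] at hζ
  have hzx : ∀ x : ℝ, z ≠ ((x ^ r : ℝ) : ℂ) := by
    intro x h
    rw [h] at hzim
    simp at hzim
  have hw : ContinuousOn (fun x : ℝ => (Real.sqrt ((x - a) * (b - x)) : ℂ)) (Icc a b) := by
    fun_prop
  have hi1 : IntegrableOn (fun x : ℝ => (Real.sqrt ((x - a) * (b - x)) : ℂ) *
        (fGIGFactor α β x * (z - ((x ^ r : ℝ) : ℂ))⁻¹)) (Icc a b) := by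
    refine ContinuousOn.integrableOn_Icc (hw.mul (ContinuousOn.mul ?_ ?_))
    · intro x hx
      have hxc : (x : ℂ) ≠ 0 := by exact_mod_cast (ha.trans_le hx.1).ne'
      exact (ContinuousAt.comp (f := fun x : ℝ => (x : ℂ)) (g := fGIGFactor α β)
        (differentiableAt_fGIGFactor hxc).continuousAt
        Complex.continuous_ofReal.continuousAt).continuousWithinAt
    · refine Continuous.continuousOn (Continuous.inv₀ ?_ fun x => sub_ne_zero.2 (hzx x))
      exact continuous_const.sub (Complex.continuous_ofReal.comp
        (Real.continuous_rpow_const hr0.le))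
  have hi2 : IntegrableOn (fun x : ℝ => (Real.sqrt ((x - a) * (b - x)) : ℂ) *
        (principalRoot r z - x)⁻¹) (Icc a b) := by
    refine ContinuousOn.integrableOn_Icc (hw.mul (Continuous.continuousOn
      (Continuous.inv₀ (by fun_prop) fun x h => hζim ?_)))
    rw [sub_eq_zero.1 h, Complex.ofReal_im]
  have hE : ∫ x in Icc a b, (Real.sqrt ((x - a) * (b - x)) : ℂ) * fGIGRegular r α β z x =
      (∫ x in Icc a b, (Real.sqrt ((x - a) * (b - x)) : ℂ) *
        (fGIGFactor α β x * (z - ((x ^ r : ℝ) : ℂ))⁻¹)) - fGIGResidue r α β z *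
      ∫ x in Icc a b, (Real.sqrt ((x - a) * (b - x)) : ℂ) * (principalRoot r z - x)⁻¹ := by
    rw [← integral_const_mul, ← integral_sub hi1 (hi2.const_mul _)]
    refine setIntegral_congr_fun measurableSet_Icc fun x hx => ?_
    rw [fGIGRegular_eq hr (ha.trans_le hx.1) hzs (hzx x)]
    ring
  have hpi : (Real.pi : ℂ) ≠ 0 := by exact_mod_cast Real.pi_ne_zero
  have hrc : (r : ℂ) ≠ 0 := by exact_mod_cast hr0.ne'
  rw [fGIGMean, hE, integral_Icc_semicircle hab hσ hζ, fGIGJump, fGIGResidue, fGIGFactor]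
  field_simp
  ring

end Continuation

theorem tendsto_re_of_jump {G E N : ℂ → ℂ} {x : ℝ} {L : ℂ}
    (hconj : ∀ z, G (starRingEnd ℂ z) = starRingEnd ℂ (G z))
    (hup : ∀ z : ℂ, 0 < z.im → G z = E z + N z / 2)
    (hlow : ∀ z : ℂ, z.im < 0 → G z = E z - N z / 2)
    (hE : ContinuousAt E x) (hN : Tendsto N (𝓝 (x : ℂ)) (𝓝 L)) :
    Tendsto (fun ε : ℝ => (((G (x + ε * Complex.I)).re : ℝ) : ℂ)) (𝓝[>] 0) (𝓝 (E x)) := by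
  have hp : Tendsto (fun ε : ℝ => (x : ℂ) + ε * Complex.I) (𝓝[>] 0) (𝓝 (x : ℂ)) := by
    have : Continuous (fun ε : ℝ => (x : ℂ) + ε * Complex.I) := by fun_prop
    simpa using (this.tendsto 0).mono_left nhdsWithin_le_nhds
  have hq : Tendsto (fun ε : ℝ => starRingEnd ℂ ((x : ℂ) + ε * Complex.I)) (𝓝[>] 0)
      (𝓝 (x : ℂ)) := by
    have := (Complex.continuous_conj.tendsto (x : ℂ)).comp hp
    rwa [Complex.conj_ofReal] at this
  have h := (((hE.tendsto.comp hp).add ((hN.comp hp).div_const 2)).add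
    ((hE.tendsto.comp hq).sub ((hN.comp hq).div_const 2))).div_const 2
  rw [show (E x + L / 2 + (E x - L / 2)) / 2 = E x by ring] at h
  refine h.congr' ?_
  filter_upwards [self_mem_nhdsWithin] with ε hε
  have hε' : (0 : ℝ) < ε := hε
  have h1 := hup ((x : ℂ) + ε * Complex.I) (by simpa using hε')
  have h2 := hlow (starRingEnd ℂ ((x : ℂ) + ε * Complex.I)) (by simpa using hε')
  rw [Complex.re_eq_add_conj, ← hconj, h1, h2]
  rfl

theorem continuationData_map_fGIG {a b α₁ α₂ r : ℝ} (ha : 0 < a) (hab : a < b) (hα₁ : 0 < α₁)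
    (hα₂ : 0 < α₂) (hr : 1 ≤ r) [IsProbabilityMeasure (fGIG a b α₁ α₂)] :
    ContinuationData (a ^ r) (b ^ r)
      (cauchyTransform (Measure.map (fun x : ℝ => x ^ r) (fGIG a b α₁ α₂)))
      (fGIGMean a b r α₁ (α₂ / √(a * b))) (fGIGJump a b r α₁ (α₂ / √(a * b)))
      (fun z => principalRoot r z / z) (α₁ / r) := by
  have hb := ha.trans hab
  have hr0 : 0 < r := by positivity
  have hβ : 0 < α₂ / √(a * b) := by positivity
  have hA := Real.rpow_pos_of_pos ha r
  have hAB : a ^ r < b ^ r := Real.rpow_lt_rpow ha.le hab hr0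
  have hν := ae_map_fGIG_mem_Ioo (b := b) (α₁ := α₁) (α₂ := α₂) ha hr
  have : IsProbabilityMeasure (Measure.map (fun x : ℝ => x ^ r) (fGIG a b α₁ α₂)) :=
    Measure.isProbabilityMeasure_map (by fun_prop)
  set ν := Measure.map (fun x : ℝ => x ^ r) (fGIG a b α₁ α₂) with hνdef
  set β := α₂ / √(a * b) with hβdef
  have hup : ∀ z : ℂ, 0 < z.im →
      cauchyTransform ν z = fGIGMean a b r α₁ β z + fGIGJump a b r α₁ β z / 2 := by
    intro z hz
    rw [hνdef, cauchyTransform_map_fGIG ha hab hα₁ hα₂,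
      fGIGMean_eq ha hab hr (σ := 1) (by norm_num) (by simpa using hz)]
    simp [hβdef]
  have hlow : ∀ z : ℂ, z.im < 0 →
      cauchyTransform ν z = fGIGMean a b r α₁ β z - fGIGJump a b r α₁ β z / 2 := by
    intro z hz
    rw [hνdef, cauchyTransform_map_fGIG ha hab hα₁ hα₂,
      fGIGMean_eq ha hab hr (σ := -1) (by norm_num) (by simpa using hz)]
    push_cast
    ring
  have hE : ∀ x : ℝ, a ^ r ≤ x → ContinuousAt (fGIGMean a b r α₁ β) x := fun x hx =>
    ((differentiableOn_fGIGMean ha hr).differentiableAt (Complex.isOpen_slitPlane.mem_nhds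
      (Complex.ofReal_mem_slitPlane.2 (hA.trans_le hx)))).continuousAt
  have hNl : Tendsto (fGIGJump a b r α₁ β) (𝓝 ((a ^ r : ℝ) : ℂ)) (𝓝 0) :=
    tendsto_fGIGJump_left ha hr
  have hNr : Tendsto (fGIGJump a b r α₁ β) (𝓝 ((b ^ r : ℝ) : ℂ)) (𝓝 0) :=
    tendsto_fGIGJump_right hb hr
  have hlim : ∀ x : ℝ, a ^ r ≤ x → x ≤ b ^ r →
      Tendsto (fun ε : ℝ => (((cauchyTransform ν (x + ε * Complex.I)).re : ℝ) : ℂ)) (𝓝[>] 0)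
        (𝓝 (fGIGMean a b r α₁ β x)) := by
    intro x hx1 hx2
    obtain ⟨L, hL⟩ : ∃ L, Tendsto (fGIGJump a b r α₁ β) (𝓝 (x : ℂ)) (𝓝 L) := by
      rcases hx1.eq_or_lt with rfl | hx1
      · exact ⟨0, hNl⟩
      rcases hx2.eq_or_lt with rfl | hx2
      · exact ⟨0, hNr⟩
      have hopen : IsOpen {z : ℂ | a ^ r < z.re ∧ z.re < b ^ r} :=
        (isOpen_lt continuous_const Complex.continuous_re).inter
          (isOpen_lt Complex.continuous_re continuous_const)
      exact ⟨_, ((differentiableOn_fGIGJump ha hab hr).differentiableAt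
        (mem_of_superset (hopen.mem_nhds (x := (x : ℂ)) ⟨hx1, hx2⟩)
          fun z hz => Or.inr hz)).continuousAt.tendsto⟩
    exact tendsto_re_of_jump cauchyTransform_conj hup hlow (hE x hx1) hL
  have hlim_re : ∀ x : ℝ, a ^ r ≤ x → x ≤ b ^ r →
      Tendsto (fun ε : ℝ => (cauchyTransform ν (x + ε * Complex.I)).re) (𝓝[>] 0)
        (𝓝 (fGIGMean a b r α₁ β x).re) := fun x hx1 hx2 =>
    ((Complex.continuous_re.tendsto _).comp (hlim x hx1 hx2)).congr fun ε => Complex.ofReal_re _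
  have hunit : ∀ᶠ ε : ℝ in 𝓝[>] 0, 0 < ε ∧ ε ≤ 1 := Ioc_mem_nhdsGT one_pos
  exact
    { A_pos := hA
      A_lt_B := hAB
      c₀_pos := by positivity
      G_diff := fun z hz => differentiableAt_cauchyTransform hν hz
      G_im_neg := fun z hz => cauchyTransform_im_neg hν hz
      G_im_pos := fun z hz => cauchyTransform_im_pos hν hz
      G_left := fun x hx => ⟨cauchyTransform_ofReal_im x,
        cauchyTransform_re_neg hν (Or.inr (Or.inl hx)) hx.le⟩
      G_right := fun x hx => ⟨cauchyTransform_ofReal_im x,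
        cauchyTransform_re_pos hν (Or.inr (Or.inr hx)) hx.le⟩
      G_infty := tendsto_mul_cauchyTransform hν
      E_diff := differentiableOn_fGIGMean ha hr
      E_upper := hup
      E_lower := hlow
      E_real := fun x hx1 hx2 => by
        have h := (Complex.continuous_im.tendsto _).comp (hlim x hx1 hx2)
        refine tendsto_nhds_unique h (tendsto_const_nhds.congr fun ε => ?_)
        simp
      E_left := by
        have h : (fGIGMean a b r α₁ β ((a ^ r : ℝ) : ℂ)).re ≤
            (cauchyTransform ν ((a ^ r : ℝ) + (1 : ℝ) * Complex.I)).re :=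
          le_of_tendsto (hlim_re _ le_rfl hAB.le)
            (hunit.mono fun ε hε => cauchyTransform_re_le_left hν hε.1 hε.2)
        exact h.trans_lt (cauchyTransform_re_neg hν (Or.inl (by simp)) (by simp))
      E_right := by
        have h : (cauchyTransform ν ((b ^ r : ℝ) + (1 : ℝ) * Complex.I)).re ≤
            (fGIGMean a b r α₁ β ((b ^ r : ℝ) : ℂ)).re :=
          ge_of_tendsto (hlim_re _ hAB.le le_rfl)
            (hunit.mono fun ε hε => cauchyTransform_re_le_right hν hε.1 hε.2)
        exact (cauchyTransform_re_pos hν (Or.inl (by simp)) (by simp)).trans_le h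
      N_diff := differentiableOn_fGIGJump ha hab hr
      N_left := hNl.mono_left nhdsWithin_le_nhds
      N_right := hNr.mono_left nhdsWithin_le_nhds
      N_mid := fun x hx1 hx2 => fGIGJump_mid ha hab hr hα₁ hβ hx1 hx2
      N_ne := fun z hz => fGIGJump_ne_zero hab hr hβ hz
      N_neg := fun x hx => asympHalfPlane_fGIGJump_neg ha hab hr hα₁ hβ hx
      N_half_left := asympHalfPlane_fGIGJump_left ha hab hr hα₁ hβ
      N_half_right := fun x hx => asympHalfPlane_fGIGJump_right ha hab hr hα₁ hβ hx
      N_sq := fun x hx hx' => fGIGJump_sq_pos ha hab hr hα₁ hβ hx hx'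
      N_zero := tendsto_norm_fGIGJump_zero ha hab hr hβ
      h_im := fun z hz => principalRoot_div_im_nonneg hr hz
      h_ne := fun z hz => by
        have hz0 : z ≠ 0 := by rintro rfl; simp at hz
        exact div_ne_zero (principalRoot_ne_zero hz0) hz0
      h_infty := tendsto_norm_mul_principalRoot_div hr
      N_infty := tendsto_fGIGJump_div ha hab hr }

theorem isUI_map_fGIG_of_one_le {a b α₁ α₂ r : ℝ} (ha : 0 < a) (hab : a < b) (hα₁ : 0 < α₁)
    (hα₂ : 0 < α₂) (hr : 1 ≤ r) [IsProbabilityMeasure (fGIG a b α₁ α₂)] :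
    IsUI (Measure.map (fun x : ℝ => x ^ r) (fGIG a b α₁ α₂)) :=
  (continuationData_map_fGIG ha hab hα₁ hα₂ hr).exists_univalent_inverse

theorem fGIG_apply (a b α₁ α₂ : ℝ) {t : Set ℝ} (ht : MeasurableSet t) :
    fGIG a b α₁ α₂ t = ∫⁻ x in Ioo a b, t.indicator (fun x => ENNReal.ofReal
      (Real.sqrt ((x - a) * (b - x)) / (2 * Real.pi * x) *
        (α₁ + α₂ / (Real.sqrt (a * b) * x)))) x := by
  rw [fGIG, withDensity_apply _ ht, ← lintegral_indicator ht,
    ← lintegral_indicator measurableSet_Ioo]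
  refine lintegral_congr fun x => ?_
  by_cases hx : x ∈ Ioo a b <;> by_cases hxt : x ∈ t <;> simp [hx, hxt]

theorem fGIG_density_inv {a b α₁ α₂ x : ℝ} (ha : 0 < a) (hab : a < b) (hx : x ∈ Ioo a b) :
    |-(x ^ 2)⁻¹| * (Real.sqrt ((x⁻¹ - b⁻¹) * (a⁻¹ - x⁻¹)) / (2 * Real.pi * x⁻¹) *
      (α₂ + α₁ / (Real.sqrt (b⁻¹ * a⁻¹) * x⁻¹))) =
    Real.sqrt ((x - a) * (b - x)) / (2 * Real.pi * x) *
      (α₁ + α₂ / (Real.sqrt (a * b) * x)) := by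
  have hb := ha.trans hab
  have hx0 := ha.trans hx.1
  have hab0 : 0 < √(a * b) := Real.sqrt_pos.2 (mul_pos ha hb)
  have h1 : √(b⁻¹ * a⁻¹) = (√(a * b))⁻¹ := by rw [← Real.sqrt_inv, mul_inv, mul_comm]
  have h2 : √((x⁻¹ - b⁻¹) * (a⁻¹ - x⁻¹)) = √((x - a) * (b - x)) / (√(a * b) * x) := by
    rw [show (x⁻¹ - b⁻¹) * (a⁻¹ - x⁻¹) = (x - a) * (b - x) / ((a * b) * x ^ 2) by
      field_simp, Real.sqrt_div' _ (by positivity), Real.sqrt_mul (mul_pos ha hb).le,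
      Real.sqrt_sq hx0.le]
  rw [h1, h2, abs_neg, abs_of_pos (by positivity)]
  field_simp
  ring

theorem map_inv_fGIG {a b α₁ α₂ : ℝ} (ha : 0 < a) (hab : a < b) :
    Measure.map (fun x : ℝ => x⁻¹) (fGIG a b α₁ α₂) = fGIG b⁻¹ a⁻¹ α₂ α₁ := by
  have hb := ha.trans hab
  have himg : (fun x : ℝ => x⁻¹) '' Ioo a b = Ioo b⁻¹ a⁻¹ := by
    ext y
    constructor
    · rintro ⟨x, hx, rfl⟩
      exact ⟨inv_strictAnti₀ (ha.trans hx.1) hx.2, inv_strictAnti₀ ha hx.1⟩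
    · intro hy
      have hy0 : 0 < y := (inv_pos.2 hb).trans hy.1
      exact ⟨y⁻¹, ⟨lt_inv_of_lt_inv₀ hy0 hy.2, inv_lt_of_inv_lt₀ hb hy.1⟩, inv_inv y⟩
  ext s hs
  rw [Measure.map_apply measurable_inv hs, fGIG_apply _ _ _ _ (measurable_inv hs),
    fGIG_apply _ _ _ _ hs, ← himg, lintegral_image_eq_lintegral_abs_deriv_mul measurableSet_Ioo
      (fun x hx => (hasDerivAt_inv (ha.trans hx.1).ne').hasDerivWithinAt) inv_injective.injOn]
  refine setLIntegral_congr_fun measurableSet_Ioo fun x hx => ?_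
  by_cases hxs : x⁻¹ ∈ s
  · have hxs' : x ∈ (fun x : ℝ => x⁻¹) ⁻¹' s := hxs
    simp only [indicator_of_mem hxs, indicator_of_mem hxs']
    rw [← ENNReal.ofReal_mul (abs_nonneg _), fGIG_density_inv ha hab hx]
  · have hxs' : x ∉ (fun x : ℝ => x⁻¹) ⁻¹' s := hxs
    simp only [indicator_of_notMem hxs, indicator_of_notMem hxs', mul_zero]

theorem map_rpow_fGIG_eq {a b α₁ α₂ : ℝ} (ha : 0 < a) (hab : a < b) (r : ℝ) :
    Measure.map (fun x : ℝ => x ^ r) (fGIG a b α₁ α₂) =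
      Measure.map (fun x : ℝ => x ^ (-r)) (fGIG b⁻¹ a⁻¹ α₂ α₁) := by
  rw [← map_inv_fGIG ha hab, Measure.map_map (by fun_prop) measurable_inv]
  refine Measure.map_congr ?_
  filter_upwards [ae_fGIG_mem_Ioo a b α₁ α₂] with x hx
  have hx0 := (ha.trans hx.1).le
  simp [Real.rpow_neg (inv_nonneg.2 hx0), Real.inv_rpow hx0]

end UnivalentInverse

/-- If `X` follows the fGIG distribution, then `X^r ∈ UI` for every `r` with `|r| ≥ 1`. -/
theorem fGIG_power_UI (a b α₁ α₂ : ℝ) (ha : 0 < a) (hab : a < b)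
    (hα₁ : 0 < α₁) (hα₂ : 0 < α₂)
    (hprob : IsProbabilityMeasure (fGIG a b α₁ α₂))
    (r : ℝ) (hr : 1 ≤ |r|) :
    IsUI (Measure.map (fun x : ℝ => x ^ r) (fGIG a b α₁ α₂)) := by
  rcases le_abs.1 hr with h | h
  · exact isUI_map_fGIG_of_one_le ha hab hα₁ hα₂ h
  · have : IsProbabilityMeasure (fGIG b⁻¹ a⁻¹ α₂ α₁) :=
      map_inv_fGIG ha hab ▸ Measure.isProbabilityMeasure_map (by fun_prop)
    rw [map_rpow_fGIG_eq ha hab]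
    exact isUI_map_fGIG_of_one_le (inv_pos.2 (ha.trans hab)) (inv_strictAnti₀ ha hab) hα₂ hα₁ h
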